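/- (Uniform Siegel–Walfisz theorem.) Let C > 0 be given. Then there exists a constant D = D(C) > 0 such that for all x ≥ 2, all real y with 2 ≤ y ≤ x, all positive integers q ≤ (log x)^C, and all integers a with gcd(a,q) = 1, one has π(y;q,a) = (1/φ(q))·∫_2^y dt/log t + O(x·e^{−D·√(log x)}), with an implied constant depending only on C. -/

import Mathlib

open scoped Classical

/-- `π(y; q, a)`: number of primes `l ≤ y` with `l ≡ a (mod q)`. -/
noncomputable def primePiMod (y : ℝ) (q : ℕ) (a : ℤ) : ℕ :=
  ((Finset.Icc 1 ⌊y⌋₊).filter (fun n : ℕ => n.Prime ∧ (n : ℤ) ≡ a [ZMOD (q : ℤ)])).card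

section LogarithmicDerivative

open Complex Metric

/-- Borel–Carathéodory bound for the logarithmic derivative of a nonvanishing function on a disc. -/
lemma norm_logDeriv_le_of_ne_zero {f : ℂ → ℂ} {c : ℂ} {R M : ℝ} (hR : 0 < R) (hM : 0 < M)
    (hf : DifferentiableOn ℂ f (ball c R)) (h0 : ∀ z ∈ ball c R, f z ≠ 0)
    (hb : ∀ z ∈ ball c R, ‖f z‖ ≤ Real.exp M * ‖f c‖) {z : ℂ} (hz : dist z c ≤ R / 2) :
    ‖deriv f z / f z‖ ≤ 24 * M / R := by
  have hdf : DifferentiableOn ℂ (fun z ↦ deriv f z / f z) (ball c R) :=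
    (hf.deriv isOpen_ball).div hf h0
  obtain ⟨g, hgc, hg⟩ := hdf.isExactOn_ball.with_val_at c 0
  have hcR : c ∈ ball c R := mem_ball_self hR
  have hgd : DifferentiableOn ℂ g (ball c R) := fun w hw ↦
    (hg w hw).differentiableAt.differentiableWithinAt
  have hconst : ∀ w ∈ ball c R, f w * exp (-g w) = f c := by
    intro w hw
    have hd : ∀ u ∈ ball c R, HasDerivAt (fun u ↦ f u * exp (-g u)) 0 u := by
      intro u hu
      have h1 : HasDerivAt f (deriv f u) u :=
        (hf.differentiableAt (isOpen_ball.mem_nhds hu)).hasDerivAt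
      have h2 := h1.mul ((hg u hu).neg.cexp)
      have h3 : deriv f u / f u * f u = deriv f u := div_mul_cancel₀ _ (h0 u hu)
      have h4 : 0 = deriv f u * exp (-g u) + f u * (exp (-g u) * -(deriv f u / f u)) := by
        linear_combination exp (-g u) * h3
      rw [h4]
      exact h2
    have := (convex_ball c R).is_const_of_fderivWithin_eq_zero (𝕜 := ℂ)
      (f := fun u ↦ f u * exp (-g u))
      (fun u hu ↦ (hd u hu).differentiableAt.differentiableWithinAt) (fun u hu ↦ by
        rw [fderivWithin_of_isOpen isOpen_ball hu, (hd u hu).hasFDerivAt.fderiv]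
        ext; simp) hw hcR
    simpa [hgc] using this
  have hre : ∀ w ∈ ball c R, (g w).re ≤ M := by
    intro w hw
    have h1 : f w = f c * exp (g w) := by
      rw [← hconst w hw, mul_assoc, ← exp_add]; simp
    have h2 := hb w hw
    rw [h1, norm_mul, norm_exp, mul_comm] at h2
    have h3 : 0 < ‖f c‖ := norm_pos_iff.mpr (h0 c hcR)
    exact Real.exp_le_exp.mp (le_of_mul_le_mul_right h2 h3)
  have hbound : ∀ w, dist w c ≤ 3 * R / 4 → ‖g w‖ ≤ 6 * M := by
    intro w hw
    have hmaps : ∀ u ∈ ball (0 : ℂ) R, u + c ∈ ball c R := fun u hu ↦ by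
      simpa [dist_eq_norm] using hu
    have hw' : ‖w - c‖ ≤ 3 * R / 4 := by rwa [← dist_eq_norm]
    have h := borelCaratheodory_zero (f := fun u ↦ g (u + c)) (z := w - c) hM
      (hgd.comp (by fun_prop) hmaps) (fun u hu ↦ hre _ (hmaps u hu)) hR
      (by rw [mem_ball_zero_iff]; linarith) (by simpa using hgc)
    simp only [sub_add_cancel] at h
    refine h.trans ?_
    rw [div_le_iff₀ (by linarith)]
    nlinarith
  have hsub : closedBall z (R / 4) ⊆ ball c R := by
    intro w hw
    rw [mem_closedBall] at hw
    rw [mem_ball]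
    linarith [dist_triangle w z c]
  have hzR : z ∈ ball c R := hsub (mem_closedBall_self (by positivity))
  have hder := norm_deriv_le_of_forall_mem_sphere_norm_le (f := g) (c := z) (R := R / 4)
    (C := 6 * M) (by positivity)
    ((hgd.mono hsub).diffContOnCl_ball subset_rfl)
    (fun w hw ↦ hbound w (by
      rw [mem_sphere] at hw
      linarith [dist_triangle w z c]))
  rw [(hg z hzR).deriv] at hder
  refine hder.trans (le_of_eq ?_)
  field_simp
  ring

/-- Dividing an entire function by a Blaschke factor for one of its zeros. -/
lemma exists_div_blaschke {f : ℂ → ℂ} (hf : Differentiable ℂ f) {R A : ℝ} (hR : 0 < R) (h0 : f 0 ≠ 0)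
    (hA : ∀ z ∈ closedBall (0 : ℂ) R, ‖f z‖ ≤ A) {ρ : ℂ} (hρ : ‖ρ‖ ≤ R / 2) (hfρ : f ρ = 0) :
    ∃ g : ℂ → ℂ, Differentiable ℂ g ∧ (∀ z ∈ closedBall (0 : ℂ) R, ‖g z‖ ≤ A) ∧
      2 * ‖f 0‖ ≤ ‖g 0‖ ∧ (∀ z ∈ closedBall (0 : ℂ) R, g z = 0 → f z = 0) ∧
      deriv f 0 / f 0 = deriv g 0 / g 0 + (-1 / ρ + (starRingEnd ℂ) ρ / R ^ 2) := by
  have hρ0 : ρ ≠ 0 := fun h ↦ h0 (h ▸ hfρ)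
  have hρpos : 0 < ‖ρ‖ := norm_pos_iff.mpr hρ0
  have hRC : (R : ℂ) ≠ 0 := by exact_mod_cast hR.ne'
  set d : ℂ → ℂ := dslope f ρ with hd
  have hdd : Differentiable ℂ d := by
    intro z
    have := (differentiableOn_dslope (c := ρ) (f := f) (s := Set.univ) (by simp)).mpr
      hf.differentiableOn
    exact (this z trivial).differentiableAt (by simp)
  have hfd : ∀ z, f z = (z - ρ) * d z := fun z ↦ by
    have := sub_smul_dslope f ρ z
    rw [hfρ, sub_zero, smul_eq_mul] at this
    exact this.symm
  set n : ℂ → ℂ := fun z ↦ (R ^ 2 - (starRingEnd ℂ) ρ * z) / R with hn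
  have hnd : Differentiable ℂ n := by fun_prop
  have hn0 : n 0 = R := by simp [hn]; field_simp
  have hnne : ∀ z ∈ closedBall (0 : ℂ) R, n z ≠ 0 := by
    intro z hz h
    rw [mem_closedBall_zero_iff] at hz
    simp only [hn, div_eq_zero_iff, hRC, or_false, sub_eq_zero] at h
    have h2 := congrArg norm h
    rw [norm_mul, norm_conj, norm_pow, norm_real, Real.norm_of_nonneg hR.le] at h2
    nlinarith [norm_nonneg z]
  have hgd : Differentiable ℂ (fun z ↦ d z * n z) := hdd.mul hnd
  have hd0 : d 0 ≠ 0 := fun h ↦ h0 (by rw [hfd, h, mul_zero])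
  refine ⟨fun z ↦ d z * n z, hgd, ?_, ?_, ?_, ?_⟩
  · intro z hz
    refine norm_le_of_forall_mem_frontier_norm_le (isBounded_ball (x := (0 : ℂ)) (r := R))
      (hgd.diffContOnCl) ?_ (by rwa [closure_ball _ hR.ne'])
    intro w hw
    rw [frontier_ball _ hR.ne', mem_sphere_zero_iff_norm] at hw
    have h1 : ‖n w‖ = ‖w - ρ‖ := by
      have h2 : (R : ℂ) ^ 2 = w * (starRingEnd ℂ) w := by
        rw [mul_conj, normSq_eq_norm_sq, hw]; push_cast; ring
      have h3 : n w = w * (starRingEnd ℂ) (w - ρ) / R := by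
        simp only [hn, h2, map_sub]; ring
      rw [h3, norm_div, norm_mul, norm_conj, norm_real, Real.norm_of_nonneg hR.le, hw]
      field_simp
    rw [norm_mul, h1, mul_comm, ← norm_mul, ← hfd]
    exact hA w (by rw [mem_closedBall_zero_iff, hw])
  · simp only [hn0, norm_mul, norm_real, Real.norm_of_nonneg hR.le]
    rw [hfd 0, norm_mul, zero_sub, norm_neg]
    nlinarith [norm_nonneg (d 0)]
  · intro z hz h
    rw [hfd, (mul_eq_zero.mp h).resolve_right (hnne z hz), mul_zero]
  · have hf' : deriv f 0 = d 0 + (0 - ρ) * deriv d 0 := by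
      have : f = fun z ↦ (z - ρ) * d z := funext hfd
      rw [this]
      have := ((hasDerivAt_id (0 : ℂ)).sub_const ρ).mul (hdd 0).hasDerivAt
      have h := this.deriv
      simp only [id_eq, one_mul] at h
      exact h
    have hn' : HasDerivAt n (-(starRingEnd ℂ) ρ / R) 0 := by
      have := ((((hasDerivAt_id (0 : ℂ)).const_mul ((starRingEnd ℂ) ρ)).const_sub
        ((R : ℂ) ^ 2)).div_const (R : ℂ))
      simpa [hn] using this
    have hg' : deriv (fun z ↦ d z * n z) 0 = deriv d 0 * R + d 0 * (-(starRingEnd ℂ) ρ / R) := by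
      have := ((hdd 0).hasDerivAt.mul hn').deriv
      rw [hn0] at this
      exact this
    beta_reduce
    rw [hf', hg', hfd 0, hn0]
    field_simp
    ring

lemma re_blaschke_term {ρ : ℂ} {R : ℝ} :
    (-1 / ρ + (starRingEnd ℂ) ρ / R ^ 2).re = -ρ.re * (1 / ‖ρ‖ ^ 2 - 1 / R ^ 2) := by
  have h1 : ((starRingEnd ℂ) ρ / (R : ℂ) ^ 2).re = ρ.re / R ^ 2 := by
    rw [← ofReal_pow, div_ofReal_re, conj_re]
  have h2 : (-1 / ρ).re = -ρ.re / ‖ρ‖ ^ 2 := by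
    rw [div_re, normSq_eq_norm_sq]
    simp
  rw [add_re, h1, h2]
  ring

lemma neg_le_re_logDeriv_zero {R A : ℝ} (hR : 0 < R) (k : ℕ) :
    ∀ f : ℂ → ℂ, Differentiable ℂ f → f 0 ≠ 0 → (∀ z ∈ closedBall (0 : ℂ) R, ‖f z‖ ≤ A) →
      (∀ z ∈ closedBall (0 : ℂ) R, f z = 0 → z.re ≤ 0) → A < 2 ^ k * ‖f 0‖ →
      ∀ M, 0 < M → A ≤ Real.exp M * ‖f 0‖ → -(48 * M / R) ≤ (deriv f 0 / f 0).re := by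
  induction k with
  | zero =>
    intro f _ _ hA _ hlt
    exact absurd (hA 0 (mem_closedBall_self hR.le)) (by linarith)
  | succ k ih =>
    intro f hf h0 hA hz hlt M hM hAM
    by_cases hex : ∃ ρ, ‖ρ‖ ≤ R / 2 ∧ f ρ = 0
    · obtain ⟨ρ, hρ, hfρ⟩ := hex
      have hρ0 : ρ ≠ 0 := fun h ↦ h0 (h ▸ hfρ)
      have hρpos : 0 < ‖ρ‖ := norm_pos_iff.mpr hρ0
      obtain ⟨g, hg, hgA, hg0, hgz, hder⟩ := exists_div_blaschke hf hR h0 hA hρ hfρ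
      have hfpos : 0 < ‖f 0‖ := norm_pos_iff.mpr h0
      have hgpos : 0 < ‖g 0‖ := by linarith
      have hle : ‖f 0‖ ≤ ‖g 0‖ := by linarith
      have key := ih g hg (norm_pos_iff.mp hgpos) hgA (fun z hz' h ↦ hz z hz' (hgz z hz' h))
        (hlt.trans_le (by rw [pow_succ, mul_assoc]; gcongr)) M hM
        (hAM.trans (by gcongr))
      rw [hder, add_re, re_blaschke_term]
      have hre : ρ.re ≤ 0 := hz ρ (by rw [mem_closedBall_zero_iff]; linarith) hfρ
      have : 1 / R ^ 2 ≤ 1 / ‖ρ‖ ^ 2 := by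
        apply one_div_le_one_div_of_le (by positivity)
        gcongr
        linarith
      have := mul_nonneg (neg_nonneg.mpr hre) (sub_nonneg.mpr this)
      linarith
    · push Not at hex
      have h := norm_logDeriv_le_of_ne_zero (f := f) (c := 0) (R := R / 2) (z := 0) (by positivity)
        hM hf.differentiableOn (fun z hz' ↦ hex z (mem_ball_zero_iff.mp hz').le)
        (fun z hz' ↦ (hA z (by
          rw [mem_ball_zero_iff] at hz'; rw [mem_closedBall_zero_iff]; linarith)).trans hAM)
        (by simp; positivity)
      have h2 : 24 * M / (R / 2) = 48 * M / R := by field_simp; ring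
      rw [h2] at h
      linarith [neg_abs_le (deriv f 0 / f 0).re, abs_re_le_norm (deriv f 0 / f 0)]

lemma deriv_comp_add_right (f : ℂ → ℂ) (c : ℂ) :
    deriv (fun z ↦ f (z + c)) 0 = deriv f c := by
  rw [deriv_comp_add_const, zero_add]

/-- Lower bound for the real part of the logarithmic derivative when all nearby zeros lie to
the left. -/
lemma neg_le_re_logDeriv {f : ℂ → ℂ} (hf : Differentiable ℂ f) {c : ℂ} {R M : ℝ} (hR : 0 < R)
    (hM : 0 < M) (h0 : f c ≠ 0) (hb : ∀ z ∈ closedBall c R, ‖f z‖ ≤ Real.exp M * ‖f c‖)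
    (hz : ∀ z ∈ closedBall c R, f z = 0 → z.re ≤ c.re) :
    -(48 * M / R) ≤ (deriv f c / f c).re := by
  have hmaps : ∀ u ∈ closedBall (0 : ℂ) R, u + c ∈ closedBall c R := fun u hu ↦ by
    simpa [dist_eq_norm] using hu
  obtain ⟨k, hk⟩ := pow_unbounded_of_one_lt (Real.exp M) (one_lt_two)
  have hpos : 0 < ‖f c‖ := norm_pos_iff.mpr h0
  have := neg_le_re_logDeriv_zero (A := Real.exp M * ‖f c‖) hR k (fun z ↦ f (z + c))
    (hf.comp (by fun_prop)) (by simpa using h0) (fun z h ↦ hb _ (hmaps z h))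
    (fun z h h' ↦ by simpa using hz _ (hmaps z h) h')
    (by simpa using mul_lt_mul_of_pos_right hk hpos) M hM (by simp)
  rw [deriv_comp_add_right] at this
  simpa using this

/-- A zero to the left of the centre improves the lower bound for the real part of the
logarithmic derivative. -/
lemma neg_add_le_re_logDeriv {f : ℂ → ℂ} (hf : Differentiable ℂ f) {c : ℂ} {R M δ : ℝ} (hR : 0 < R)
    (hM : 0 < M) (h0 : f c ≠ 0) (hb : ∀ z ∈ closedBall c R, ‖f z‖ ≤ Real.exp M * ‖f c‖)
    (hz : ∀ z ∈ closedBall c R, f z = 0 → z.re ≤ c.re) (hδ : 0 < δ) (hδR : δ ≤ R / 2)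
    (hρ : f (c - δ) = 0) :
    -(48 * M / R) + (1 / δ - δ / R ^ 2) ≤ (deriv f c / f c).re := by
  have hmaps : ∀ u ∈ closedBall (0 : ℂ) R, u + c ∈ closedBall c R := fun u hu ↦ by
    simpa [dist_eq_norm] using hu
  have hpos : 0 < ‖f c‖ := norm_pos_iff.mpr h0
  have hnorm : ‖(-δ : ℂ)‖ = δ := by rw [norm_neg, norm_real, Real.norm_of_nonneg hδ.le]
  obtain ⟨g, hg, hgA, hg0, hgz, hder⟩ := exists_div_blaschke (f := fun z ↦ f (z + c))
    (hf.comp (by fun_prop)) hR (A := Real.exp M * ‖f c‖) (by simpa using h0)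
    (fun z h ↦ hb _ (hmaps z h)) (ρ := -δ) (by rwa [hnorm]) (by
      rw [neg_add_eq_sub]; exact hρ)
  obtain ⟨k, hk⟩ := pow_unbounded_of_one_lt (Real.exp M) (one_lt_two)
  have hg0' : ‖f c‖ ≤ ‖g 0‖ := by
    simp only [zero_add] at hg0; linarith
  have key := neg_le_re_logDeriv_zero (A := Real.exp M * ‖f c‖) hR k g hg
    (norm_pos_iff.mp (hpos.trans_le hg0')) hgA
    (fun z h h' ↦ by simpa using hz _ (hmaps z h) (hgz z h h'))
    (calc _ < 2 ^ k * ‖f c‖ := mul_lt_mul_of_pos_right hk hpos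
      _ ≤ _ := by gcongr) M hM (by gcongr)
  rw [deriv_comp_add_right] at hder
  simp only [zero_add] at hder
  rw [hder, add_re, re_blaschke_term, hnorm]
  have : -(-(δ : ℂ)).re * (1 / δ ^ 2 - 1 / R ^ 2) = 1 / δ - δ / R ^ 2 := by
    simp; field_simp
  rw [this]
  linarith

end LogarithmicDerivative

section IntegralRepresentation

open Complex MeasureTheory Set

lemma integral_rpow_Ioi_one {α σ : ℝ} (h : α < σ) :
    ∫ u in Ioi (1 : ℝ), u ^ (α - σ - 1) = 1 / (σ - α) := by
  rw [integral_Ioi_rpow_of_lt (by linarith) one_pos, Real.one_rpow]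
  rw [show α - σ - 1 + 1 = -(σ - α) by ring, neg_div_neg_eq]

lemma norm_mul_cpow_le {E : ℝ → ℂ} {B α : ℝ} (hE : ∀ u, 1 < u → ‖E u‖ ≤ B * u ^ α) (s : ℂ)
    {u : ℝ} (hu : 1 < u) :
    ‖E u * (u : ℂ) ^ (-(s + 1))‖ ≤ B * u ^ (α - s.re - 1) := by
  have h0 : 0 < u := by linarith
  rw [norm_mul, norm_cpow_eq_rpow_re_of_pos h0]
  calc _ ≤ B * u ^ α * u ^ (-(s + 1)).re := by gcongr; exact hE u hu
    _ = _ := by rw [mul_assoc, ← Real.rpow_add h0]; congr 2; simp; ring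

lemma integrableOn_mul_cpow {E : ℝ → ℂ} (hm : Measurable E) {B α : ℝ}
    (hE : ∀ u, 1 < u → ‖E u‖ ≤ B * u ^ α) {s : ℂ} (hs : α < s.re) :
    IntegrableOn (fun u : ℝ ↦ E u * (u : ℂ) ^ (-(s + 1))) (Ioi 1) := by
  refine Integrable.mono' (g := fun u ↦ B * u ^ (α - s.re - 1))
    ((integrableOn_Ioi_rpow_of_lt (by linarith) one_pos).const_mul B)
    (by fun_prop) ?_
  filter_upwards [ae_restrict_mem measurableSet_Ioi] with u hu
  exact norm_mul_cpow_le hE s hu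

lemma norm_integral_mul_cpow_le {E : ℝ → ℂ} {B α : ℝ}
    (hE : ∀ u, 1 < u → ‖E u‖ ≤ B * u ^ α) {s : ℂ} (hs : α < s.re) :
    ‖∫ u in Ioi (1 : ℝ), E u * (u : ℂ) ^ (-(s + 1))‖ ≤ B / (s.re - α) := by
  refine (norm_integral_le_of_norm_le (g := fun u ↦ B * u ^ (α - s.re - 1))
    ((integrableOn_Ioi_rpow_of_lt (by linarith) one_pos).const_mul B) ?_).trans_eq ?_
  · filter_upwards [ae_restrict_mem measurableSet_Ioi] with u hu
    exact norm_mul_cpow_le hE s hu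
  · rw [integral_const_mul, integral_rpow_Ioi_one hs, mul_one_div]

lemma differentiableAt_integral_mul_cpow {E : ℝ → ℂ} (hm : Measurable E) {B α : ℝ}
    (hE : ∀ u, 1 < u → ‖E u‖ ≤ B * u ^ α) {s : ℂ} (hs : α < s.re) :
    DifferentiableAt ℂ (fun s : ℂ ↦ ∫ u in Ioi (1 : ℝ), E u * (u : ℂ) ^ (-(s + 1))) s := by
  have hB : 0 ≤ B := by
    by_contra h
    have h1 := hE 2 (by norm_num)
    have h2 : (0 : ℝ) < 2 ^ α := by positivity
    nlinarith [norm_nonneg (E 2)]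
  set f : ℝ → ℂ := (Ioi 1).indicator E with hf
  have hfm : Measurable f := hm.indicator measurableSet_Ioi
  have hb : ∀ u, 0 < u → ‖f u‖ ≤ B * u ^ α := by
    intro u hu0
    by_cases hu : u ∈ Ioi (1 : ℝ)
    · simpa [hf, indicator_of_mem hu] using hE u hu
    · rw [hf, indicator_of_notMem hu, norm_zero]
      positivity
  have hfun : (fun s : ℂ ↦ ∫ u in Ioi (1 : ℝ), E u * (u : ℂ) ^ (-(s + 1))) =
      fun s ↦ mellin f (-s) := by
    funext s
    rw [mellin, ← integral_indicator measurableSet_Ioi, ← integral_indicator measurableSet_Ioi]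
    congr 1
    funext u
    by_cases hu : u ∈ Ioi (1 : ℝ)
    · have hu' : u ∈ Ioi (0 : ℝ) := lt_trans one_pos (mem_Ioi.mp hu)
      rw [indicator_of_mem hu, indicator_of_mem hu', hf, indicator_of_mem hu, smul_eq_mul,
        mul_comm, neg_add']
    · by_cases hu' : u ∈ Ioi (0 : ℝ)
      · rw [indicator_of_notMem hu, indicator_of_mem hu', hf, indicator_of_notMem hu, smul_zero]
      · rw [indicator_of_notMem hu, indicator_of_notMem hu']
  rw [hfun]
  refine DifferentiableAt.comp (g := mellin f) s ?_ (by fun_prop)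
  refine mellin_differentiableAt_of_isBigO_rpow (a := -α) (b := -s.re - 1) ?_ ?_
    (by simpa using hs) ?_ (by simp)
  · intro x hx
    have hx' : (0 : ℝ) < x := hx
    refine ⟨Icc (x / 2) (2 * x), mem_nhdsWithin_of_mem_nhds (Icc_mem_nhds (by linarith)
      (by linarith)), ?_⟩
    have hc : ContinuousOn (fun u : ℝ ↦ B * u ^ α) (Icc (x / 2) (2 * x)) := by
      refine continuousOn_const.mul (continuousOn_id.rpow_const fun u hu ↦ Or.inl ?_)
      have := hu.1
      simp only [id]
      linarith
    refine Integrable.mono' (hc.integrableOn_compact isCompact_Icc) hfm.aestronglyMeasurable ?_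
    filter_upwards [ae_restrict_mem measurableSet_Icc] with u hu
    exact hb u (by linarith [hu.1])
  · refine Asymptotics.IsBigO.of_bound B ?_
    filter_upwards [Filter.eventually_gt_atTop 1] with u hu
    rw [neg_neg, Real.norm_of_nonneg (by positivity)]
    exact hb u (by linarith)
  · refine Asymptotics.IsBigO.of_bound 0 ?_
    filter_upwards [mem_nhdsWithin_of_mem_nhds (Iio_mem_nhds (show (0 : ℝ) < 1 by norm_num))]
      with u hu
    have : u ∉ Ioi (1 : ℝ) := by simpa using le_of_lt hu
    simp [hf, indicator_of_notMem this]

lemma eqOn_re_pos_of_eqOn {f g : ℂ → ℂ} (hf : DifferentiableOn ℂ f {s | 0 < s.re})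
    (hg : DifferentiableOn ℂ g {s | 0 < s.re}) (h : ∀ s : ℂ, 1 < s.re → f s = g s) {s : ℂ}
    (hs : 0 < s.re) : f s = g s := by
  have ho : IsOpen {s : ℂ | 0 < s.re} := isOpen_lt continuous_const continuous_re
  have ho' : IsOpen {s : ℂ | 1 < s.re} := isOpen_lt continuous_const continuous_re
  refine (hf.analyticOnNhd ho).eqOn_of_preconnected_of_eventuallyEq (hg.analyticOnNhd ho)
    (convex_halfSpace_re_gt 0).isPreconnected (z₀ := 2) (by simp) ?_ hs
  filter_upwards [ho'.mem_nhds (show (2 : ℂ) ∈ {s : ℂ | 1 < s.re} by simp)] with z hz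
  exact h z hz

end IntegralRepresentation

section Characters

open Complex MeasureTheory Set

variable {q : ℕ}

/-- The summatory function of a Dirichlet character. -/
noncomputable def charSum (χ : DirichletCharacter ℂ q) (u : ℝ) : ℂ :=
  ∑ k ∈ Finset.Icc 1 ⌊u⌋₊, χ (k : ZMod q)

lemma measurable_charSum (χ : DirichletCharacter ℂ q) : Measurable (charSum χ) :=
  (measurable_from_nat (f := fun n ↦ ∑ k ∈ Finset.Icc 1 n, χ (k : ZMod q))).comp
    Nat.measurable_floor

lemma norm_charSum_le_self (χ : DirichletCharacter ℂ q) {u : ℝ} (hu : 0 ≤ u) :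
    ‖charSum χ u‖ ≤ u := by
  refine (norm_sum_le_of_le (f := fun k : ℕ ↦ χ k) _ (n := fun _ ↦ (1 : ℝ))
    (fun k _ ↦ χ.norm_le_one _)).trans ?_
  simpa using Nat.floor_le hu

variable [NeZero q]

lemma ZMod.sum_range_natCast (f : ZMod q → ℂ) :
    ∑ k ∈ Finset.range q, f (k : ZMod q) = ∑ x, f x := by
  obtain ⟨n, rfl⟩ := Nat.exists_eq_succ_of_ne_zero (NeZero.ne q)
  rw [← Fin.sum_univ_eq_sum_range (fun k ↦ f (k : ZMod n.succ))]
  refine Finset.sum_congr rfl fun i _ ↦ congrArg f ?_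
  exact Fin.cast_val_eq_self i

lemma norm_charSum_le (χ : DirichletCharacter ℂ q) (hχ : χ ≠ 1) (u : ℝ) :
    ‖charSum χ u‖ ≤ q := by
  have hrange : ∀ n : ℕ, ‖∑ k ∈ Finset.range n, χ ((k : ZMod q) + 1)‖ ≤ q := by
    intro n
    induction n using Nat.strong_induction_on with
    | _ n ih =>
      rcases lt_or_ge n q with h | h
      · refine (norm_sum_le_of_le (f := fun k : ℕ ↦ χ ((k : ZMod q) + 1)) _ (n := fun _ ↦ (1 : ℝ))
          (fun k _ ↦ χ.norm_le_one _)).trans ?_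
        simpa using h.le
      · obtain ⟨m, rfl⟩ := Nat.exists_eq_add_of_le h
        rw [Finset.sum_range_add, ZMod.sum_range_natCast (fun x ↦ χ (x + 1)),
          show ∑ x, χ (x + 1) = ∑ x, χ x from Equiv.sum_comp (Equiv.addRight (1 : ZMod q)) χ, MulChar.sum_eq_zero_of_ne_one hχ, zero_add]
        simpa using ih m (by have := NeZero.pos q; omega)
  have : charSum χ u = ∑ k ∈ Finset.range ⌊u⌋₊, χ ((k : ZMod q) + 1) := by
    rw [charSum, Finset.range_eq_Ico]
    have h := (Finset.sum_Ico_add' (fun k : ℕ ↦ χ (k : ZMod q)) 0 ⌊u⌋₊ 1).symm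
    rw [zero_add, Finset.Ico_add_one_right_eq_Icc] at h
    simpa using h
  rw [this]
  exact hrange _

lemma norm_charSum_le_rpow (χ : DirichletCharacter ℂ q) (hχ : χ ≠ 1) {θ : ℝ} (hθ : 0 ≤ θ)
    (hθ' : θ ≤ 1) {u : ℝ} (hu : 1 < u) :
    ‖charSum χ u‖ ≤ (q : ℝ) ^ θ * u ^ (1 - θ) := by
  calc ‖charSum χ u‖ = ‖charSum χ u‖ ^ θ * ‖charSum χ u‖ ^ (1 - θ) := by
        rw [← Real.rpow_add_of_nonneg (norm_nonneg _) hθ (by linarith)]; simp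
    _ ≤ _ := by
        gcongr
        · exact norm_charSum_le χ hχ u
        · exact norm_charSum_le_self χ (by linarith)

lemma LFunction_eq_mul_integral (χ : DirichletCharacter ℂ q) (hχ : χ ≠ 1) {s : ℂ} (hs : 0 < s.re) :
    χ.LFunction s = s * ∫ u in Ioi (1 : ℝ), charSum χ u * (u : ℂ) ^ (-(s + 1)) := by
  refine eqOn_re_pos_of_eqOn (g := fun s ↦ s * ∫ u in Ioi (1 : ℝ), charSum χ u *
    (u : ℂ) ^ (-(s + 1))) (χ.differentiable_LFunction hχ).differentiableOn ?_ ?_ hs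
  · intro s hs
    refine (differentiableAt_id.mul (differentiableAt_integral_mul_cpow (measurable_charSum χ)
      (B := q) (α := 0) (fun u _ ↦ ?_) hs)).differentiableWithinAt
    simpa using norm_charSum_le χ hχ u
  · intro s hs
    rw [χ.LFunction_eq_LSeries hs]
    refine LSeries_eq_mul_integral _ zero_le_one hs (χ.LSeriesSummable_of_one_lt_re hs) ?_
    refine Asymptotics.IsBigO.of_bound 1 (Filter.Eventually.of_forall fun n ↦ ?_)
    have := norm_charSum_le_self χ (Nat.cast_nonneg (α := ℝ) n)
    simpa [charSum] using this

lemma norm_LFunction_le (χ : DirichletCharacter ℂ q) (hχ : χ ≠ 1) {θ : ℝ} (hθ : 0 ≤ θ)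
    (hθ' : θ ≤ 1) {s : ℂ} (hs : 0 < s.re) (hs' : 1 - θ < s.re) :
    ‖χ.LFunction s‖ ≤ ‖s‖ * ((q : ℝ) ^ θ / (s.re - (1 - θ))) := by
  rw [LFunction_eq_mul_integral χ hχ hs, norm_mul]
  gcongr
  exact norm_integral_mul_cpow_le (fun u hu ↦ norm_charSum_le_rpow χ hχ hθ hθ' hu) hs'

/-- An entire completion of `(s - 1) ζ(s)` as an integral on the right half plane. -/
noncomputable def zetaOne (s : ℂ) : ℂ :=
  s + s * (s - 1) * ∫ u in Ioi (1 : ℝ), ((⌊u⌋₊ : ℂ) - u) * (u : ℂ) ^ (-(s + 1))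

lemma norm_floor_sub_le {u : ℝ} (hu : 1 < u) : ‖(⌊u⌋₊ : ℂ) - u‖ ≤ 1 * u ^ (0 : ℝ) := by
  have h1 := Nat.floor_le (show 0 ≤ u by linarith)
  have h2 := Nat.lt_floor_add_one u
  rw [← ofReal_natCast, ← ofReal_sub, norm_real, Real.norm_eq_abs, abs_le]
  constructor <;> simp <;> linarith

lemma measurable_floor_sub : Measurable fun u : ℝ ↦ (⌊u⌋₊ : ℂ) - u :=
  ((measurable_from_nat (f := fun n : ℕ ↦ (n : ℂ))).comp Nat.measurable_floor).sub (by fun_prop)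

lemma differentiableOn_zetaOne : DifferentiableOn ℂ zetaOne {s | 0 < s.re} := by
  intro s hs
  exact (differentiableAt_id.add (DifferentiableAt.mul (by fun_prop)
    (differentiableAt_integral_mul_cpow measurable_floor_sub
      (fun u hu ↦ norm_floor_sub_le hu) hs))).differentiableWithinAt

lemma norm_zetaOne_le {s : ℂ} (hs : 0 < s.re) :
    ‖zetaOne s‖ ≤ ‖s‖ + ‖s‖ * ‖s - 1‖ * (1 / s.re) := by
  refine (norm_add_le _ _).trans ?_
  rw [norm_mul, norm_mul]
  gcongr
  simpa using norm_integral_mul_cpow_le (s := s) (fun u hu ↦ norm_floor_sub_le hu) hs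

lemma zetaOne_eq_of_one_lt_re {s : ℂ} (hs : 1 < s.re) :
    zetaOne s = (s - 1) * riemannZeta s := by
  have hs1 : s - 1 ≠ 0 := fun h ↦ by
    rw [sub_eq_zero.mp h] at hs; simp at hs
  have h1 : riemannZeta s = s * ∫ u in Ioi (1 : ℝ), (⌊u⌋₊ : ℂ) * (u : ℂ) ^ (-(s + 1)) := by
    rw [← LSeries_one_eq_riemannZeta hs, LSeries_eq_mul_integral _ zero_le_one hs
      (LSeriesSummable_one_iff.mpr hs) ?_]
    · simp
    · refine Asymptotics.IsBigO.of_bound 1 (Filter.Eventually.of_forall fun n ↦ ?_)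
      simp
  have h2 : ∫ u in Ioi (1 : ℝ), (u : ℂ) * (u : ℂ) ^ (-(s + 1)) = 1 / (s - 1) := by
    rw [← neg_div_neg_eq, neg_sub, ← integral_congr_ae (f := fun u : ℝ ↦ (u : ℂ) ^ (-s))]
    · rw [integral_Ioi_cpow_of_lt (by simpa using hs) one_pos]
      simp [neg_add_eq_sub]
    · filter_upwards [ae_restrict_mem measurableSet_Ioi] with u hu
      have hu0 : (u : ℂ) ≠ 0 := by
        have : (1 : ℝ) < u := hu
        exact_mod_cast (by linarith : u ≠ 0)
      nth_rewrite 2 [← cpow_one (u : ℂ)]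
      rw [← cpow_add _ _ hu0]
      ring_nf
  have h3 : ∫ u in Ioi (1 : ℝ), ((⌊u⌋₊ : ℂ) - u) * (u : ℂ) ^ (-(s + 1)) =
      (∫ u in Ioi (1 : ℝ), (⌊u⌋₊ : ℂ) * (u : ℂ) ^ (-(s + 1))) - 1 / (s - 1) := by
    rw [← h2, ← integral_sub]
    · simp only [sub_mul]
    · refine integrableOn_mul_cpow (B := 1) (α := 1) ?_ (fun u hu ↦ ?_) hs
      · exact (measurable_from_nat (f := fun n : ℕ ↦ (n : ℂ))).comp Nat.measurable_floor
      · simpa using Nat.floor_le (show 0 ≤ u by linarith)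
    · refine integrableOn_mul_cpow (B := 1) (α := 1) (by fun_prop) (fun u hu ↦ ?_) hs
      rw [norm_real, Real.norm_of_nonneg (by linarith)]
      simp
  rw [zetaOne, h3, h1]
  field_simp
  ring

end Characters

section Completion

open Complex MeasureTheory Set

lemma exists_norm_LSeries_le {s : ℂ} (hs : 1 < s.re) {f : ℕ → ℂ} (hf : ∀ n, ‖f n‖ ≤ 1) :
    ‖LSeries f s‖ ≤ 2 * s.re / (s.re - 1) := by
  set σ : ℝ := s.re with hσ
  have hσ1 : 1 < (σ : ℂ).re := by simpa using hs
  have hsum : LSeriesSummable 1 (σ : ℂ) := LSeriesSummable_one_iff.mpr hσ1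
  have hle : ∀ n, ‖LSeries.term f s n‖ ≤ ‖LSeries.term 1 (σ : ℂ) n‖ := by
    intro n
    rw [LSeries.norm_term_eq, LSeries.norm_term_eq, ofReal_re]
    split_ifs
    · exact le_rfl
    · gcongr
      simpa using hf n
  have h1 : ‖LSeries f s‖ ≤ ∑' n, ‖LSeries.term 1 (σ : ℂ) n‖ :=
    tsum_of_norm_bounded hsum.norm.hasSum hle
  have h2 : LSeries 1 (σ : ℂ) = ((∑' n, ‖LSeries.term 1 (σ : ℂ) n‖ : ℝ) : ℂ) := by
    rw [LSeries, ofReal_tsum]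
    refine tsum_congr fun n ↦ ?_
    rw [LSeries.norm_term_eq, LSeries.term_def]
    split_ifs
    · simp
    · simp [ofReal_cpow (Nat.cast_nonneg n)]
  have h3 : ∑' n, ‖LSeries.term 1 (σ : ℂ) n‖ = ‖riemannZeta σ‖ := by
    rw [← LSeries_one_eq_riemannZeta hσ1, h2, norm_real,
      Real.norm_of_nonneg (tsum_nonneg fun _ ↦ norm_nonneg _)]
  have h4 := norm_zetaOne_le (s := (σ : ℂ)) (by rw [ofReal_re]; linarith)
  have h5 : ‖(σ : ℂ) - 1‖ = σ - 1 := by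
    rw [← ofReal_one, ← ofReal_sub, norm_real, Real.norm_of_nonneg (by linarith)]
  rw [zetaOne_eq_of_one_lt_re hσ1, norm_mul, h5, norm_real, Real.norm_of_nonneg (by linarith),
    ofReal_re, mul_assoc, ← mul_one_div] at h4
  rw [h3] at h1
  refine h1.trans ?_
  rw [le_div_iff₀ (by linarith)]
  have h6 : σ * ((σ - 1) * (1 / σ)) = σ - 1 := by field_simp
  linarith

variable {q : ℕ} [NeZero q]

lemma le_norm_LFunction (χ : DirichletCharacter ℂ q) {s : ℂ} (hs : 1 < s.re) :
    (s.re - 1) / (2 * s.re) ≤ ‖χ.LFunction s‖ := by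
  have h1 := DirichletCharacter.LSeries.mul_mu_eq_one χ hs
  have h2 := exists_norm_LSeries_le hs (f := (fun n ↦ χ n * (ArithmeticFunction.moebius n : ℂ)))
    (fun n ↦ by
      rw [norm_mul]
      have ha := χ.norm_le_one (n : ZMod q)
      have hb : ‖((ArithmeticFunction.moebius n : ℤ) : ℂ)‖ ≤ 1 := by
        rw [norm_intCast]
        exact_mod_cast ArithmeticFunction.abs_moebius_le_one
      exact mul_le_one₀ ha (norm_nonneg _) hb)
  have h3 := congrArg norm h1
  rw [norm_mul, norm_one, ← χ.LFunction_eq_LSeries hs] at h3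
  rw [div_le_iff₀ (by linarith)]
  have h4 : 1 ≤ ‖χ.LFunction s‖ * (2 * s.re / (s.re - 1)) := by
    exact h3.symm.le.trans (mul_le_mul_of_nonneg_left h2 (norm_nonneg _))
  rw [← mul_div_assoc, le_div_iff₀ (by linarith)] at h4
  linarith

/-- The entire function `L(s, χ)`, respectively `(s - 1) L(s, χ)` for principal `χ`. -/
noncomputable def entireL (χ : DirichletCharacter ℂ q) : ℂ → ℂ :=
  if χ = 1 then DirichletCharacter.LFunctionTrivChar₁ q else χ.LFunction

lemma entireL_one : entireL (1 : DirichletCharacter ℂ q) =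
    DirichletCharacter.LFunctionTrivChar₁ q := if_pos rfl

lemma entireL_of_ne_one {χ : DirichletCharacter ℂ q} (hχ : χ ≠ 1) : entireL χ = χ.LFunction :=
  if_neg hχ

lemma differentiable_entireL (χ : DirichletCharacter ℂ q) : Differentiable ℂ (entireL χ) := by
  by_cases hχ : χ = 1
  · rw [hχ, entireL_one]
    exact DirichletCharacter.differentiable_LFunctionTrivChar₁ q
  · rw [entireL_of_ne_one hχ]
    exact χ.differentiable_LFunction hχ

lemma entireL_eq (χ : DirichletCharacter ℂ q) {s : ℂ} (hs : s ≠ 1) :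
    entireL χ s = (if χ = 1 then s - 1 else 1) * χ.LFunction s := by
  by_cases hχ : χ = 1
  · subst hχ
    rw [entireL_one, if_pos rfl, DirichletCharacter.LFunctionTrivChar₁, Function.update_of_ne hs]
  · rw [entireL_of_ne_one hχ, if_neg hχ, one_mul]

lemma entireL_one_eq {s : ℂ} (hs : 0 < s.re) : entireL (1 : DirichletCharacter ℂ q) s =
    (∏ p ∈ q.primeFactors, (1 - (p : ℂ) ^ (-s))) * zetaOne s := by
  refine eqOn_re_pos_of_eqOn (g := fun s ↦ (∏ p ∈ q.primeFactors, (1 - (p : ℂ) ^ (-s))) * zetaOne s)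
    (differentiable_entireL _).differentiableOn (DifferentiableOn.mul ?_ differentiableOn_zetaOne)
    ?_ hs
  · refine DifferentiableOn.fun_finsetProd fun p hp ↦ ?_
    have : (p : ℂ) ≠ 0 := by exact_mod_cast (Nat.prime_of_mem_primeFactors hp).ne_zero
    intro z _
    exact (DifferentiableAt.const_sub (DifferentiableAt.const_cpow (by fun_prop) (Or.inl this))
      _).differentiableWithinAt
  · intro s hs
    have hs1 : s ≠ 1 := fun h ↦ by rw [h] at hs; simp at hs
    rw [entireL_eq _ hs1, if_pos rfl, zetaOne_eq_of_one_lt_re hs,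
      ← DirichletCharacter.LFunctionTrivChar, DirichletCharacter.LFunctionTrivChar_eq_mul_riemannZeta hs1]
    ring

lemma norm_prod_one_sub_cpow_le {n : ℕ} (hn : n ≠ 0) {s : ℂ} (hs : 0 ≤ s.re) {a : ℕ → ℂ}
    (ha : ∀ p, ‖a p‖ ≤ 1) :
    ‖∏ p ∈ n.primeFactors, (1 - a p * (p : ℂ) ^ (-s))‖ ≤ n := by
  rw [norm_prod]
  calc ∏ p ∈ n.primeFactors, ‖1 - a p * (p : ℂ) ^ (-s)‖ ≤ ∏ p ∈ n.primeFactors, (p : ℝ) := by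
        refine Finset.prod_le_prod (fun _ _ ↦ norm_nonneg _) fun p hp ↦ ?_
        have hp := Nat.prime_of_mem_primeFactors hp
        refine (norm_sub_le _ _).trans ?_
        have h1 : ‖(p : ℂ) ^ (-s)‖ ≤ 1 := by
          rw [norm_natCast_cpow_of_pos hp.pos]
          exact Real.rpow_le_one_of_one_le_of_nonpos (by exact_mod_cast hp.one_le) (by simpa using hs)
        have h2 : (2 : ℝ) ≤ p := by exact_mod_cast hp.two_le
        rw [norm_mul, norm_one]
        nlinarith [mul_le_one₀ (ha p) (norm_nonneg _) h1]
    _ = ((∏ p ∈ n.primeFactors, p : ℕ) : ℝ) := by push_cast; rfl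
    _ ≤ n := by exact_mod_cast Nat.le_of_dvd (Nat.pos_of_ne_zero hn) (Nat.prod_primeFactors_dvd n)

lemma norm_entireL_le (χ : DirichletCharacter ℂ q) {s : ℂ} (hs : 1 / 2 ≤ s.re) :
    ‖entireL χ s‖ ≤ 3 * q * (1 + ‖s‖) ^ 2 := by
  have hq : (0 : ℝ) < q := by exact_mod_cast NeZero.pos q
  have hn := norm_nonneg s
  by_cases hχ : χ = 1
  · rw [hχ, entireL_one_eq (by linarith), norm_mul]
    have h1 := norm_prod_one_sub_cpow_le (NeZero.ne q) (s := s) (by linarith) (a := fun _ ↦ 1)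
      (by simp)
    simp only [one_mul] at h1
    have h2 := norm_zetaOne_le (s := s) (by linarith)
    have h3 : ‖s - 1‖ ≤ ‖s‖ + 1 := by simpa using norm_sub_le s 1
    have h4 : 1 / s.re ≤ 2 := by
      rw [div_le_iff₀ (by linarith)]; linarith
    have h5 : ‖zetaOne s‖ ≤ 3 * (1 + ‖s‖) ^ 2 := by
      calc _ ≤ ‖s‖ + ‖s‖ * (‖s‖ + 1) * 2 := h2.trans (by gcongr)
        _ ≤ _ := by nlinarith
    calc _ ≤ (q : ℝ) * (3 * (1 + ‖s‖) ^ 2) := by gcongr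
      _ = _ := by ring
  · rw [entireL_of_ne_one hχ]
    have h := norm_LFunction_le χ hχ (θ := 1) zero_le_one le_rfl (s := s) (by linarith)
      (by linarith)
    rw [Real.rpow_one, sub_self, sub_zero] at h
    refine h.trans ?_
    have h4 : (q : ℝ) / s.re ≤ 2 * q := by
      rw [div_le_iff₀ (by linarith)]; nlinarith
    calc _ ≤ ‖s‖ * (2 * q) := by gcongr
      _ = q * (2 * ‖s‖) := by ring
      _ ≤ q * (3 * (1 + ‖s‖) ^ 2) := by gcongr <;> nlinarith
      _ = _ := by ring

lemma le_norm_entireL (χ : DirichletCharacter ℂ q) {s : ℂ} (hs : 1 < s.re) (hs' : s.re ≤ 2) :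
    (s.re - 1) ^ 2 / 4 ≤ ‖entireL χ s‖ := by
  have hs1 : s ≠ 1 := fun h ↦ by rw [h] at hs; simp at hs
  rw [entireL_eq χ hs1, norm_mul]
  have h1 : s.re - 1 ≤ ‖(if χ = 1 then s - 1 else 1 : ℂ)‖ := by
    split_ifs
    · simpa using re_le_norm (s - 1)
    · rw [norm_one]; linarith
  have h2 : (s.re - 1) / 4 ≤ ‖χ.LFunction s‖ := by
    refine le_trans ?_ (le_norm_LFunction χ hs)
    rw [div_le_div_iff₀ (by norm_num) (by linarith)]
    nlinarith
  calc (s.re - 1) ^ 2 / 4 = (s.re - 1) * ((s.re - 1) / 4) := by ring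
    _ ≤ _ := by gcongr

lemma entireL_ne_zero_of_one_le_re (χ : DirichletCharacter ℂ q) {s : ℂ} (hs : 1 ≤ s.re) :
    entireL χ s ≠ 0 := by
  by_cases hs1 : s = 1
  · by_cases hχ : χ = 1
    · rw [hχ, hs1, entireL_one]
      exact DirichletCharacter.LFunctionTrivChar₁_apply_one_ne_zero q
    · rw [entireL_of_ne_one hχ]
      exact χ.LFunction_ne_zero_of_one_le_re (.inl hχ) hs
  · rw [entireL_eq χ hs1]
    refine mul_ne_zero ?_ (χ.LFunction_ne_zero_of_one_le_re (.inr hs1) hs)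
    split_ifs
    · exact sub_ne_zero.mpr hs1
    · exact one_ne_zero

lemma logDeriv_entireL (χ : DirichletCharacter ℂ q) {s : ℂ} (hs1 : s ≠ 1)
    (hL : χ.LFunction s ≠ 0) :
    deriv (entireL χ) s / entireL χ s =
      (if χ = 1 then 1 / (s - 1) else 0) + deriv χ.LFunction s / χ.LFunction s := by
  have hs0 : s - 1 ≠ 0 := sub_ne_zero.mpr hs1
  by_cases hχ : χ = 1
  · subst hχ
    rw [entireL_eq 1 hs1, entireL_one, DirichletCharacter.deriv_LFunctionTrivChar₁_apply_of_ne_one q hs1,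
      if_pos rfl, if_pos rfl]
    rw [DirichletCharacter.LFunctionTrivChar]
    field_simp
    ring
  · rw [entireL_of_ne_one hχ, if_neg hχ, zero_add]

end Completion

section ZeroFreeRegion

open Complex Set

variable {q : ℕ}

/-- The Dirichlet series `∑ χ(n) Λ(n) n^{-s}`. -/
noncomputable def twistedMangoldt (χ : DirichletCharacter ℂ q) (s : ℂ) : ℂ :=
  LSeries ((fun n : ℕ ↦ χ n) * fun n : ℕ ↦ (ArithmeticFunction.vonMangoldt n : ℂ)) s

lemma DirichletCharacter.norm_sq_eq_one_apply (χ : DirichletCharacter ℂ q) (a : ZMod q) :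
    ((‖χ a‖ ^ 2 : ℝ) : ℂ) = (1 : DirichletCharacter ℂ q) a := by
  by_cases ha : IsUnit a
  · obtain ⟨u, rfl⟩ := ha
    rw [DirichletCharacter.unit_norm_eq_one, MulChar.one_apply u.isUnit]; simp
  · rw [χ.map_nonunit ha, MulChar.map_nonunit _ ha]; simp

lemma three_four_one_re (z : ℂ) (hz : z = 0 ∨ ‖z‖ = 1) :
    0 ≤ (3 * ((‖z‖ ^ 2 : ℝ) : ℂ) + 4 * z + z ^ 2).re := by
  rcases hz with rfl | hz
  · simp
  · have h : z.re ^ 2 + z.im ^ 2 = 1 := by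
      have := normSq_eq_norm_sq z
      rw [normSq_apply, hz] at this
      linarith
    rw [hz]
    simp [pow_two]
    nlinarith [sq_nonneg (1 + z.re)]

lemma twistedMangoldt_three_four_one (χ : DirichletCharacter ℂ q) {σ : ℝ} (hσ : 1 < σ) (γ : ℝ) :
    0 ≤ (3 * twistedMangoldt (1 : DirichletCharacter ℂ q) σ + 4 * twistedMangoldt χ (σ + γ * I) +
      twistedMangoldt (χ ^ 2) (σ + (2 * γ : ℝ) * I)).re := by
  have h1 := ((1 : DirichletCharacter ℂ q).LSeriesSummable_twist_vonMangoldt (s := σ)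
    (by simpa using hσ)).hasSum.mul_left 3
  have h2 := (χ.LSeriesSummable_twist_vonMangoldt (s := σ + γ * I)
    (by simpa using hσ)).hasSum.mul_left 4
  have h3 := ((χ ^ 2).LSeriesSummable_twist_vonMangoldt (s := σ + (2 * γ : ℝ) * I)
    (by simpa using hσ)).hasSum
  refine (hasSum_re ((h1.add h2).add h3)).nonneg fun n ↦ ?_
  rcases eq_or_ne n 0 with rfl | hn
  · simp
  have hn0 : (n : ℂ) ≠ 0 := by exact_mod_cast hn
  set c : ℝ := ArithmeticFunction.vonMangoldt n / (n : ℝ) ^ σ with hc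
  set w : ℂ := χ n / (n : ℂ) ^ (γ * I) with hw
  have hc0 : 0 ≤ c := div_nonneg ArithmeticFunction.vonMangoldt_nonneg (by positivity)
  have hnorm : ‖(n : ℂ) ^ (γ * I)‖ = 1 := by
    rw [norm_natCast_cpow_of_pos (Nat.pos_of_ne_zero hn)]; simp
  have hnσ : (n : ℂ) ^ (σ : ℂ) = (((n : ℝ) ^ σ : ℝ) : ℂ) := by
    rw [ofReal_cpow (by positivity)]; simp
  have hww : ‖w‖ = ‖χ n‖ := by rw [hw, norm_div, hnorm, div_one]
  have hcases : w = 0 ∨ ‖w‖ = 1 := by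
    by_cases hu : IsUnit (n : ZMod q)
    · right
      obtain ⟨u, hu⟩ := hu
      rw [hww, ← hu, DirichletCharacter.unit_norm_eq_one]
    · left; rw [hw, χ.map_nonunit hu, zero_div]
  have hpos : (0 : ℝ) < (n : ℝ) ^ σ := by positivity
  have hne : (((n : ℝ) ^ σ : ℝ) : ℂ) ≠ 0 := by exact_mod_cast hpos.ne'
  have hne2 : (n : ℂ) ^ (γ * I) ≠ 0 := fun h ↦ by rw [h] at hnorm; simp at hnorm
  have key : 3 * LSeries.term ((fun n : ℕ ↦ (1 : DirichletCharacter ℂ q) n) *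
      fun n : ℕ ↦ (ArithmeticFunction.vonMangoldt n : ℂ)) σ n +
      4 * LSeries.term ((fun n : ℕ ↦ χ n) * fun n : ℕ ↦ (ArithmeticFunction.vonMangoldt n : ℂ))
        (σ + γ * I) n +
      LSeries.term ((fun n : ℕ ↦ (χ ^ 2) n) * fun n : ℕ ↦ (ArithmeticFunction.vonMangoldt n : ℂ))
        (σ + (2 * γ : ℝ) * I) n = (c : ℂ) * (3 * ((‖w‖ ^ 2 : ℝ) : ℂ) + 4 * w + w ^ 2) := by
    rw [LSeries.term_of_ne_zero hn, LSeries.term_of_ne_zero hn, LSeries.term_of_ne_zero hn, hww,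
      χ.norm_sq_eq_one_apply, cpow_add _ _ hn0, cpow_add _ _ hn0,
      show (((2 * γ : ℝ) : ℂ) * I) = γ * I + γ * I by push_cast; ring, cpow_add _ _ hn0, hnσ, hc, hw]
    simp only [Pi.mul_apply, MulChar.pow_apply' _ two_ne_zero]
    push_cast [-ofReal_natCast]
    field_simp
  rw [key, re_ofReal_mul]
  exact mul_nonneg hc0 (three_four_one_re w hcases)

variable [NeZero q]

lemma twistedMangoldt_eq (χ : DirichletCharacter ℂ q) {s : ℂ} (hs : 1 < s.re) :
    twistedMangoldt χ s = (if χ = 1 then 1 / (s - 1) else 0) -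
      deriv (entireL χ) s / entireL χ s := by
  have hs1 : s ≠ 1 := fun h ↦ by rw [h] at hs; simp at hs
  rw [logDeriv_entireL χ hs1 (χ.LFunction_ne_zero_of_one_le_re (.inr hs1) hs.le),
    twistedMangoldt, χ.LSeries_twist_vonMangoldt_eq hs, χ.LFunction_eq_LSeries hs,
    χ.deriv_LFunction_eq_deriv_LSeries hs]
  ring

lemma norm_entireL_le_exp {l : ℝ} (hl : 1 ≤ l) (hq : (q : ℝ) ≤ Real.exp l)
    (χ : DirichletCharacter ℂ q) {z : ℂ} (hz : 1 / 2 ≤ z.re)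
    (hz' : ‖z‖ ≤ 6 * Real.exp l) : ‖entireL χ z‖ ≤ Real.exp (9 * l) := by
  have hpos := Real.exp_pos l
  have he : 2 ≤ Real.exp l := by linarith [Real.add_one_le_exp l]
  calc ‖entireL χ z‖ ≤ 3 * q * (1 + ‖z‖) ^ 2 := norm_entireL_le χ hz
    _ ≤ 3 * Real.exp l * (Real.exp l + 6 * Real.exp l) ^ 2 := by
        gcongr
        linarith
    _ = 147 * Real.exp l ^ 3 := by ring
    _ ≤ Real.exp l ^ 6 * Real.exp l ^ 3 := by
        gcongr
        have h2 : (2.7 : ℝ) ≤ Real.exp l :=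
          le_trans (by linarith [Real.exp_one_gt_d9]) (Real.exp_le_exp.mpr hl)
        calc (147 : ℝ) ≤ 2.7 ^ 6 := by norm_num
          _ ≤ _ := by gcongr
    _ = Real.exp (9 * l) := by
        rw [← pow_add, ← Real.exp_nat_mul]; norm_num

lemma norm_entireL_le_exp_mul {l a : ℝ} (hl : 1 ≤ l) (ha : 0 ≤ a) (hq : (q : ℝ) ≤ Real.exp l)
    (χ : DirichletCharacter ℂ q) {c z : ℂ} (hc : 1 + Real.exp (-a) / l ≤ c.re) (hc' : c.re ≤ 2)
    (hz : 1 / 2 ≤ z.re) (hz' : ‖z‖ ≤ 6 * Real.exp l) :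
    ‖entireL χ z‖ ≤ Real.exp ((13 + 2 * a) * l) * ‖entireL χ c‖ := by
  have hpos : 0 < Real.exp (-a) / l := by positivity
  have h1 := norm_entireL_le_exp hl hq χ hz hz'
  have h2 := le_norm_entireL χ (s := c) (by linarith) hc'
  have h4 : Real.exp (-(4 + 2 * a) * l) ≤ ‖entireL χ c‖ := by
    refine le_trans ?_ h2
    have h5 : Real.exp (-(a + 1) * l) ≤ Real.exp (-a) / l := by
      rw [le_div_iff₀ (by linarith)]
      calc Real.exp (-(a + 1) * l) * l ≤ Real.exp (-(a + 1) * l) * Real.exp l := by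
            gcongr
            linarith [Real.add_one_le_exp l]
        _ = Real.exp (-a * l) := by rw [← Real.exp_add]; ring_nf
        _ ≤ _ := by
            apply Real.exp_le_exp.mpr
            nlinarith
    have h6 : Real.exp (-2 * l) ≤ 1 / 4 := by
      have : (4 : ℝ) ≤ Real.exp (2 * l) := by
        have h := Real.add_one_le_exp l
        rw [two_mul, Real.exp_add]
        nlinarith
      rw [neg_mul, Real.exp_neg, ← one_div]
      exact one_div_le_one_div_of_le (by norm_num) this
    calc Real.exp (-(4 + 2 * a) * l) = Real.exp (-(a + 1) * l) ^ 2 * Real.exp (-2 * l) := by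
          rw [← Real.exp_nat_mul, ← Real.exp_add]; congr 1; push_cast; ring
      _ ≤ (Real.exp (-a) / l) ^ 2 * (1 / 4) := by gcongr
      _ ≤ (c.re - 1) ^ 2 * (1 / 4) := by
          gcongr
          linarith
      _ = _ := by ring
  calc ‖entireL χ z‖ ≤ Real.exp (9 * l) := h1
    _ = Real.exp ((13 + 2 * a) * l) * Real.exp (-(4 + 2 * a) * l) := by
        rw [← Real.exp_add]; congr 1; ring
    _ ≤ _ := by gcongr

lemma exp_neg_twenty_mul_le : 100000 * Real.exp (-20) ≤ (1 : ℝ) := by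
  have h : (2 : ℝ) ^ 20 ≤ Real.exp 20 := by
    have h1 : (2 : ℝ) ≤ Real.exp 1 := by linarith [Real.exp_one_gt_d9]
    calc (2 : ℝ) ^ 20 ≤ Real.exp 1 ^ 20 := by gcongr
      _ = Real.exp 20 := by rw [← Real.exp_nat_mul]; norm_num
  have h2 : Real.exp (-20) * Real.exp 20 = 1 := by rw [← Real.exp_add]; simp
  nlinarith [Real.exp_pos (-20)]

lemma re_one_div_add_mul_I (η γ : ℝ) :
    (1 / ((η : ℂ) + γ * I)).re = η / (η ^ 2 + γ ^ 2) := by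
  rw [one_div, inv_re, normSq_apply]
  simp
  ring

/-- Zeros near the line `re s = 1` can only come from real characters, and lie close to `s = 1`. -/
lemma sq_eq_one_of_entireL_eq_zero {l : ℝ} (hl : 1 ≤ l) (hq : (q : ℝ) ≤ Real.exp l)
    (χ : DirichletCharacter ℂ q) {ρ : ℂ} (hγ : |ρ.im| ≤ 2 * Real.exp l)
    (hβ : 1 - Real.exp (-20) / (100 * l) ≤ ρ.re) (hρ : entireL χ ρ = 0) :
    χ ^ 2 = 1 ∧ |ρ.im| < 10 * (Real.exp (-20) / l) := by
  set η : ℝ := Real.exp (-20) / l with hη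
  set γ := ρ.im with hγdef
  set β := ρ.re with hβdef
  have hA := exp_neg_twenty_mul_le
  have hA0 := Real.exp_pos (-20)
  have hη0 : 0 < η := by positivity
  have hηl : 100000 * (η * l) ≤ 1 := by rwa [hη, div_mul_cancel₀ _ (by linarith)]
  have hη1 : 100000 * η ≤ 1 := by nlinarith
  have hβ' : 1 - η / 100 ≤ β := by
    rw [hη, div_div, mul_comm l]; exact hβ
  have hβ1 : β < 1 := by
    by_contra h
    exact entireL_ne_zero_of_one_le_re χ (not_lt.mp h) hρ
  have hel : 2 ≤ Real.exp l := by linarith [Real.add_one_le_exp l]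
  -- lower bounds for the real part of the logarithmic derivatives
  have hbound : ∀ (ψ : DirichletCharacter ℂ q) (t : ℝ), |t| ≤ 4 * Real.exp l →
      ∀ z ∈ Metric.closedBall ((1 + η : ℝ) + t * I : ℂ) (1 / 2), ‖entireL ψ z‖ ≤
        Real.exp (53 * l) * ‖entireL ψ ((1 + η : ℝ) + t * I)‖ := by
    intro ψ t ht z hz
    rw [Metric.mem_closedBall, dist_eq_norm] at hz
    have h1 := (abs_re_le_norm _).trans hz
    simp only [sub_re, add_re, ofReal_re, mul_re, ofReal_im, I_re, I_im, mul_zero, zero_mul,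
      sub_zero, add_zero] at h1
    have h2 : ‖z‖ ≤ ‖z - ((1 + η : ℝ) + t * I)‖ + ‖((1 + η : ℝ) + t * I : ℂ)‖ := by
      simpa using norm_add_le (z - ((1 + η : ℝ) + t * I)) ((1 + η : ℝ) + t * I)
    have h3 : ‖((1 + η : ℝ) + t * I : ℂ)‖ ≤ 1 + η + |t| := by
      refine (norm_add_le _ _).trans ?_
      rw [norm_mul, norm_I, mul_one, norm_real, norm_real, Real.norm_of_nonneg (by linarith),
        Real.norm_eq_abs]
    have := norm_entireL_le_exp_mul hl (a := 20) (by norm_num) hq ψ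
      (c := (1 + η : ℝ) + t * I) (z := z) (by rw [← hη]; simp) (by simp; linarith)
      (by linarith [(abs_le.mp h1).1]) (by linarith)
    norm_num at this ⊢
    exact this
  have hne : ∀ (ψ : DirichletCharacter ℂ q) (t : ℝ), entireL ψ ((1 + η : ℝ) + t * I) ≠ 0 :=
    fun ψ t ↦ entireL_ne_zero_of_one_le_re ψ (by simp; linarith)
  have hzeros : ∀ (ψ : DirichletCharacter ℂ q) (t : ℝ),
      ∀ z ∈ Metric.closedBall ((1 + η : ℝ) + t * I : ℂ) (1 / 2), entireL ψ z = 0 →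
        z.re ≤ ((1 + η : ℝ) + t * I : ℂ).re := by
    intro ψ t z _ hz
    by_contra! h
    refine entireL_ne_zero_of_one_le_re ψ ?_ hz
    simp at h
    linarith
  have hgen : ∀ (ψ : DirichletCharacter ℂ q) (t : ℝ), |t| ≤ 4 * Real.exp l →
      (twistedMangoldt ψ ((1 + η : ℝ) + t * I)).re ≤
        (if ψ = 1 then η / (η ^ 2 + t ^ 2) else 0) + 5088 * l := by
    intro ψ t ht
    have h := neg_le_re_logDeriv (differentiable_entireL ψ) (by norm_num : (0 : ℝ) < 1 / 2)
      (by linarith : 0 < 53 * l) (hne ψ t) (hbound ψ t ht) (hzeros ψ t)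
    rw [twistedMangoldt_eq ψ (by simp; linarith), sub_re]
    have h2 : ((if ψ = 1 then 1 / ((1 + η : ℝ) + t * I - 1) else 0 : ℂ)).re =
        if ψ = 1 then η / (η ^ 2 + t ^ 2) else 0 := by
      split_ifs
      · rw [← re_one_div_add_mul_I]; congr 2; push_cast; ring
      · simp
    rw [h2]
    have h3 : 48 * (53 * l) / (1 / 2) = 5088 * l := by ring
    linarith
  set δ : ℝ := 1 + η - β with hδ
  have hspec : (twistedMangoldt χ ((1 + η : ℝ) + γ * I)).re ≤
      (if χ = 1 then η / (η ^ 2 + γ ^ 2) else 0) + 5088 * l - (1 / δ - δ / (1 / 2) ^ 2) := by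
    have ht : |γ| ≤ 4 * Real.exp l := by linarith
    have hρ' : ((1 + η : ℝ) + γ * I : ℂ) - δ = ρ := by
      apply Complex.ext <;> simp [hδ, hβdef, hγdef]
    have h := neg_add_le_re_logDeriv (differentiable_entireL χ) (by norm_num : (0 : ℝ) < 1 / 2)
      (by linarith : 0 < 53 * l) (hne χ γ) (hbound χ γ ht) (hzeros χ γ) (δ := δ)
      (by linarith) (by linarith) (by rw [hρ', hρ])
    rw [twistedMangoldt_eq χ (by simp; linarith), sub_re]
    have h2 : ((if χ = 1 then 1 / ((1 + η : ℝ) + γ * I - 1) else 0 : ℂ)).re =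
        if χ = 1 then η / (η ^ 2 + γ ^ 2) else 0 := by
      split_ifs
      · rw [← re_one_div_add_mul_I]; congr 2; push_cast; ring
      · simp
    rw [h2]
    have h3 : 48 * (53 * l) / (1 / 2) = 5088 * l := by ring
    linarith
  have h341 := twistedMangoldt_three_four_one χ (σ := 1 + η) (by linarith) γ
  have ha := hgen 1 0 (by simp; positivity)
  have hb := hgen (χ ^ 2) (2 * γ) (by rw [abs_mul, abs_two]; linarith)
  rw [if_pos rfl] at ha
  have hre : (3 * twistedMangoldt (1 : DirichletCharacter ℂ q) (1 + η : ℝ) +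
      4 * twistedMangoldt χ ((1 + η : ℝ) + γ * I) +
      twistedMangoldt (χ ^ 2) ((1 + η : ℝ) + (2 * γ : ℝ) * I)).re =
      3 * (twistedMangoldt (1 : DirichletCharacter ℂ q) ((1 + η : ℝ) + (0 : ℝ) * I)).re +
      4 * (twistedMangoldt χ ((1 + η : ℝ) + γ * I)).re +
      (twistedMangoldt (χ ^ 2) ((1 + η : ℝ) + (2 * γ : ℝ) * I)).re := by
    simp
  rw [hre] at h341
  have hη2 : η / (η ^ 2 + 0 ^ 2) = 1 / η := by field_simp; ring
  rw [hη2] at ha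
  -- numerical comparison
  have hδ1 : 3.96 / η ≤ 4 * (1 / δ) := by
    rw [div_le_iff₀ hη0]
    have : 0.99 ≤ 1 / δ * η := by
      rw [div_mul_eq_mul_div, one_mul, le_div_iff₀ (by linarith)]
      linarith
    linarith
  have hlη : 100000 * l ≤ 1 / η := by
    rw [le_div_iff₀ hη0]; linarith
  have hmain : 0.5 / η ≤ 4 * (if χ = 1 then η / (η ^ 2 + γ ^ 2) else 0) +
      (if χ ^ 2 = 1 then η / (η ^ 2 + (2 * γ) ^ 2) else 0) := by
    have e1 : (0.5 : ℝ) / η = 0.5 * (1 / η) := by ring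
    have e2 : (3.96 : ℝ) / η = 3.96 * (1 / η) := by ring
    rw [e2] at hδ1
    rw [e1]
    have h4 : δ / (1 / 2) ^ 2 ≤ 5 := by
      have : δ ≤ 5 / 4 := by linarith
      norm_num; linarith
    linarith
  have hχ2 : χ ^ 2 = 1 := by
    by_contra hne2
    have hne1 : χ ≠ 1 := fun h ↦ hne2 (by rw [h, one_pow])
    rw [if_neg hne1, if_neg hne2] at hmain
    have : 0 < 0.5 / η := by positivity
    linarith
  refine ⟨hχ2, ?_⟩
  by_contra! hlarge
  have hfrac : ∀ t : ℝ, 10 * η ≤ |t| → η / (η ^ 2 + t ^ 2) ≤ 0.01 / η := by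
    intro t ht
    rw [div_le_div_iff₀ (by positivity) hη0]
    have : (10 * η) ^ 2 ≤ t ^ 2 := by
      rw [← sq_abs t]; gcongr
    nlinarith
  have h5 := hfrac γ hlarge
  have h6 := hfrac (2 * γ) (by rw [abs_mul, abs_two]; linarith [abs_nonneg γ])
  have h7 : (0 : ℝ) ≤ η / (η ^ 2 + γ ^ 2) := by positivity
  rw [if_pos hχ2] at hmain
  have h8 : 0.5 / η ≤ 0.05 / η := by
    split_ifs at hmain
    · have : (0.05 : ℝ) / η = 4 * (0.01 / η) + 0.01 / η := by ring
      linarith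
    · have : (0.05 : ℝ) / η = 4 * (0.01 / η) + 0.01 / η := by ring
      have : (0 : ℝ) < 0.01 / η := by positivity
      linarith
  rw [div_le_div_iff_of_pos_right hη0] at h8
  norm_num at h8

end ZeroFreeRegion

section Estermann

open Complex Set
open scoped ComplexOrder Topology

lemma contDiffAt_of_differentiableOn_re {f : ℂ → ℂ} (hf : DifferentiableOn ℂ f {s | 1 < s.re})
    (k : ℕ) : ContDiffAt ℂ k f 2 :=
  (hf.contDiffOn (isOpen_lt continuous_const continuous_re)).contDiffAt
    ((isOpen_lt continuous_const continuous_re).mem_nhds (by simp))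

/-- Alternating signs of derivatives pass from the negative logarithmic derivative to the function. -/
lemma iteratedDeriv_alternating_of_deriv {f h : ℂ → ℂ} (hf : DifferentiableOn ℂ f {s | 1 < s.re})
    (hh : DifferentiableOn ℂ h {s | 1 < s.re})
    (hd : ∀ s : ℂ, 1 < s.re → deriv f s = -(h s * f s))
    (hpos : ∀ k, 0 ≤ (-1) ^ k * iteratedDeriv k h 2) (h0 : 0 ≤ f 2) (k : ℕ) :
    0 ≤ (-1) ^ k * iteratedDeriv k f 2 := by
  induction k using Nat.strong_induction_on with
  | _ k ih =>
    cases k with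
    | zero => simpa using h0
    | succ k =>
      have hev : deriv f =ᶠ[𝓝 2] -(fun s ↦ h s * f s) := by
        filter_upwards [(isOpen_lt continuous_const continuous_re).mem_nhds
          (show (2 : ℂ) ∈ {s : ℂ | 1 < s.re} by simp)] with s hs
        exact hd s hs
      rw [iteratedDeriv_succ', hev.iteratedDeriv_eq, iteratedDeriv_neg, iteratedDeriv_fun_mul
        (contDiffAt_of_differentiableOn_re hh k) (contDiffAt_of_differentiableOn_re hf k),
        pow_succ, mul_assoc, neg_one_mul, neg_neg, Finset.mul_sum]
      refine Finset.sum_nonneg fun i hi ↦ ?_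
      have hik : i ≤ k := Nat.lt_succ_iff.mp (Finset.mem_range.mp hi)
      have hpow : (-1 : ℂ) ^ k = (-1) ^ i * (-1) ^ (k - i) := by
        rw [← pow_add, Nat.add_sub_cancel' hik]
      have : (-1 : ℂ) ^ k * ((k.choose i : ℂ) * iteratedDeriv i h 2 * iteratedDeriv (k - i) f 2) =
          (k.choose i : ℂ) * (((-1) ^ i * iteratedDeriv i h 2) *
            ((-1) ^ (k - i) * iteratedDeriv (k - i) f 2)) := by
        rw [hpow]; ring
      rw [this]
      exact mul_nonneg (by exact_mod_cast Nat.zero_le _)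
        (mul_nonneg (hpos i) (ih (k - i) (by omega)))

lemma iteratedDeriv_const_div_sub_one (c : ℂ) (k : ℕ) :
    iteratedDeriv k (fun s : ℂ ↦ c * (s - 1)⁻¹) 2 = c * ((-1) ^ k * k.factorial) := by
  rw [iteratedDeriv_const_mul]
  · have h := congrFun (iteratedDeriv_comp_sub_const k (Inv.inv : ℂ → ℂ) 1) 2
    rw [h, iteratedDeriv_eq_iterate, iter_deriv_inv]
    norm_num
  · exact ContDiffAt.inv (by fun_prop) (by norm_num)

/-- Estermann's lemma, with the truncation point as a parameter. -/
lemma estermann_truncated {P f : ℂ → ℂ} {Q c σ : ℝ} (hP : Differentiable ℂ P)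
    (hPQ : ∀ z ∈ Metric.closedBall (2 : ℂ) (4 / 3), ‖P z‖ ≤ Q)
    (hf : ∀ s : ℂ, 1 < s.re → P s = (s - 1) * f s)
    (hpos : ∀ k, 0 ≤ (-1) ^ k * iteratedDeriv k f 2) (hc : c ≤ (f 2).re)
    (hσ : 9 / 10 ≤ σ) (hσ1 : σ < 1) (hPσ : 0 ≤ (P σ).re) {N : ℕ} (hN : 0 < N) :
    (c - 35 * Q * (33 / 40) ^ N) * (1 - σ) ≤ (P 1).re * (2 - σ) ^ N := by
  set g : ℂ → ℂ := dslope P 1 with hg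
  have hgd : Differentiable ℂ g := by
    intro z
    have := (differentiableOn_dslope (c := (1 : ℂ)) (f := P) (s := univ) (by simp)).mpr
      hP.differentiableOn
    exact (this z trivial).differentiableAt (by simp)
  have hPg : ∀ z, P z = P 1 + (z - 1) * g z := fun z ↦ by
    have := sub_smul_dslope P 1 z
    rw [smul_eq_mul] at this
    rw [hg, this]; ring
  have hQ0 : 0 ≤ Q := (norm_nonneg _).trans (hPQ 2 (Metric.mem_closedBall_self (by norm_num)))
  have h1Q : ‖P 1‖ ≤ Q := hPQ 1 (by rw [Metric.mem_closedBall, dist_eq_norm]; norm_num)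
  have hgb : ∀ z ∈ Metric.sphere (2 : ℂ) (4 / 3), ‖g z‖ ≤ 6 * Q := by
    intro z hz
    have h1 := hPQ z (Metric.sphere_subset_closedBall hz)
    have h2 : 1 / 3 ≤ ‖z - 1‖ := by
      rw [Metric.mem_sphere, dist_eq_norm] at hz
      have := norm_sub_le (z - 1) 1
      rw [norm_one, sub_sub] at this
      norm_num at this
      linarith
    have h3 : ‖z - 1‖ * ‖g z‖ ≤ 2 * Q := by
      rw [← norm_mul, show (z - 1) * g z = P z - P 1 by rw [hPg z]; ring]
      linarith [norm_sub_le (P z) (P 1)]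
    nlinarith [norm_nonneg (g z)]
  have hcoef : ∀ k, ‖iteratedDeriv k g 2‖ ≤ k.factorial * (6 * Q * (3 / 4) ^ k) := by
    intro k
    refine (norm_iteratedDeriv_le_of_forall_mem_sphere_norm_le k (by norm_num : (0 : ℝ) < 4 / 3)
      hgd.diffContOnCl hgb).trans_eq ?_
    rw [div_eq_mul_inv, ← inv_pow]
    norm_num [mul_assoc]
  have hrel : ∀ k, iteratedDeriv k g 2 = iteratedDeriv k f 2 - P 1 * ((-1) ^ k * k.factorial) := by
    intro k
    have hev : f =ᶠ[𝓝 2] fun s ↦ g s + P 1 * (s - 1)⁻¹ := by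
      filter_upwards [(isOpen_lt continuous_const continuous_re).mem_nhds
        (show (2 : ℂ) ∈ {s : ℂ | 1 < s.re} by simp)] with s hs
      have hs1 : s - 1 ≠ 0 := fun h ↦ by
        rw [sub_eq_zero.mp h] at hs; simp at hs
      have h1 := hf s hs
      rw [hPg s] at h1
      field_simp
      linear_combination -h1
    rw [hev.iteratedDeriv_eq, iteratedDeriv_fun_add, iteratedDeriv_const_div_sub_one,
      add_sub_cancel_right]
    · exact hgd.contDiff.contDiffAt
    · exact contDiffAt_const.mul (ContDiffAt.inv (by fun_prop) (by norm_num))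
  set y : ℝ := 2 - σ with hy
  set a : ℕ → ℝ := fun k ↦ ((-1) ^ k * iteratedDeriv k f 2).re / k.factorial with ha
  set b : ℕ → ℝ := fun k ↦ ((-1) ^ k * iteratedDeriv k g 2).re / k.factorial with hb
  have hfac : ∀ k : ℕ, (0 : ℝ) < k.factorial := fun k ↦ by exact_mod_cast k.factorial_pos
  have ha0 : ∀ k, 0 ≤ a k := fun k ↦ div_nonneg ((Complex.le_def.mp (hpos k)).1) (hfac k).le
  have hba : ∀ k, b k = a k - (P 1).re := by
    intro k
    simp only [hb, ha]
    have : (-1 : ℂ) ^ k * (P 1 * ((-1) ^ k * k.factorial)) = (k.factorial : ℝ) * P 1 := by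
      have h1 : (-1 : ℂ) ^ k * (-1) ^ k = 1 := by rw [← mul_pow]; simp
      push_cast
      linear_combination P 1 * k.factorial * h1
    rw [hrel k, mul_sub, sub_re, this, re_ofReal_mul]
    have := (hfac k).ne'
    field_simp
  have hbb : ∀ k, -(6 * Q * (3 / 4) ^ k) ≤ b k := by
    intro k
    have h1 := (abs_re_le_norm ((-1) ^ k * iteratedDeriv k g 2))
    rw [norm_mul, norm_pow, norm_neg, norm_one, one_pow, one_mul] at h1
    simp only [hb]
    rw [le_div_iff₀ (hfac k)]
    linarith [(abs_le.mp (h1.trans (hcoef k))).1]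
  have hsum : HasSum (fun k ↦ b k * y ^ k) (g σ).re := by
    have h := hasSum_re (hasSum_taylorSeries_of_entire hgd 2 σ)
    have hterm : (fun k ↦ b k * y ^ k) = fun k : ℕ ↦
        ((k.factorial : ℂ)⁻¹ • ((σ : ℂ) - 2) ^ k • iteratedDeriv k g 2).re := by
      funext k
      have h1 : ((σ : ℂ) - 2) ^ k = (-1) ^ k * ((y ^ k : ℝ) : ℂ) := by
        rw [ofReal_pow, ← mul_pow, hy]; push_cast; ring
      have h2 : (k.factorial : ℂ)⁻¹ • ((σ : ℂ) - 2) ^ k • iteratedDeriv k g 2 =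
          (((k.factorial : ℝ)⁻¹ * y ^ k : ℝ) : ℂ) * ((-1) ^ k * iteratedDeriv k g 2) := by
        rw [h1, smul_eq_mul, smul_eq_mul]; push_cast; ring
      rw [h2, re_ofReal_mul]
      simp only [hb]
      ring
    rw [hterm]
    exact h
  have hy1 : 1 < y := by linarith
  have hy2 : y ≤ 11 / 10 := by linarith
  have hsplit := hsum.summable.sum_add_tsum_nat_add N
  rw [hsum.tsum_eq] at hsplit
  have htail : -(35 * Q * (33 / 40) ^ N) ≤ ∑' k, b (k + N) * y ^ (k + N) := by
    have hgeo := (hasSum_geometric_of_lt_one (r := 33 / 40) (by norm_num) (by norm_num)).mul_left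
      (-(6 * Q * (33 / 40) ^ N))
    have hle := hasSum_le (fun k ↦ ?_) hgeo
      ((summable_nat_add_iff N).mpr hsum.summable).hasSum
    · refine le_trans ?_ hle
      have : 0 ≤ Q * (33 / 40) ^ N := by positivity
      norm_num
      nlinarith
    · have h1 : (3 / 4 : ℝ) ^ (k + N) * y ^ (k + N) ≤ (33 / 40) ^ (k + N) := by
        rw [← mul_pow]
        gcongr
        linarith
      have h2 : 0 < y ^ (k + N) := by positivity
      have h3 := mul_le_mul_of_nonneg_right (hbb (k + N)) h2.le
      refine le_trans ?_ h3
      have h4 := mul_le_mul_of_nonneg_left h1 (by positivity : 0 ≤ 6 * Q)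
      rw [pow_add (33 / 40 : ℝ)] at h4
      linarith
  have hhead : c - (P 1).re * ((y ^ N - 1) / (y - 1)) ≤ ∑ k ∈ Finset.range N, b k * y ^ k := by
    have h1 : ∑ k ∈ Finset.range N, b k * y ^ k =
        ∑ k ∈ Finset.range N, a k * y ^ k - (P 1).re * ∑ k ∈ Finset.range N, y ^ k := by
      rw [Finset.mul_sum, ← Finset.sum_sub_distrib]
      exact Finset.sum_congr rfl fun k _ ↦ by rw [hba]; ring
    rw [h1, geom_sum_eq hy1.ne']
    have h2 : a 0 * y ^ 0 ≤ ∑ k ∈ Finset.range N, a k * y ^ k :=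
      Finset.single_le_sum (f := fun k ↦ a k * y ^ k)
        (fun k _ ↦ mul_nonneg (ha0 k) (by positivity)) (Finset.mem_range.mpr hN)
    have h3 : a 0 = (f 2).re := by simp [ha]
    rw [h3, pow_zero, mul_one] at h2
    linarith
  have hre : (P σ).re = (P 1).re - (y - 1) * (g σ).re := by
    rw [hPg σ, add_re, ← ofReal_one, ← ofReal_sub, re_ofReal_mul]
    simp [hy]; ring
  have hy10 : 0 < y - 1 := by linarith
  have hfin : (y - 1) * (c - (P 1).re * ((y ^ N - 1) / (y - 1)) - 35 * Q * (33 / 40) ^ N) ≤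
      (P 1).re := by
    have : c - (P 1).re * ((y ^ N - 1) / (y - 1)) - 35 * Q * (33 / 40) ^ N ≤ (g σ).re := by
      linarith
    nlinarith
  have h5 : (y - 1) * ((P 1).re * ((y ^ N - 1) / (y - 1))) = (P 1).re * (y ^ N - 1) := by
    field_simp
  have h6 : 1 - σ = y - 1 := by rw [hy]; ring
  rw [h6]
  nlinarith

end Estermann

section RealCharacters

open Complex Set DirichletCharacter MeasureTheory
open scoped ComplexOrder Topology

variable {q : ℕ}

lemma exists_ofReal_apply {χ : DirichletCharacter ℂ q} (hχ : χ ^ 2 = 1) (a : ZMod q) :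
    ∃ r : ℝ, χ a = r := by
  rcases MulChar.isQuadratic_iff_sq_eq_one.mpr hχ a with h | h | h
  · exact ⟨0, by simp [h]⟩
  · exact ⟨1, by simp [h]⟩
  · exact ⟨-1, by simp [h]⟩

variable [NeZero q]

lemma exists_ofReal_integral_mul_cpow {g : ℝ → ℂ} (hg : ∀ u, ∃ r : ℝ, g u = r) (σ : ℝ) :
    ∃ r : ℝ, ∫ u in Ioi (1 : ℝ), g u * (u : ℂ) ^ (-((σ : ℂ) + 1)) = r := by
  choose r hr using hg
  refine ⟨∫ u in Ioi (1 : ℝ), r u * u ^ (-(σ + 1)), ?_⟩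
  rw [← integral_complex_ofReal]
  refine setIntegral_congr_fun measurableSet_Ioi fun u hu ↦ ?_
  have hu0 : (0 : ℝ) ≤ u := zero_le_one.trans (le_of_lt hu)
  simp only [hr]
  push_cast [ofReal_cpow hu0]
  rfl

/-- The completed function of a real character is real on the positive real axis. -/
lemma exists_ofReal_entireL {χ : DirichletCharacter ℂ q} (hχ : χ ^ 2 = 1) {σ : ℝ} (hσ : 0 < σ) :
    ∃ r : ℝ, entireL χ σ = r := by
  by_cases h : χ = 1
  · subst h
    rw [entireL_one_eq (by simpa using hσ), zetaOne]
    obtain ⟨r, hr⟩ := exists_ofReal_integral_mul_cpow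
      (g := fun u ↦ (((⌊u⌋₊ : ℝ) - u : ℝ) : ℂ)) (fun u ↦ ⟨_, rfl⟩) σ
    refine ⟨(∏ p ∈ q.primeFactors, (1 - (p : ℝ) ^ (-σ))) * (σ + σ * (σ - 1) * r), ?_⟩
    push_cast at hr ⊢
    rw [hr]
    congr 1
    refine Finset.prod_congr rfl fun p _ ↦ ?_
    rw [ofReal_cpow (Nat.cast_nonneg p)]
    push_cast
    rfl
  · rw [entireL_of_ne_one h, LFunction_eq_mul_integral χ h (by simpa using hσ)]
    obtain ⟨r, hr⟩ := exists_ofReal_integral_mul_cpow (g := charSum χ) (fun u ↦ by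
      choose r hr using exists_ofReal_apply hχ
      exact ⟨∑ n ∈ Finset.Icc 1 ⌊u⌋₊, r (n : ZMod q), by simp [charSum, hr]⟩) σ
    exact ⟨σ * r, by rw [hr]; push_cast; rfl⟩

lemma LFunction_two_pos {χ : DirichletCharacter ℂ q} (hχ : χ ^ 2 = 1) :
    0 < χ.LFunction 2 := by
  have h2 : (1 : ℝ) < (2 : ℂ).re := by norm_num
  have hab : LSeries.abscissaOfAbsConv χ.zetaMul < (2 : ℝ) := by
    refine (LSeries.abscissaOfAbsConv_le_of_forall_lt_LSeriesSummable (x := 1) fun y hy ↦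
      χ.LSeriesSummable_zetaMul (by simpa using hy)).trans_lt ?_
    exact_mod_cast (by norm_num : (1 : ℝ) < 2)
  have hpos := LSeries.positive (a := χ.zetaMul) (fun n ↦ zetaMul_nonneg hχ n)
    (by rw [χ.isMultiplicative_zetaMul.map_one]; exact zero_lt_one) hab
  have hmul : LSeries χ.zetaMul 2 = riemannZeta 2 * χ.LFunction 2 := by
    rw [zetaMul, ← ArithmeticFunction.coe_mul, LSeries_convolution', χ.LFunction_eq_LSeries h2,
      ← ArithmeticFunction.LSeries_zeta_eq_riemannZeta h2]
    · congr 1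
      exact (LSeries_congr χ.apply_eq_toArithmeticFunction_apply 2).symm
    · exact ArithmeticFunction.LSeriesSummable_zeta_iff.mpr h2
    · exact (LSeriesSummable_congr 2 χ.apply_eq_toArithmeticFunction_apply).mp
        (χ.LSeriesSummable_of_one_lt_re h2)
  push_cast at hpos
  rw [hmul, riemannZeta_two] at hpos
  have hpi : (0 : ℂ) < (Real.pi : ℂ) ^ 2 / 6 := by
    rw [show (Real.pi : ℂ) ^ 2 / 6 = ((Real.pi ^ 2 / 6 : ℝ) : ℂ) by push_cast; rfl]
    exact_mod_cast (by positivity : (0 : ℝ) < Real.pi ^ 2 / 6)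
  exact (mul_pos_iff_of_pos_left hpi).mp hpos

lemma le_re_prod_LFunction_two (S : Finset (DirichletCharacter ℂ q)) (hS : S.card ≤ 4)
    (hS2 : ∀ χ ∈ S, χ ^ 2 = 1) : 1 / 256 ≤ (∏ χ ∈ S, χ.LFunction 2).re ∧
      0 ≤ ∏ χ ∈ S, χ.LFunction 2 := by
  have hpos : 0 ≤ ∏ χ ∈ S, χ.LFunction 2 :=
    Finset.prod_nonneg fun χ hχ ↦ (LFunction_two_pos (hS2 χ hχ)).le
  refine ⟨?_, hpos⟩
  have hnorm : (1 / 4 : ℝ) ^ 4 ≤ ‖∏ χ ∈ S, χ.LFunction 2‖ := by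
    rw [norm_prod]
    calc (1 / 4 : ℝ) ^ 4 ≤ (1 / 4) ^ S.card := pow_le_pow_of_le_one (by norm_num) (by norm_num) hS
      _ = ∏ χ ∈ S, (1 / 4 : ℝ) := by simp
      _ ≤ _ := Finset.prod_le_prod (fun _ _ ↦ by norm_num) fun χ _ ↦ by
        have := le_norm_LFunction χ (s := 2) (by norm_num)
        norm_num at this ⊢
        exact this
  have h1 : ‖∏ χ ∈ S, χ.LFunction 2‖ = (∏ χ ∈ S, χ.LFunction 2).re := by
    rw [← norm_of_nonneg' hpos, ofReal_re, norm_real, norm_norm]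
  rw [h1] at hnorm
  norm_num at hnorm ⊢
  exact hnorm

end RealCharacters

section EstermannCharacters

open Complex Set DirichletCharacter
open scoped ComplexOrder Topology

lemma estermann_numeric {Q c σ X : ℝ} (hQ : 1 ≤ Q) (hc : c = 1 / 256) (hσ : 9 / 10 ≤ σ)
    (hσ1 : σ < 1)
    (h : ∀ N : ℕ, 0 < N → (c - 35 * Q * (33 / 40) ^ N) * (1 - σ) ≤ X * (2 - σ) ^ N) :
    1 - σ ≤ 512 * (53760 * Q ^ (6 * (1 - σ))) * X := by
  set m := ⌈Real.log (17920 * Q)⌉₊ with hm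
  have hlog : 0 < Real.log (17920 * Q) := Real.log_pos (by linarith)
  have hm1 : Real.log (17920 * Q) ≤ m := Nat.le_ceil _
  have hm2 : m < Real.log (17920 * Q) + 1 := Nat.ceil_lt_add_one hlog.le
  have hm0 : 0 < m := Nat.ceil_pos.mpr hlog
  have hN := h (6 * m) (by omega)
  have h1 : 17920 * Q * (33 / 40 : ℝ) ^ (6 * m) ≤ 1 := by
    have he : (33 / 40 : ℝ) ^ 6 ≤ Real.exp (-1) := by
      rw [Real.exp_neg, ← one_div, le_div_iff₀ (Real.exp_pos 1)]
      nlinarith [Real.exp_one_lt_d9]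
    have h2 : (33 / 40 : ℝ) ^ (6 * m) ≤ Real.exp (-m) := by
      rw [pow_mul, show -(m : ℝ) = m * (-1) by ring, Real.exp_nat_mul]
      gcongr
    have h3 : Real.exp (-m) ≤ (17920 * Q)⁻¹ := by
      rw [Real.exp_neg]
      gcongr
      calc 17920 * Q = Real.exp (Real.log (17920 * Q)) := (Real.exp_log (by linarith)).symm
        _ ≤ _ := Real.exp_le_exp.mpr hm1
    have h4 : 0 < 17920 * Q := by linarith
    calc 17920 * Q * (33 / 40 : ℝ) ^ (6 * m) ≤ 17920 * Q * (17920 * Q)⁻¹ := by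
          gcongr; exact h2.trans h3
      _ = 1 := mul_inv_cancel₀ h4.ne'
  have h5 : 1 / 512 * (1 - σ) ≤ X * (2 - σ) ^ (6 * m) := by
    refine le_trans ?_ hN
    have : 0 < 1 - σ := by linarith
    gcongr
    rw [hc]; linarith
  have hX : 0 < X := by
    have h6 : 0 < (2 - σ) ^ (6 * m) := by have : 0 < 2 - σ := by linarith
                                          positivity
    by_contra hX
    have : X * (2 - σ) ^ (6 * m) ≤ 0 := mul_nonpos_of_nonpos_of_nonneg (not_lt.mp hX) h6.le
    linarith
  have h7 : (2 - σ) ^ (6 * m) ≤ 53760 * Q ^ (6 * (1 - σ)) := by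
    have he : (2 - σ) ≤ Real.exp (1 - σ) := by linarith [Real.add_one_le_exp (1 - σ)]
    calc (2 - σ) ^ (6 * m) ≤ Real.exp (1 - σ) ^ (6 * m) := by
          gcongr; linarith
      _ = Real.exp (m * (6 * (1 - σ))) := by
          rw [← Real.exp_nat_mul]; push_cast; ring_nf
      _ ≤ Real.exp ((Real.log (17920 * Q) + 1) * (6 * (1 - σ))) := by
          apply Real.exp_le_exp.mpr
          apply mul_le_mul_of_nonneg_right hm2.le
          linarith
      _ = Real.exp ((Real.log 17920 + 1) * (6 * (1 - σ))) * Q ^ (6 * (1 - σ)) := by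
          rw [Real.rpow_def_of_pos (by linarith), ← Real.exp_add, Real.log_mul (by norm_num)
            (by linarith)]
          ring_nf
      _ ≤ _ := by
          have : Real.exp ((Real.log 17920 + 1) * (6 * (1 - σ))) ≤ 53760 := by
            calc _ ≤ Real.exp (Real.log 17920 + 1) := by
                  apply Real.exp_le_exp.mpr
                  have : 0 < Real.log (17920 : ℝ) := Real.log_pos (by norm_num)
                  nlinarith
              _ = 17920 * Real.exp 1 := by rw [Real.exp_add, Real.exp_log (by norm_num)]
              _ ≤ 53760 := by linarith [Real.exp_one_lt_three]
          gcongr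
  nlinarith [mul_le_mul_of_nonneg_left h7 hX.le]

variable {q : ℕ}

/-- The Dirichlet series with coefficients `Λ(n) ∑_{χ ∈ S} χ(n)`. -/
noncomputable def sumTwistedMangoldt (S : Finset (DirichletCharacter ℂ q)) : ℂ → ℂ :=
  LSeries fun n : ℕ ↦ (∑ χ ∈ S, χ (n : ZMod q)) * (ArithmeticFunction.vonMangoldt n : ℂ)

lemma coeff_sumTwistedMangoldt (S : Finset (DirichletCharacter ℂ q)) :
    (fun n : ℕ ↦ (∑ χ ∈ S, χ (n : ZMod q)) * (ArithmeticFunction.vonMangoldt n : ℂ)) =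
      ∑ χ ∈ S, (fun n : ℕ ↦ χ n) * fun n : ℕ ↦ (ArithmeticFunction.vonMangoldt n : ℂ) := by
  funext n
  simp [Finset.sum_apply, Finset.sum_mul]

lemma abscissa_sumTwistedMangoldt (S : Finset (DirichletCharacter ℂ q)) :
    LSeries.abscissaOfAbsConv (fun n : ℕ ↦ (∑ χ ∈ S, χ (n : ZMod q)) *
      (ArithmeticFunction.vonMangoldt n : ℂ)) ≤ (1 : ℝ) := by
  refine LSeries.abscissaOfAbsConv_le_of_forall_lt_LSeriesSummable fun y hy ↦ ?_
  rw [coeff_sumTwistedMangoldt]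
  exact LSeriesSummable.sum fun χ _ ↦ χ.LSeriesSummable_twist_vonMangoldt (by simpa using hy)

variable [NeZero q]

lemma sumTwistedMangoldt_eq (S : Finset (DirichletCharacter ℂ q)) {s : ℂ} (hs : 1 < s.re) :
    sumTwistedMangoldt S s = -∑ χ ∈ S, logDeriv χ.LFunction s := by
  rw [sumTwistedMangoldt, coeff_sumTwistedMangoldt,
    LSeries_sum fun χ _ ↦ χ.LSeriesSummable_twist_vonMangoldt hs, ← Finset.sum_neg_distrib]
  refine Finset.sum_congr rfl fun χ _ ↦ ?_
  rw [χ.LSeries_twist_vonMangoldt_eq hs, logDeriv_apply, χ.LFunction_eq_LSeries hs,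
    χ.deriv_LFunction_eq_deriv_LSeries hs, neg_div]

lemma prod_entireL_eq {S : Finset (DirichletCharacter ℂ q)} (h1 : 1 ∈ S) {s : ℂ} (hs : s ≠ 1) :
    ∏ χ ∈ S, entireL χ s = (s - 1) * ∏ χ ∈ S, χ.LFunction s := by
  simp_rw [entireL_eq _ hs, Finset.prod_mul_distrib]
  rw [Finset.prod_ite_eq' S 1 (fun _ ↦ s - 1), if_pos h1]

lemma one_sub_le_prod_entireL (S : Finset (DirichletCharacter ℂ q)) (h1 : 1 ∈ S)
    (hS : S.card ≤ 4) (hS2 : ∀ χ ∈ S, χ ^ 2 = 1) (hpos : ∀ n : ℕ, 0 ≤ ∑ χ ∈ S, χ (n : ZMod q))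
    {σ : ℝ} (hσ : 9 / 10 ≤ σ) (hσ1 : σ < 1) (hPσ : 0 ≤ (∏ χ ∈ S, entireL χ σ).re) :
    1 - σ ≤ 512 * (53760 * ((57 * q : ℝ) ^ 4) ^ (6 * (1 - σ))) *
      (∏ χ ∈ S, entireL χ 1).re := by
  have hq : (1 : ℝ) ≤ q := by exact_mod_cast NeZero.pos q
  have hre {s : ℂ} (hs : 1 < s.re) : s ≠ 1 := fun h ↦ by simp [h] at hs
  refine estermann_numeric (one_le_pow₀ (by linarith)) rfl hσ hσ1 fun N hN ↦
    estermann_truncated (P := fun s ↦ ∏ χ ∈ S, entireL χ s) (f := fun s ↦ ∏ χ ∈ S, χ.LFunction s)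
      ?_ ?_ (fun s hs ↦ prod_entireL_eq h1 (hre hs)) ?_ (le_re_prod_LFunction_two S hS hS2).1
      hσ hσ1 hPσ hN
  · exact Differentiable.fun_finsetProd fun χ _ ↦ differentiable_entireL χ
  · intro z hz
    rw [Metric.mem_closedBall, dist_eq_norm] at hz
    have hzre : 1 / 2 ≤ z.re := by
      have := (abs_re_le_norm (z - 2)).trans hz
      rw [sub_re, re_ofNat] at this
      linarith [(abs_le.mp this).1]
    have hzn : ‖z‖ ≤ 10 / 3 := by
      have := norm_sub_norm_le z 2
      rw [Complex.norm_ofNat] at this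
      linarith
    rw [norm_prod]
    calc ∏ χ ∈ S, ‖entireL χ z‖ ≤ ∏ χ ∈ S, (57 * q : ℝ) := by
          refine Finset.prod_le_prod (fun _ _ ↦ norm_nonneg _) fun χ _ ↦
            (norm_entireL_le χ hzre).trans ?_
          have : (1 + ‖z‖) ^ 2 ≤ (13 / 3) ^ 2 := by gcongr; linarith
          nlinarith
      _ = (57 * q : ℝ) ^ S.card := by simp
      _ ≤ _ := pow_le_pow_right₀ (by linarith) hS
  · have hLd : ∀ χ ∈ S, ∀ s : ℂ, 1 < s.re → DifferentiableAt ℂ χ.LFunction s :=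
      fun χ _ s hs ↦ χ.differentiableAt_LFunction s (.inl (hre hs))
    refine iteratedDeriv_alternating_of_deriv (h := sumTwistedMangoldt S) ?_ ?_ ?_ ?_
      (le_re_prod_LFunction_two S hS hS2).2
    · exact fun s hs ↦ (DifferentiableAt.fun_finsetProd fun χ hχ ↦
        hLd χ hχ s hs).differentiableWithinAt
    · exact (LSeries_differentiableOn _).mono fun s hs ↦
        (abscissa_sumTwistedMangoldt S).trans_lt (by exact_mod_cast hs)
    · intro s hs
      have hne : ∀ χ ∈ S, χ.LFunction s ≠ 0 := fun χ _ ↦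
        χ.LFunction_ne_zero_of_one_le_re (.inr (hre hs)) hs.le
      have := logDeriv_prod hne fun χ hχ ↦ hLd χ hχ s hs
      rw [← neg_eq_iff_eq_neg.mpr (sumTwistedMangoldt_eq S hs), logDeriv_apply, div_eq_iff
        (Finset.prod_ne_zero_iff.mpr hne)] at this
      rw [this]; ring
    · intro k
      have := LSeries.iteratedDeriv_alternating (a := fun n : ℕ ↦ (∑ χ ∈ S, χ (n : ZMod q)) *
        (ArithmeticFunction.vonMangoldt n : ℂ)) (fun n ↦ mul_nonneg (hpos n) 
          (Complex.zero_le_real.mpr ArithmeticFunction.vonMangoldt_nonneg)) (x := 2)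
        ((abscissa_sumTwistedMangoldt S).trans_lt (by exact_mod_cast one_lt_two)) k
      exact_mod_cast this

end EstermannCharacters

section Discs

open Complex Set DirichletCharacter Metric
open scoped Topology

lemma one_sub_mul_cpow_ne_zero {p : ℕ} (hp : p.Prime) {a : ℂ} (ha : ‖a‖ ≤ 1) {s : ℂ}
    (hs : 0 < s.re) : 1 - a * (p : ℂ) ^ (-s) ≠ 0 := by
  intro h
  have h1 : ‖a * (p : ℂ) ^ (-s)‖ < 1 := by
    rw [norm_mul, norm_natCast_cpow_of_pos hp.pos]
    have : (p : ℝ) ^ (-s).re < 1 :=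
      Real.rpow_lt_one_of_one_lt_of_neg (by exact_mod_cast hp.one_lt) (by simpa using hs)
    nlinarith [norm_nonneg a, Real.rpow_nonneg (Nat.cast_nonneg (α := ℝ) p) (-s).re]
  rw [← sub_eq_zero.mp h, norm_one] at h1
  exact lt_irrefl _ h1

lemma re_of_norm_sub_one_le {s : ℂ} {r : ℝ} (h : ‖s - 1‖ ≤ r) : 1 - r ≤ s.re ∧ s.re ≤ 1 + r := by
  have := abs_le.mp ((abs_re_le_norm (s - 1)).trans h)
  rw [sub_re, one_re] at this
  constructor <;> linarith [this.1, this.2]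

variable {q : ℕ} [NeZero q]

lemma entireL_one_ne_zero_of_norm_sub_one_lt {s : ℂ} (hs : ‖s - 1‖ < 1 / 4) :
    entireL (1 : DirichletCharacter ℂ q) s ≠ 0 := by
  have hre := (re_of_norm_sub_one_le hs.le).1
  have hre0 : 0 < s.re := by linarith
  rw [entireL_one_eq hre0]
  refine mul_ne_zero (Finset.prod_ne_zero_iff.mpr fun p hp ↦ ?_) ?_
  · simpa using one_sub_mul_cpow_ne_zero (Nat.prime_of_mem_primeFactors hp) (a := 1) (by simp) hre0
  · rw [zetaOne]
    set J := ∫ u in Ioi (1 : ℝ), ((⌊u⌋₊ : ℂ) - u) * (u : ℂ) ^ (-(s + 1)) with hJ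
    have hJn : ‖J‖ ≤ 1 / (s.re - 0) :=
      norm_integral_mul_cpow_le (fun u hu ↦ norm_floor_sub_le hu) hre0
    have h1 : ‖(s - 1) * J‖ < 1 := by
      rw [norm_mul]
      have h2 : 1 / (s.re - 0) ≤ 4 / 3 := by
        rw [div_le_div_iff₀ (by linarith) (by norm_num)]; linarith
      nlinarith [norm_nonneg (s - 1), norm_nonneg J]
    have h3 : s + s * (s - 1) * J = s * (1 + (s - 1) * J) := by ring
    rw [h3]
    refine mul_ne_zero (fun h ↦ by simp [h] at hre0) fun h ↦ ?_
    rw [eq_neg_of_add_eq_zero_right h, norm_neg, norm_one] at h1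
    exact lt_irrefl _ h1

lemma norm_entireL_one_one_le : ‖entireL (1 : DirichletCharacter ℂ q) 1‖ ≤ 1 := by
  rw [entireL_one_eq (by simp), zetaOne, sub_self, mul_zero, zero_mul, add_zero, mul_one, norm_prod]
  refine Finset.prod_le_one (fun _ _ ↦ norm_nonneg _) fun p hp ↦ ?_
  have hp1 : (1 : ℝ) ≤ p := by exact_mod_cast (Nat.prime_of_mem_primeFactors hp).one_lt.le
  have : (1 : ℂ) - (p : ℂ) ^ (-1 : ℂ) = ((1 - (p : ℝ)⁻¹ : ℝ) : ℂ) := by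
    rw [cpow_neg_one]; push_cast; rfl
  rw [this, norm_real, Real.norm_eq_abs, abs_le]
  constructor <;> nlinarith [inv_le_one_of_one_le₀ hp1, inv_nonneg.mpr (zero_le_one.trans hp1)]

lemma norm_LFunction_one_le {χ : DirichletCharacter ℂ q} (hχ : χ ≠ 1) {θ : ℝ} (hθ : 0 < θ)
    (hθ1 : θ ≤ 1) : ‖χ.LFunction 1‖ ≤ (q : ℝ) ^ θ / θ := by
  have := norm_LFunction_le χ hχ hθ.le hθ1 (s := 1) (by simp) (by simpa using hθ)
  simpa using this

/-- A lower bound for `L(1, χ)` gives a zero free disc around `1`. -/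
lemma LFunction_ne_zero_of_le_norm {χ : DirichletCharacter ℂ q} (hχ : χ ≠ 1) {θ b : ℝ}
    (hθ : 0 < θ) (hθ1 : θ ≤ 1) (hb : b ≤ ‖χ.LFunction 1‖) {s : ℂ}
    (hs : ‖s - 1‖ * (12 * (q : ℝ) ^ θ) < b * θ ^ 2) : χ.LFunction s ≠ 0 := by
  have hq : (0 : ℝ) < (q : ℝ) ^ θ := Real.rpow_pos_of_pos (by exact_mod_cast NeZero.pos q) _
  have hbq : b * θ ≤ (q : ℝ) ^ θ := by
    have := hb.trans (norm_LFunction_one_le hχ hθ hθ1)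
    rwa [le_div_iff₀ hθ] at this
  have hs4 : ‖s - 1‖ < θ / 4 := by
    by_contra! h
    nlinarith
  have hderiv : ∀ z ∈ ball (1 : ℂ) (θ / 4), ‖deriv χ.LFunction z‖ ≤ 12 * (q : ℝ) ^ θ / θ ^ 2 := by
    intro z hz
    rw [mem_ball, dist_eq_norm] at hz
    have := norm_deriv_le_of_forall_mem_sphere_norm_le (c := z) (f := χ.LFunction)
      (C := 3 * (q : ℝ) ^ θ / θ) (by positivity : 0 < θ / 4)
      (differentiable_LFunction hχ).diffContOnCl fun w hw ↦ ?_
    · refine this.trans_eq ?_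
      field_simp; ring
    · rw [mem_sphere, dist_eq_norm] at hw
      have hw1 : ‖w - 1‖ ≤ θ / 2 := by
        have := norm_add_le (w - z) (z - 1)
        rw [sub_add_sub_cancel] at this
        linarith
      have hre := (re_of_norm_sub_one_le hw1).1
      have hn : ‖w‖ ≤ 3 / 2 := by
        have := norm_add_le (w - 1) 1
        rw [sub_add_cancel, norm_one] at this
        linarith
      refine (norm_LFunction_le χ hχ hθ.le hθ1 (by linarith) (by linarith)).trans ?_
      have hw0 : 0 < w.re - (1 - θ) := by linarith
      calc ‖w‖ * ((q : ℝ) ^ θ / (w.re - (1 - θ))) ≤ 3 / 2 * ((q : ℝ) ^ θ / (θ / 2)) := by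
            gcongr
            linarith
        _ = _ := by field_simp
  have hmv := (convex_ball (1 : ℂ) (θ / 4)).norm_image_sub_le_of_norm_deriv_le
    (fun z _ ↦ (differentiable_LFunction hχ) z) hderiv (mem_ball_self (by positivity))
    (by rwa [mem_ball, dist_eq_norm])
  intro h0
  rw [h0, zero_sub, norm_neg] at hmv
  have h1 : 12 * (q : ℝ) ^ θ / θ ^ 2 * ‖s - 1‖ < b := by
    rw [div_mul_eq_mul_div, div_lt_iff₀ (by positivity)]
    linarith
  linarith

end Discs

section Siegel

open Complex Set DirichletCharacter
open scoped ComplexOrder Topology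

lemma LFunction_ne_zero_of_le_norm_mul_rpow {q : ℕ} [NeZero q] {χ : DirichletCharacter ℂ q}
    (hχ : χ ≠ 1) {ε b : ℝ} (hε : 0 < ε) (hε1 : ε ≤ 1)
    (hb : b ≤ ‖χ.LFunction 1‖ * (q : ℝ) ^ (ε / 2)) {s : ℂ}
    (hs : ‖s - 1‖ < b * (ε / 8) ^ 2 / 12 * (q : ℝ) ^ (-ε)) : χ.LFunction s ≠ 0 := by
  have hq : (0 : ℝ) < q := by exact_mod_cast NeZero.pos q
  have hq1 : (1 : ℝ) ≤ q := by exact_mod_cast NeZero.pos q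
  have hb0 : 0 < b := by
    have h1 := (norm_nonneg (s - 1)).trans_lt hs
    by_contra! h
    have : b * (ε / 8) ^ 2 / 12 ≤ 0 := by nlinarith [sq_nonneg (ε / 8)]
    exact absurd h1 (not_lt.mpr (mul_nonpos_of_nonpos_of_nonneg this
      (Real.rpow_nonneg hq.le _)))
  refine LFunction_ne_zero_of_le_norm hχ (θ := ε / 8) (b := b * (q : ℝ) ^ (-(ε / 2)))
    (by linarith) (by linarith) ?_ ?_
  · rw [Real.rpow_neg hq.le, ← div_eq_mul_inv, div_le_iff₀ (by positivity)]
    exact hb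
  · have h1 : (q : ℝ) ^ (-ε) * (q : ℝ) ^ (ε / 8) ≤ (q : ℝ) ^ (-(ε / 2)) := by
      rw [← Real.rpow_add hq]
      exact Real.rpow_le_rpow_of_exponent_le hq1 (by linarith)
    have h2 : 0 < (q : ℝ) ^ (ε / 8) := by positivity
    calc ‖s - 1‖ * (12 * (q : ℝ) ^ (ε / 8)) <
          b * (ε / 8) ^ 2 / 12 * (q : ℝ) ^ (-ε) * (12 * (q : ℝ) ^ (ε / 8)) := by gcongr
      _ = b * (ε / 8) ^ 2 * ((q : ℝ) ^ (-ε) * (q : ℝ) ^ (ε / 8)) := by ring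
      _ ≤ b * (ε / 8) ^ 2 * (q : ℝ) ^ (-(ε / 2)) := by gcongr
      _ = _ := by ring

lemma one_add_apply_nonneg {q : ℕ} {χ : DirichletCharacter ℂ q} (hχ : χ ^ 2 = 1) (a : ZMod q) :
    0 ≤ (1 : DirichletCharacter ℂ q) a + χ a := by
  by_cases ha : IsUnit a
  · rw [MulChar.one_apply ha]
    rcases MulChar.isQuadratic_iff_sq_eq_one.mpr hχ a with h | h | h <;> rw [h] <;> norm_num
  · simp [MulChar.map_nonunit _ ha]

lemma one_add_add_add_apply_nonneg {q : ℕ} {χ ψ : DirichletCharacter ℂ q} (hχ : χ ^ 2 = 1)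
    (hψ : ψ ^ 2 = 1) (a : ZMod q) :
    0 ≤ (1 : DirichletCharacter ℂ q) a + χ a + ψ a + (χ * ψ) a := by
  by_cases ha : IsUnit a
  · rw [MulChar.one_apply ha, MulChar.mul_apply]
    rcases MulChar.isQuadratic_iff_sq_eq_one.mpr hχ a with h | h | h <;>
    rcases MulChar.isQuadratic_iff_sq_eq_one.mpr hψ a with h' | h' | h' <;>
    rw [h, h'] <;> norm_num
  · simp [MulChar.map_nonunit _ ha]

/-- Lower bound for `L(1, χ)` when there are no real zeros of real characters near `1`. -/
lemma le_norm_LFunction_one_of_no_zeros {q : ℕ} [NeZero q] {χ : DirichletCharacter ℂ q}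
    (hχ : χ ^ 2 = 1) (hχ1 : χ ≠ 1) {σ : ℝ} (hσ : 9 / 10 ≤ σ) (hσ1 : σ < 1)
    (hz : ∀ β : ℝ, σ ≤ β → β < 1 → entireL χ β ≠ 0) :
    1 - σ ≤ 512 * (53760 * ((57 * q : ℝ) ^ 4) ^ (6 * (1 - σ))) * ‖χ.LFunction 1‖ := by
  have hS : ∀ s, ∏ ψ ∈ ({1, χ} : Finset (DirichletCharacter ℂ q)), entireL ψ s =
      entireL 1 s * entireL χ s := fun s ↦ Finset.prod_pair hχ1.symm
  have hS2 : ∀ ψ ∈ ({1, χ} : Finset (DirichletCharacter ℂ q)), ψ ^ 2 = 1 := by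
    intro ψ hψ
    simp only [Finset.mem_insert, Finset.mem_singleton] at hψ
    rcases hψ with h | h
    · rw [h, one_pow]
    · rw [h, hχ]
  have hP := one_sub_le_prod_entireL (q := q) {1, χ} (by simp) (Finset.card_le_two.trans (by norm_num))
    hS2 (fun n ↦ by rw [Finset.sum_pair hχ1.symm]; exact one_add_apply_nonneg hχ n) hσ hσ1 ?_
  · refine hP.trans (mul_le_mul_of_nonneg_left ?_ (by positivity))
    rw [hS, ← entireL_of_ne_one hχ1]
    refine (re_le_norm _).trans ?_
    rw [norm_mul]
    exact mul_le_of_le_one_left (norm_nonneg _) norm_entireL_one_one_le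
  · set P : ℝ → ℝ := fun x ↦ (∏ ψ ∈ ({1, χ} : Finset (DirichletCharacter ℂ q)), entireL ψ x).re
    have hPc : Continuous P := by
      refine continuous_re.comp ((?_ : Continuous fun s : ℂ ↦ ∏ ψ ∈ ({1, χ} : Finset
        (DirichletCharacter ℂ q)), entireL ψ s).comp continuous_ofReal)
      exact continuous_finsetProd _ fun ψ _ ↦ (differentiable_entireL ψ).continuous
    have hP2 : 0 ≤ P 2 := by
      have : (0 : ℂ) ≤ ∏ ψ ∈ ({1, χ} : Finset (DirichletCharacter ℂ q)), entireL ψ 2 := by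
        rw [prod_entireL_eq (by simp) (by norm_num)]
        refine mul_nonneg (by norm_num) (Finset.prod_nonneg fun ψ hψ ↦ ?_)
        refine (LFunction_two_pos ?_).le
        exact hS2 ψ hψ
      exact_mod_cast (Complex.nonneg_iff.mp this).1
    by_contra! hneg
    obtain ⟨x, hx, hx0⟩ := intermediate_value_Icc (show σ ≤ 2 by linarith) hPc.continuousOn
      ⟨hneg.le, hP2⟩
    obtain ⟨r, hr⟩ := exists_ofReal_entireL hχ (show 0 < x by linarith [hx.1])
    obtain ⟨r', hr'⟩ := exists_ofReal_entireL (q := q) (χ := 1) (by simp)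
      (show 0 < x by linarith [hx.1])
    simp only [P] at hx0
    rw [hS, hr, hr', ← ofReal_mul, ofReal_re, mul_eq_zero] at hx0
    rcases hx0 with h | h
    · rw [h, ofReal_zero] at hr'
      rcases le_or_gt 1 x with h1 | h1
      · exact entireL_ne_zero_of_one_le_re 1 (by simpa using h1) hr'
      · refine entireL_one_ne_zero_of_norm_sub_one_lt ?_ hr'
        rw [← ofReal_one, ← ofReal_sub, norm_real, Real.norm_eq_abs, abs_lt]
        constructor <;> linarith [hx.1]
    · rw [h, ofReal_zero] at hr
      rcases le_or_gt 1 x with h1 | h1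
      · exact entireL_ne_zero_of_one_le_re χ (by simpa using h1) hr
      · exact hz x hx.1 h1 hr

/-- Lower bound for `L(1, ψ)` from a real zero of another real character of the same modulus. -/
lemma le_norm_LFunction_one_of_zero {q : ℕ} [NeZero q] {χ ψ : DirichletCharacter ℂ q}
    (hχ : χ ^ 2 = 1) (hχ1 : χ ≠ 1) (hψ : ψ ^ 2 = 1) (hψ1 : ψ ≠ 1) (hne : χ ≠ ψ)
    {β : ℝ} (hβ : 9 / 10 ≤ β) (hβ1 : β < 1) (hz : entireL χ β = 0) {θ : ℝ} (hθ : 0 < θ)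
    (hθ1 : θ ≤ 1) :
    1 - β ≤ 512 * (53760 * ((57 * q : ℝ) ^ 4) ^ (6 * (1 - β))) *
      (((q : ℝ) ^ θ / θ) ^ 2 * ‖ψ.LFunction 1‖) := by
  have hmul1 : χ * ψ ≠ 1 := by
    intro h
    apply hne
    calc χ = χ * ψ ^ 2 := by rw [hψ, mul_one]
      _ = χ * ψ * ψ := by rw [sq, mul_assoc]
      _ = ψ := by rw [h, one_mul]
  have hmulχ : χ ≠ χ * ψ := fun h ↦ hψ1 (by simpa using h)
  have hmulψ : ψ ≠ χ * ψ := fun h ↦ hχ1 (by simpa using h)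
  set S : Finset (DirichletCharacter ℂ q) := {1, χ, ψ, χ * ψ} with hSdef
  have hS1 : (1 : DirichletCharacter ℂ q) ∉ ({χ, ψ, χ * ψ} : Finset _) := by
    simp [hχ1.symm, hψ1.symm, hmul1.symm]
  have hS2 : χ ∉ ({ψ, χ * ψ} : Finset (DirichletCharacter ℂ q)) := by
    simp only [Finset.mem_insert, Finset.mem_singleton, not_or]; exact ⟨hne, hmulχ⟩
  have hprod : ∀ s, ∏ φ ∈ S, entireL φ s =
      entireL 1 s * (entireL χ s * (entireL ψ s * entireL (χ * ψ) s)) := fun s ↦ by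
    rw [hSdef, Finset.prod_insert hS1, Finset.prod_insert hS2, Finset.prod_pair hmulψ]
  have hP := one_sub_le_prod_entireL (q := q) S (by simp [hSdef]) Finset.card_le_four
    (by rintro φ hφ
        simp only [hSdef, Finset.mem_insert, Finset.mem_singleton] at hφ
        rcases hφ with rfl | rfl | rfl | rfl
        · simp
        · exact hχ
        · exact hψ
        · rw [mul_pow, hχ, hψ, one_mul])
    (fun n ↦ by
      rw [hSdef, Finset.sum_insert hS1, Finset.sum_insert hS2, Finset.sum_pair hmulψ,
        ← add_assoc, ← add_assoc]
      exact one_add_add_add_apply_nonneg hχ hψ n) hβ hβ1 (by rw [hprod, hz]; simp)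
  refine hP.trans (mul_le_mul_of_nonneg_left ?_ (by positivity))
  rw [hprod, entireL_of_ne_one hχ1, entireL_of_ne_one hψ1, entireL_of_ne_one hmul1]
  refine (re_le_norm _).trans ?_
  rw [norm_mul, norm_mul, norm_mul]
  have h1 := norm_entireL_one_one_le (q := q)
  have h2 := norm_LFunction_one_le hχ1 hθ hθ1
  have h3 := norm_LFunction_one_le hmul1 hθ hθ1
  have h0 : 0 ≤ (q : ℝ) ^ θ / θ := by positivity
  calc _ ≤ 1 * ((q : ℝ) ^ θ / θ * (‖ψ.LFunction 1‖ * ((q : ℝ) ^ θ / θ))) := by gcongr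
    _ = _ := by ring

end Siegel

section SiegelTheorem

open Complex Set DirichletCharacter
open scoped ComplexOrder Topology

lemma rpow_conductor_le {N t ε : ℝ} (hN : 1 ≤ N) (ht : 24 * t ≤ ε / 4) (hε1 : ε ≤ 1) :
    ((57 * N) ^ 4) ^ (6 * t) ≤ 57 * N ^ (ε / 4) := by
  have h1 : ((57 * N) ^ 4) ^ (6 * t) = (57 * N) ^ (24 * t) := by
    rw [← Real.rpow_natCast (57 * N) 4, ← Real.rpow_mul (by linarith)]
    norm_num
    ring_nf
  rw [h1, Real.mul_rpow (by norm_num) (by linarith)]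
  gcongr
  · calc (57 : ℝ) ^ (24 * t) ≤ 57 ^ (1 : ℝ) :=
        Real.rpow_le_rpow_of_exponent_le (by norm_num) (by linarith)
      _ = 57 := Real.rpow_one _

lemma LFunction_eq_zero_of_changeLevel_eq {M N : ℕ} [NeZero M] [NeZero N] {s : ℂ} (hs : 0 < s.re)
    (hMN : M ∣ N) {χ : DirichletCharacter ℂ M} (hχ : χ ≠ 1)
    (h0 : (changeLevel hMN χ).LFunction s = 0) : χ.LFunction s = 0 := by
  rw [LFunction_changeLevel hMN χ (.inl hχ), mul_eq_zero] at h0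
  refine h0.resolve_right (Finset.prod_ne_zero_iff.mpr fun p hp ↦ ?_)
  exact one_sub_mul_cpow_ne_zero (Nat.prime_of_mem_primeFactors hp) (χ.norm_le_one _) hs

lemma LFunction_changeLevel_eq_zero {M N : ℕ} [NeZero M] [NeZero N] {s : ℂ}
    (hMN : M ∣ N) {χ : DirichletCharacter ℂ M} (hχ : χ ≠ 1) (h0 : χ.LFunction s = 0) :
    (changeLevel hMN χ).LFunction s = 0 := by
  rw [LFunction_changeLevel hMN χ (.inl hχ), h0, zero_mul]

lemma exists_forall_LFunction_ne_zero_of_no_zeros {ε : ℝ} (hε : 0 < ε) (hε1 : ε ≤ 1)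
    (H : ∀ (q : ℕ) (_ : NeZero q) (χ : DirichletCharacter ℂ q), χ ^ 2 = 1 → χ ≠ 1 →
      ∀ β : ℝ, 1 - ε / 100 ≤ β → β < 1 → χ.LFunction β ≠ 0) :
    ∃ c : ℝ, 0 < c ∧ ∀ (q : ℕ) (_ : NeZero q) (χ : DirichletCharacter ℂ q), χ ^ 2 = 1 → χ ≠ 1 →
      ∀ s : ℂ, ‖s - 1‖ < c * (q : ℝ) ^ (-ε) → χ.LFunction s ≠ 0 := by
  set b : ℝ := ε / 100 / (512 * 53760 * 57) with hb
  refine ⟨b * (ε / 8) ^ 2 / 12, by positivity, fun q _ χ hχ hχ1 s hs ↦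
    LFunction_ne_zero_of_le_norm_mul_rpow hχ1 hε hε1 ?_ hs⟩
  have hq1 : (1 : ℝ) ≤ q := by exact_mod_cast NeZero.pos q
  have h1 := le_norm_LFunction_one_of_no_zeros hχ hχ1 (σ := 1 - ε / 100) (by linarith) (by linarith)
    (fun β hβ hβ1 ↦ by rw [entireL_of_ne_one hχ1]; exact H q _ χ hχ hχ1 β hβ hβ1)
  have h2 := rpow_conductor_le (N := q) (t := 1 - (1 - ε / 100)) (ε := ε) hq1 (by linarith) hε1
  have h3 : (q : ℝ) ^ (ε / 4) ≤ (q : ℝ) ^ (ε / 2) :=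
    Real.rpow_le_rpow_of_exponent_le hq1 (by linarith)
  rw [hb, div_le_iff₀ (by norm_num)]
  calc ε / 100 = 1 - (1 - ε / 100) := by ring
    _ ≤ _ := h1
    _ ≤ 512 * (53760 * (57 * (q : ℝ) ^ (ε / 2))) * ‖χ.LFunction 1‖ := by
      gcongr
      exact h2.trans (by gcongr)
    _ = _ := by ring

lemma exists_forall_LFunction_ne_zero_of_zero {ε : ℝ} (hε : 0 < ε) (hε1 : ε ≤ 1) {q₁ : ℕ}
    [NeZero q₁] {χ₁ : DirichletCharacter ℂ q₁} (hχ₁ : χ₁ ^ 2 = 1) (hne₁ : χ₁ ≠ 1) {β : ℝ}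
    (hβ : 1 - ε / 100 ≤ β) (hβ1 : β < 1) (hz : χ₁.LFunction β = 0) :
    ∃ c : ℝ, 0 < c ∧ ∀ (q : ℕ) (_ : NeZero q) (χ : DirichletCharacter ℂ q), χ ^ 2 = 1 → χ ≠ 1 →
      ∀ s : ℂ, ‖s - 1‖ < c * (q : ℝ) ^ (-ε) → χ.LFunction s ≠ 0 := by
  have hq₁ : (1 : ℝ) ≤ q₁ := by exact_mod_cast NeZero.pos q₁
  set b : ℝ := (1 - β) / (512 * 53760 * 57) * (ε / 8) ^ 2 with hb
  have hβ0 : 0 < 1 - β := by linarith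
  have hb0 : 0 < b := by positivity
  have hL1 : 0 < ‖χ₁.LFunction 1‖ :=
    norm_pos_iff.mpr (χ₁.LFunction_ne_zero_of_one_le_re (.inl hne₁) (by simp))
  have hc1 : 0 < ‖χ₁.LFunction 1‖ * (ε / 8) ^ 2 / 12 := by positivity
  have hc2 : 0 < b * (ε / 8) ^ 2 / 12 * (q₁ : ℝ) ^ (-ε) := by positivity
  refine ⟨min (min (‖χ₁.LFunction 1‖ * (ε / 8) ^ 2 / 12 * (q₁ : ℝ) ^ (-ε))
    (b * (ε / 8) ^ 2 / 12 * (q₁ : ℝ) ^ (-ε))) (1 / 2), by positivity, ?_⟩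
  intro q _ χ hχ hne s hs hs0
  have hq : (1 : ℝ) ≤ q := by exact_mod_cast NeZero.pos q
  have hqε : 0 < (q : ℝ) ^ (-ε) := Real.rpow_pos_of_pos (by linarith) _
  have hqε1 : (q : ℝ) ^ (-ε) ≤ 1 := Real.rpow_le_one_of_one_le_of_nonpos hq (by linarith)
  have hs1 : ‖s - 1‖ < ‖χ₁.LFunction 1‖ * (ε / 8) ^ 2 / 12 * (q₁ : ℝ) ^ (-ε) :=
    calc ‖s - 1‖ < _ := hs
      _ ≤ ‖χ₁.LFunction 1‖ * (ε / 8) ^ 2 / 12 * (q₁ : ℝ) ^ (-ε) * 1 := by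
        gcongr; exact (min_le_left _ _).trans (min_le_left _ _)
      _ = _ := mul_one _
  have hs2 : ‖s - 1‖ < b * (ε / 8) ^ 2 / 12 * ((q₁ * q : ℕ) : ℝ) ^ (-ε) := by
    refine hs.trans_le ?_
    push_cast
    rw [Real.mul_rpow (by linarith) (by linarith), ← mul_assoc]
    gcongr
    exact (min_le_left _ _).trans (min_le_right _ _)
  have hsre : 0 < s.re := by
    have : ‖s - 1‖ ≤ 1 / 2 := by
      refine hs.le.trans ?_
      nlinarith [min_le_right (min (‖χ₁.LFunction 1‖ * (ε / 8) ^ 2 / 12 * (q₁ : ℝ) ^ (-ε))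
        (b * (ε / 8) ^ 2 / 12 * (q₁ : ℝ) ^ (-ε))) (1 / 2)]
    linarith [(re_of_norm_sub_one_le this).1]
  have hd₁ : q₁ ∣ q₁ * q := dvd_mul_right _ _
  have hd : q ∣ q₁ * q := dvd_mul_left _ _
  have hN : (1 : ℝ) ≤ ((q₁ * q : ℕ) : ℝ) := by exact_mod_cast NeZero.pos (q₁ * q)
  have hs0' := LFunction_changeLevel_eq_zero hd hne hs0
  by_cases heq : changeLevel hd₁ χ₁ = changeLevel hd χ
  · refine LFunction_ne_zero_of_le_norm_mul_rpow hne₁ hε hε1 (b := ‖χ₁.LFunction 1‖) ?_ hs1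
      (LFunction_eq_zero_of_changeLevel_eq hsre hd₁ hne₁ (heq ▸ hs0'))
    exact le_mul_of_one_le_right (norm_nonneg _) (Real.one_le_rpow hq₁ (by linarith))
  · have hne' : changeLevel hd χ ≠ 1 := fun h ↦ hne ((changeLevel_eq_one_iff hd).mp h)
    have hne₁' : changeLevel hd₁ χ₁ ≠ 1 := fun h ↦ hne₁ ((changeLevel_eq_one_iff hd₁).mp h)
    refine LFunction_ne_zero_of_le_norm_mul_rpow hne' hε hε1 (b := b) ?_ hs2 hs0'
    have h1 := le_norm_LFunction_one_of_zero (χ := changeLevel hd₁ χ₁) (ψ := changeLevel hd χ)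
      (by rw [← map_pow, hχ₁, map_one]) hne₁' (by rw [← map_pow, hχ, map_one]) hne' heq
      (β := β) (by linarith) hβ1
      (by rw [entireL_of_ne_one hne₁']; exact LFunction_changeLevel_eq_zero hd₁ hne₁ hz)
      (θ := ε / 8) (by linarith) (by linarith)
    have h2 := rpow_conductor_le (N := ((q₁ * q : ℕ) : ℝ)) (t := 1 - β) (ε := ε) hN (by linarith) hε1
    generalize ((q₁ * q : ℕ) : ℝ) = N at *
    have h3 : N ^ (ε / 4) * (N ^ (ε / 8)) ^ 2 = N ^ (ε / 2) := by
      rw [sq, ← Real.rpow_add (by linarith), ← Real.rpow_add (by linarith)]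
      ring_nf
    generalize ‖(changeLevel hd χ).LFunction 1‖ = L at *
    have hL0 : 0 ≤ (N ^ (ε / 8) / (ε / 8)) ^ 2 * L := by
      by_contra! h
      have : 0 < 512 * (53760 * ((57 * N) ^ 4) ^ (6 * (1 - β))) := by
        have : 0 < N := by linarith
        positivity
      nlinarith
    have h4 : 1 - β ≤ 512 * (53760 * (57 * N ^ (ε / 4))) * ((N ^ (ε / 8) / (ε / 8)) ^ 2 * L) :=
      h1.trans (by gcongr)
    rw [hb, ← h3, div_mul_eq_mul_div, div_le_iff₀ (by norm_num), ← le_div_iff₀ (by positivity)]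
    refine h4.trans_eq ?_
    rw [div_pow]
    field_simp

/-- **Siegel's theorem**: zero free discs around `1` for real characters. -/
theorem exists_forall_entireL_ne_zero {ε : ℝ} (hε : 0 < ε) :
    ∃ c : ℝ, 0 < c ∧ ∀ (q : ℕ) (_ : NeZero q) (χ : DirichletCharacter ℂ q), χ ^ 2 = 1 →
      ∀ s : ℂ, ‖s - 1‖ < c * (q : ℝ) ^ (-ε) → entireL χ s ≠ 0 := by
  suffices h : ∃ c : ℝ, 0 < c ∧ ∀ (q : ℕ) (_ : NeZero q) (χ : DirichletCharacter ℂ q),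
      χ ^ 2 = 1 → χ ≠ 1 → ∀ s : ℂ, ‖s - 1‖ < c * (q : ℝ) ^ (-(min ε 1)) → χ.LFunction s ≠ 0 by
    obtain ⟨c, hc, h⟩ := h
    refine ⟨min c (1 / 4), by positivity, fun q _ χ hχ s hs ↦ ?_⟩
    have hq : (1 : ℝ) ≤ q := by exact_mod_cast NeZero.pos q
    have hqε : 0 < (q : ℝ) ^ (-ε) := Real.rpow_pos_of_pos (by linarith) _
    have hqε1 : (q : ℝ) ^ (-ε) ≤ 1 := Real.rpow_le_one_of_one_le_of_nonpos hq (by linarith)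
    by_cases hχ1 : χ = 1
    · subst hχ1
      refine entireL_one_ne_zero_of_norm_sub_one_lt (hs.trans_le ?_)
      nlinarith [min_le_right c (1 / 4)]
    · rw [entireL_of_ne_one hχ1]
      refine h q _ χ hχ hχ1 s (hs.trans_le ?_)
      have := Real.rpow_le_rpow_of_exponent_le hq (neg_le_neg (min_le_left ε 1))
      gcongr
      exact min_le_left _ _
  have hε' : 0 < min ε 1 := lt_min hε one_pos
  by_cases H : ∀ (q : ℕ) (_ : NeZero q) (χ : DirichletCharacter ℂ q), χ ^ 2 = 1 → χ ≠ 1 →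
      ∀ β : ℝ, 1 - min ε 1 / 100 ≤ β → β < 1 → χ.LFunction β ≠ 0
  · exact exists_forall_LFunction_ne_zero_of_no_zeros hε' (min_le_right _ _) H
  · push Not at H
    obtain ⟨q₁, _, χ₁, hχ₁, hne₁, β, hβ, hβ1, hz⟩ := H
    exact exists_forall_LFunction_ne_zero_of_zero hε' (min_le_right _ _) hχ₁ hne₁ hβ hβ1 hz

end SiegelTheorem

section ZeroFree

open Complex Set DirichletCharacter Filter
open scoped Topology

/-- The constant in the zero free region. -/
noncomputable def zeroFreeConst : ℝ := Real.exp (-20) / 100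

lemma zeroFreeConst_pos : 0 < zeroFreeConst := by unfold zeroFreeConst; positivity

lemma zeroFreeConst_le : zeroFreeConst ≤ 1 / 100 := by
  have := exp_neg_twenty_mul_le
  unfold zeroFreeConst
  linarith

lemma eventually_rpow_le_exp (A : ℝ) : ∀ᶠ l : ℝ in atTop, l ^ A ≤ Real.exp l := by
  have := (isLittleO_rpow_exp_atTop A).bound one_pos
  filter_upwards [this, eventually_ge_atTop 0] with l hl hl0
  rw [Real.norm_of_nonneg (Real.rpow_nonneg hl0 A), Real.norm_of_nonneg (Real.exp_pos l).le,
    one_mul] at hl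
  exact hl

lemma eventually_entireL_ne_zero {A : ℝ} (hA : 0 < A) : ∀ᶠ l : ℝ in atTop,
    ∀ (q : ℕ) (_ : NeZero q), (q : ℝ) ≤ l ^ A → ∀ (χ : DirichletCharacter ℂ q) (ρ : ℂ),
      |ρ.im| ≤ 2 * Real.exp l → 1 - zeroFreeConst / l ≤ ρ.re → entireL χ ρ ≠ 0 := by
  obtain ⟨c, hc, hS⟩ := exists_forall_entireL_ne_zero (ε := (2 * A)⁻¹) (by positivity)
  filter_upwards [eventually_rpow_le_exp A, eventually_ge_atTop 1, eventually_gt_atTop ((11 / c) ^ 2)]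
    with l hlA hl hlc q _ hq χ ρ him hre h0
  have hl0 : 0 < l := by linarith
  obtain ⟨hχ, him'⟩ := sq_eq_one_of_entireL_eq_zero hl (hq.trans hlA) χ him
    (by rwa [zeroFreeConst, div_div] at hre) h0
  refine hS q _ χ hχ ρ ?_ h0
  have hre1 : ρ.re < 1 := by
    by_contra! h
    exact entireL_ne_zero_of_one_le_re χ h h0
  have hq0 : (0 : ℝ) < q := by exact_mod_cast NeZero.pos q
  have h1 : ‖ρ - 1‖ ≤ |(ρ - 1).re| + |(ρ - 1).im| := norm_le_abs_re_add_abs_im _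
  rw [sub_re, sub_im, one_re, one_im, sub_zero, abs_of_neg (by linarith)] at h1
  have hsq : √l * √l = l := Real.mul_self_sqrt hl0.le
  have hsc : 11 / c < √l := Real.lt_sqrt_of_sq_lt hlc
  have hs0 : 0 < √l := Real.sqrt_pos.mpr hl0
  have h2 : c / √l ≤ c * (q : ℝ) ^ (-(2 * A)⁻¹) := by
    rw [Real.rpow_neg hq0.le, ← div_eq_mul_inv]
    gcongr
    calc (q : ℝ) ^ (2 * A)⁻¹ ≤ (l ^ A) ^ (2 * A)⁻¹ := by gcongr
      _ = √l := by
        rw [← Real.rpow_mul hl0.le, Real.sqrt_eq_rpow]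
        congr 1
        field_simp
  refine lt_of_lt_of_le ?_ h2
  have h3 : Real.exp (-20) ≤ 1 := by linarith [exp_neg_twenty_mul_le, Real.exp_pos (-20)]
  have h4 : ‖ρ - 1‖ < 11 / l := by
    have h5 : zeroFreeConst / l ≤ 1 / 100 / l := by gcongr; exact zeroFreeConst_le
    have h6 : Real.exp (-20) / l ≤ 1 / l := by gcongr
    have h7 : 11 / l = 11 * (1 / l) := by ring
    have h8 : 1 / 100 / l = 1 / 100 * (1 / l) := by ring
    have h9 : 0 < 1 / l := by positivity
    linarith
  refine h4.trans ?_
  rw [div_lt_div_iff₀ hl0 hs0]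
  rw [div_lt_iff₀ hc] at hsc
  nlinarith

variable {q : ℕ} [NeZero q]

lemma norm_logDeriv_entireL_le {l : ℝ} (hl : 1 ≤ l) (hq : (q : ℝ) ≤ Real.exp l)
    (χ : DirichletCharacter ℂ q)
    (hz : ∀ ρ : ℂ, |ρ.im| ≤ 2 * Real.exp l → 1 - zeroFreeConst / l ≤ ρ.re → entireL χ ρ ≠ 0)
    {s : ℂ} (him : |s.im| ≤ Real.exp l) (hre : 1 - zeroFreeConst / 4 / l ≤ s.re)
    (hre' : s.re ≤ 1 + zeroFreeConst / 2 / l) :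
    ‖deriv (entireL χ) s / entireL χ s‖ ≤ 1040 / zeroFreeConst * l ^ 2 := by
  have hκ := zeroFreeConst_pos
  have hκ1 := zeroFreeConst_le
  have hexp : 1 + l ≤ Real.exp l := by linarith [Real.add_one_le_exp l]
  have hl0 : 0 < l := by linarith
  set κ := zeroFreeConst with hκdef
  set ν := κ / l with hν
  have hν0 : 0 < ν := by positivity
  have hν1 : ν ≤ 1 / 100 := (div_le_self hκ.le hl).trans hκ1
  have e4 : κ / 4 / l = ν / 4 := by rw [hν]; ring
  have e2 : κ / 2 / l = ν / 2 := by rw [hν]; ring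
  rw [e4] at hre
  rw [e2] at hre'
  set c : ℂ := ((1 + ν / 2 : ℝ) : ℂ) + s.im * I with hc
  have hcre : c.re = 1 + ν / 2 := by simp [hc]
  have hcim : c.im = s.im := by simp [hc]
  have hball : ∀ z ∈ Metric.ball c (3 / 2 * ν), 1 - ν < z.re ∧ z.re < 1 + 2 * ν ∧
      |z.im| ≤ Real.exp l + 1 := by
    intro z hz
    rw [Metric.mem_ball, dist_eq_norm] at hz
    have h1 := abs_lt.mp ((abs_re_le_norm (z - c)).trans_lt hz)
    have h2 := abs_lt.mp ((abs_im_le_norm (z - c)).trans_lt hz)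
    have h3 := abs_le.mp him
    rw [sub_re, hcre] at h1
    rw [sub_im, hcim] at h2
    refine ⟨by linarith, by linarith, abs_le.mpr ⟨by linarith, by linarith⟩⟩
  have h := norm_logDeriv_le_of_ne_zero (f := entireL χ) (c := c) (R := 3 / 2 * ν) (M := 65 * l)
    (z := s) (by positivity) (by positivity) (differentiable_entireL χ).differentiableOn ?_ ?_ ?_
  · refine h.trans_eq ?_
    rw [hν]; field_simp; ring
  · intro z hzb
    obtain ⟨h1, -, h3⟩ := hball z hzb
    exact hz z (by linarith) h1.le
  · intro z hzb
    obtain ⟨h1, h2, h3⟩ := hball z hzb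
    have := norm_entireL_le_exp_mul (a := 26) hl (by norm_num) hq χ (c := c) (z := z) ?_
      (by rw [hcre]; linarith) (by linarith) ?_
    · refine this.trans_eq ?_
      norm_num
    · rw [hcre]
      have : Real.exp (-26) ≤ κ / 2 := by
        rw [hκdef, zeroFreeConst, show (-26 : ℝ) = -20 + -6 by norm_num, Real.exp_add]
        have h6 : Real.exp (-6) ≤ 1 / 200 := by
          rw [Real.exp_neg, ← one_div]
          gcongr
          have h2 : (2.7 : ℝ) ≤ Real.exp 1 := by linarith [Real.exp_one_gt_d9]
          calc (200 : ℝ) ≤ 2.7 ^ 6 := by norm_num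
            _ ≤ Real.exp 1 ^ 6 := by gcongr
            _ = Real.exp 6 := by rw [← Real.exp_nat_mul]; norm_num
        nlinarith [Real.exp_pos (-20)]
      have h5 : ν / 2 = κ / 2 / l := e2.symm
      rw [h5]
      gcongr
    · have := norm_le_abs_re_add_abs_im z
      have h4 : |z.re| ≤ 2 := abs_le.mpr ⟨by linarith, by linarith⟩
      linarith
  · have hsc : s - c = ((s.re - (1 + ν / 2) : ℝ) : ℂ) := by
      apply Complex.ext <;> simp [hc]
    rw [dist_eq_norm, hsc, norm_real, Real.norm_eq_abs, abs_le]
    constructor <;> linarith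

/-- The analytic continuation of the Dirichlet series of `Λ` on a residue class, with the pole at
`1` removed. -/
noncomputable def residueAux (a : ZMod q) (s : ℂ) : ℂ :=
  -((q.totient : ℂ)⁻¹ * ∑ χ : DirichletCharacter ℂ q,
    χ a⁻¹ * (deriv (entireL χ) s / entireL χ s))

lemma residueAux_eq {a : ZMod q} (ha : IsUnit a) {s : ℂ} (hs : 1 < s.re) :
    residueAux a s = LSeries (fun n ↦ (ArithmeticFunction.vonMangoldt.residueClass a n : ℂ)) s -
      (q.totient : ℂ)⁻¹ / (s - 1) := by
  have h := ArithmeticFunction.vonMangoldt.eqOn_LFunctionResidueClassAux ha hs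
  simp only at h
  rw [← h, ArithmeticFunction.vonMangoldt.LFunctionResidueClassAux, residueAux,
    ← Finset.sum_compl_add_sum {1}, Finset.sum_singleton, entireL_one, neg_mul_eq_mul_neg]
  congr 1
  have ha' : IsUnit a⁻¹ := isUnit_of_dvd_one ⟨a, (ZMod.inv_mul_of_unit a ha).symm⟩
  rw [MulChar.one_apply ha', one_mul, neg_add, neg_div, neg_add_eq_sub]
  congr 1
  refine Finset.sum_congr ?_ fun χ hχ ↦ ?_
  · ext; simp
  · rw [entireL_of_ne_one (by simpa using hχ), mul_div_assoc]

lemma norm_residueAux_le (a : ZMod q) {s : ℂ} {B : ℝ}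
    (h : ∀ χ : DirichletCharacter ℂ q, ‖deriv (entireL χ) s / entireL χ s‖ ≤ B) :
    ‖residueAux a s‖ ≤ B := by
  have hφ : (0 : ℝ) < q.totient := by exact_mod_cast Nat.totient_pos.mpr (NeZero.pos q)
  rw [residueAux, norm_neg, norm_mul, norm_inv, norm_natCast, inv_mul_le_iff₀ hφ]
  refine (norm_sum_le _ _).trans ?_
  calc ∑ χ : DirichletCharacter ℂ q, ‖χ a⁻¹ * (deriv (entireL χ) s / entireL χ s)‖
      ≤ ∑ χ : DirichletCharacter ℂ q, B := by
        refine Finset.sum_le_sum fun χ _ ↦ ?_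
        rw [norm_mul]
        exact (mul_le_of_le_one_left (norm_nonneg _) (χ.norm_le_one _)).trans (h χ)
    _ = q.totient * B := by
        rw [Finset.sum_const, nsmul_eq_mul, Finset.card_univ, ← Nat.card_eq_fintype_card,
          card_eq_totient_of_hasEnoughRootsOfUnity]

lemma differentiableAt_residueAux (a : ZMod q) {s : ℂ}
    (h : ∀ χ : DirichletCharacter ℂ q, entireL χ s ≠ 0) : DifferentiableAt ℂ (residueAux a) s := by
  refine (DifferentiableAt.const_mul (DifferentiableAt.fun_sum fun χ _ ↦ ?_) _).neg
  exact (((differentiable_entireL χ).deriv s).div (differentiable_entireL χ s)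
    (h χ)).const_mul _

end ZeroFree

section Package

open Complex Filter Topology

lemma eventually_residueAux {A : ℝ} (hA : 0 < A) : ∀ᶠ l : ℝ in atTop,
    ∀ q : ℕ, ∀ _ : NeZero q, (q : ℝ) ≤ l ^ A → ∀ (a : ZMod q) (s : ℂ), |s.im| ≤ Real.exp l →
      1 - zeroFreeConst / 4 / l ≤ s.re → s.re ≤ 1 + zeroFreeConst / 2 / l →
      DifferentiableAt ℂ (residueAux a) s ∧ ‖residueAux a s‖ ≤ 1040 / zeroFreeConst * l ^ 2 := by
  filter_upwards [eventually_entireL_ne_zero hA, eventually_rpow_le_exp A,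
    eventually_ge_atTop (1 : ℝ)] with l hz hle hl q _ hq a s him hre hre'
  have hκ := zeroFreeConst_pos
  have hl0 : 0 < l := by linarith
  refine ⟨differentiableAt_residueAux a fun χ ↦ hz q _ hq χ s ?_ ?_,
    norm_residueAux_le a fun χ ↦ norm_logDeriv_entireL_le hl (hq.trans hle) χ
      (hz q _ hq χ) him hre hre'⟩
  · linarith [Real.exp_pos l]
  · have : zeroFreeConst / 4 / l ≤ zeroFreeConst / l := by gcongr; linarith
    linarith

lemma norm_LSeries_le_re_LSeries {c : ℕ → ℝ} (hc : ∀ n, 0 ≤ c n) {s : ℂ}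
    (hs : LSeriesSummable (fun n ↦ (c n : ℂ)) s) :
    ‖LSeries (fun n ↦ (c n : ℂ)) s‖ ≤ ‖LSeries (fun n ↦ (c n : ℂ)) s.re‖ := by
  have key : LSeries (fun n ↦ (c n : ℂ)) s.re =
      ((∑' n, ‖LSeries.term (fun n ↦ (c n : ℂ)) s n‖ : ℝ) : ℂ) := by
    rw [LSeries, ofReal_tsum]
    refine tsum_congr fun n ↦ ?_
    rcases eq_or_ne n 0 with rfl | hn
    · simp
    · rw [LSeries.norm_term_eq, LSeries.term_of_ne_zero hn]
      simp only [hn, if_false, norm_real, Real.norm_of_nonneg (hc n)]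
      push_cast [ofReal_cpow (Nat.cast_nonneg n)]
      rfl
  rw [key, norm_real, Real.norm_of_nonneg (tsum_nonneg fun _ ↦ norm_nonneg _), LSeries]
  exact norm_tsum_le_tsum_norm hs.norm

variable {q : ℕ}

lemma LSeriesSummable_residueClass (a : ZMod q) {s : ℂ} (hs : 1 < s.re) :
    LSeriesSummable
      (fun n ↦ (ArithmeticFunction.vonMangoldt.residueClass a n : ℂ)) s := by
  refine LSeriesSummable_of_abscissaOfAbsConv_lt_re ?_
  exact (ArithmeticFunction.vonMangoldt.abscissaOfAbsConv_residueClass_le_one a).trans_lt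
    (by exact_mod_cast hs)

lemma norm_residueAux_le_of_ofReal [NeZero q] {a : ZMod q} (ha : IsUnit a) {s : ℂ} (hs : 1 < s.re) :
    ‖residueAux a s‖ ≤ ‖residueAux a s.re‖ + 2 / (s.re - 1) := by
  have h1 : 0 < s.re - 1 := by linarith
  have hφ : ‖((q.totient : ℂ))⁻¹‖ ≤ 1 := by
    rw [norm_inv, norm_natCast]
    exact inv_le_one_of_one_le₀ (by exact_mod_cast Nat.totient_pos.mpr (NeZero.pos q))
  have hp : ∀ z : ℂ, z.re = s.re → ‖((q.totient : ℂ))⁻¹ / (z - 1)‖ ≤ 1 / (s.re - 1) := by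
    intro z hz
    rw [norm_div]
    have h2 : s.re - 1 ≤ ‖z - 1‖ := by
      have := (le_abs_self _).trans (abs_re_le_norm (z - 1))
      simpa [hz] using this
    gcongr
  have e1 := residueAux_eq ha hs
  have e2 := residueAux_eq ha (s := (s.re : ℂ)) (by simpa using hs)
  have h3 := norm_LSeries_le_re_LSeries
    (ArithmeticFunction.vonMangoldt.residueClass_nonneg a) (LSeriesSummable_residueClass a hs)
  have h4 : ‖LSeries (fun n ↦ (ArithmeticFunction.vonMangoldt.residueClass a n : ℂ)) s.re‖ ≤
      ‖residueAux a s.re‖ + 1 / (s.re - 1) := by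
    have h6 := norm_sub_norm_le (LSeries (fun n ↦
      (ArithmeticFunction.vonMangoldt.residueClass a n : ℂ)) s.re) ((q.totient : ℂ)⁻¹ / (s.re - 1))
    rw [← e2] at h6
    have := hp s.re (by simp)
    linarith
  rw [e1]
  refine (norm_sub_le _ _).trans ?_
  have := hp s rfl
  have h5 : 2 / (s.re - 1) = 1 / (s.re - 1) + 1 / (s.re - 1) := by ring
  linarith

lemma eventually_norm_residueAux_line {A : ℝ} (hA : 0 < A) : ∀ᶠ l : ℝ in atTop,
    ∀ q : ℕ, ∀ _ : NeZero q, (q : ℝ) ≤ l ^ A → ∀ (a : ZMod q) (s : ℂ), IsUnit a →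
      s.re = 1 + zeroFreeConst / 2 / l → ‖residueAux a s‖ ≤ 1044 / zeroFreeConst * l ^ 2 := by
  filter_upwards [eventually_residueAux hA, eventually_ge_atTop (1 : ℝ)] with l h hl q _ hq a s ha hs
  have hκ := zeroFreeConst_pos
  have hl0 : 0 < l := by linarith
  have hp : 0 < zeroFreeConst / 2 / l := by positivity
  have hp4 : 0 < zeroFreeConst / 4 / l := by positivity
  have h1 := norm_residueAux_le_of_ofReal ha (s := s) (by linarith)
  have h2 := (h q ‹_› hq a (s.re : ℂ) (by simpa using (Real.exp_pos l).le)
    (by simp only [ofReal_re]; linarith) (by simp only [ofReal_re]; linarith)).2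
  have h3 : 2 / (s.re - 1) = 4 / zeroFreeConst * l := by
    rw [hs, add_sub_cancel_left]; field_simp; norm_num
  have h4 : 4 / zeroFreeConst * l ≤ 4 / zeroFreeConst * l ^ 2 := by
    gcongr; nlinarith
  calc _ ≤ 1040 / zeroFreeConst * l ^ 2 + 4 / zeroFreeConst * l ^ 2 := by linarith
    _ = _ := by ring

end Package

section Perron

open Complex Filter Topology MeasureTheory Set

/-- The hat function `(1 - u)` on `(0, 1]`. -/
noncomputable def hat : ℝ → ℂ := indicator (Ioc 0 1) fun u ↦ 1 - (u : ℂ)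

/-- The function `(1 - u) ^ 2 / (2 u)` on `(0, 1]`. -/
noncomputable def hatPole : ℝ → ℂ := indicator (Ioc 0 1) fun u ↦ (1 - (u : ℂ)) ^ 2 / (2 * u)

lemma hasMellin_hat {s : ℂ} (hs : 0 < s.re) : HasMellin hat s (1 / (s * (s + 1))) := by
  have h1 := hasMellin_one_Ioc hs
  have h2 := hasMellin_cpow_Ioc 1 (s := s) (by simp; linarith)
  have h := hasMellin_sub h1.1 h2.1
  rw [h1.2, h2.2] at h
  have hs0 : s ≠ 0 := fun h ↦ by simp [h] at hs
  have hs1 : s + 1 ≠ 0 := fun h ↦ by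
    have := congrArg re h; simp at this; linarith
  have e : hat = fun t ↦ indicator (Ioc 0 1) (fun _ ↦ (1 : ℂ)) t -
      indicator (Ioc 0 1) (fun t : ℝ ↦ (t : ℂ) ^ (1 : ℂ)) t := by
    funext u
    by_cases hu : u ∈ Ioc (0 : ℝ) 1
    · simp only [hat, indicator_of_mem hu, cpow_one]
    · simp only [hat, indicator_of_notMem hu, sub_zero]
  have e2 : 1 / (s * (s + 1)) = 1 / s - 1 / (s + 1) := by field_simp; ring
  rw [e, e2]
  exact h

lemma hasMellin_hatPole {s : ℂ} (hs : 1 < s.re) :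
    HasMellin hatPole s (1 / ((s - 1) * (s * (s + 1)))) := by
  have h1 := hasMellin_one_Ioc (s := s) (by linarith)
  have h2 := hasMellin_cpow_Ioc 1 (s := s) (by simp; linarith)
  have h3 := hasMellin_cpow_Ioc (-1) (s := s) (by simp; linarith)
  have h4 := hasMellin_const_smul h1.1 (2 : ℂ)
  have h5 := hasMellin_sub h3.1 h4.1
  have h6 := hasMellin_add h5.1 h2.1
  have h7 := hasMellin_const_smul h6.1 (2⁻¹ : ℂ)
  rw [h6.2, h5.2, h4.2, h3.2, h2.2, h1.2] at h7
  have hs0 : s ≠ 0 := fun h ↦ by simp [h] at hs; linarith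
  have hs1 : s + 1 ≠ 0 := fun h ↦ by
    have := congrArg re h; simp at this; linarith
  have hs2 : s - 1 ≠ 0 := fun h ↦ by
    have := congrArg re h; simp at this; linarith
  have hs3 : s + -1 ≠ 0 := by rwa [← sub_eq_add_neg]
  have e : hatPole = fun t ↦ (2⁻¹ : ℂ) • (indicator (Ioc 0 1) (fun t : ℝ ↦ (t : ℂ) ^ (-1 : ℂ)) t -
      (2 : ℂ) • indicator (Ioc 0 1) (fun _ ↦ (1 : ℂ)) t +
      indicator (Ioc 0 1) (fun t : ℝ ↦ (t : ℂ) ^ (1 : ℂ)) t) := by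
    funext u
    by_cases hu : u ∈ Ioc (0 : ℝ) 1
    · have : (u : ℂ) ≠ 0 := by exact_mod_cast hu.1.ne'
      simp only [hatPole, indicator_of_mem hu, cpow_one, cpow_neg_one, smul_eq_mul]
      field_simp; ring
    · simp only [hatPole, indicator_of_notMem hu, smul_zero, sub_zero, add_zero]
  have e2 : 1 / ((s - 1) * (s * (s + 1))) =
      (2⁻¹ : ℂ) • (1 / (s + -1) - (2 : ℂ) • (1 / s) + 1 / (s + 1)) := by
    simp only [smul_eq_mul]
    rw [← sub_eq_add_neg]
    field_simp; ring
  rw [e, e2]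
  exact h7

lemma hat_eq_max {u : ℝ} (hu : 0 < u) : hat u = ((max (1 - u) 0 : ℝ) : ℂ) := by
  by_cases h : u ≤ 1
  · rw [hat, indicator_of_mem (mem_Ioc.mpr ⟨hu, h⟩), max_eq_left (by linarith)]; push_cast; rfl
  · rw [hat, indicator_of_notMem (fun H ↦ h H.2), max_eq_right (by linarith)]; simp

lemma hatPole_eq_max {u : ℝ} (hu : 0 < u) :
    hatPole u = ((max (1 - u) 0 ^ 2 / (2 * u) : ℝ) : ℂ) := by
  by_cases h : u ≤ 1
  · rw [hatPole, indicator_of_mem (mem_Ioc.mpr ⟨hu, h⟩), max_eq_left (by linarith)]; push_cast; rfl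
  · rw [hatPole, indicator_of_notMem (fun H ↦ h H.2), max_eq_right (by linarith)]; simp

lemma continuousAt_hat {u : ℝ} (hu : 0 < u) : ContinuousAt hat u := by
  have : hat =ᶠ[𝓝 u] fun u ↦ ((max (1 - u) 0 : ℝ) : ℂ) := by
    filter_upwards [lt_mem_nhds hu] with v hv using hat_eq_max hv
  refine ContinuousAt.congr ?_ this.symm
  fun_prop

lemma continuousAt_hatPole {u : ℝ} (hu : 0 < u) : ContinuousAt hatPole u := by
  have : hatPole =ᶠ[𝓝 u] fun u ↦ ((max (1 - u) 0 ^ 2 / (2 * u) : ℝ) : ℂ) := by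
    filter_upwards [lt_mem_nhds hu] with v hv using hatPole_eq_max hv
  refine ContinuousAt.congr ?_ this.symm
  refine continuous_ofReal.continuousAt.comp ?_
  exact ContinuousAt.div (by fun_prop) (by fun_prop) (by positivity)

lemma one_add_sq_le_norm {σ : ℝ} (hσ : 1 / 2 ≤ σ) (t : ℝ) :
    (1 + t ^ 2) / 4 ≤ ‖((σ : ℂ) + t * I) * ((σ : ℂ) + t * I + 1)‖ := by
  have h1 : ‖(σ : ℂ) + t * I‖ ≤ ‖(σ : ℂ) + t * I + 1‖ := by
    refine (sq_le_sq₀ (norm_nonneg _) (norm_nonneg _)).mp ?_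
    rw [← normSq_eq_norm_sq, ← normSq_eq_norm_sq, normSq_apply, normSq_apply]
    simp; nlinarith
  rw [norm_mul]
  calc (1 + t ^ 2) / 4 ≤ ‖(σ : ℂ) + t * I‖ * ‖(σ : ℂ) + t * I‖ := by
        rw [← sq, ← normSq_eq_norm_sq, normSq_apply]
        simp; nlinarith [sq_nonneg t]
    _ ≤ _ := by gcongr

lemma norm_inv_mul_add_one_le {σ : ℝ} (hσ : 1 / 2 ≤ σ) (t : ℝ) :
    ‖1 / (((σ : ℂ) + t * I) * ((σ : ℂ) + t * I + 1))‖ ≤ 4 * (1 + t ^ 2)⁻¹ := by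
  have h := one_add_sq_le_norm hσ t
  rw [norm_div, norm_one, ← div_eq_mul_inv]
  have : 0 < (1 + t ^ 2) / 4 := by positivity
  calc _ ≤ 1 / ((1 + t ^ 2) / 4) := by gcongr
    _ = _ := by field_simp

lemma add_mul_I_ne_zero {σ : ℝ} (hσ : 0 < σ) (t : ℝ) : (σ : ℂ) + t * I ≠ 0 := fun h ↦ by
  have := congrArg re h; simp at this; linarith

lemma add_mul_I_add_one_ne_zero {σ : ℝ} (hσ : 0 < σ) (t : ℝ) : (σ : ℂ) + t * I + 1 ≠ 0 :=
  fun h ↦ by have := congrArg re h; simp at this; linarith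

lemma integrable_bounded_mul {σ : ℝ} (hσ : 1 / 2 ≤ σ) {F : ℝ → ℂ} (hF : Continuous F) {B : ℝ}
    (hB : ∀ t, ‖F t‖ ≤ B) :
    Integrable fun t : ℝ ↦ F t * (1 / (((σ : ℂ) + t * I) * ((σ : ℂ) + t * I + 1))) := by
  have hσ0 : 0 < σ := by linarith
  refine Integrable.mono' (g := fun t ↦ B * (4 * (1 + t ^ 2)⁻¹))
    ((integrable_inv_one_add_sq.const_mul 4).const_mul B) ?_ (ae_of_all _ fun t ↦ ?_)
  · refine (hF.mul ?_).aestronglyMeasurable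
    refine Continuous.div (by fun_prop) (by fun_prop) fun t ↦ ?_
    exact mul_ne_zero (add_mul_I_ne_zero hσ0 t) (add_mul_I_add_one_ne_zero hσ0 t)
  · rw [norm_mul]
    exact mul_le_mul (hB t) (norm_inv_mul_add_one_le hσ t) (norm_nonneg _)
      ((norm_nonneg _).trans (hB t))

end Perron

section PerronSum

open Complex Filter Topology MeasureTheory Set

lemma hat_eq_integral {σ u : ℝ} (hσ : 1 / 2 ≤ σ) (hu : 0 < u) :
    hat u = (1 / (2 * Real.pi) : ℝ) • ∫ t : ℝ, (u : ℂ) ^ (-((σ : ℂ) + t * I)) *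
      (1 / (((σ : ℂ) + t * I) * ((σ : ℂ) + t * I + 1))) := by
  have hm : ∀ t : ℝ, HasMellin hat ((σ : ℂ) + t * I)
      (1 / (((σ : ℂ) + t * I) * ((σ : ℂ) + t * I + 1))) := fun t ↦
    hasMellin_hat (by simp; linarith)
  have h := mellinInv_mellin_eq σ hat hu (by simpa using (hm 0).1)
    (by
      simp only [VerticalIntegrable, (hm _).2]
      simpa using integrable_bounded_mul hσ (F := fun _ ↦ 1) continuous_const (B := 1) (by simp))
    (continuousAt_hat hu)
  rw [← h, mellinInv]
  simp only [(hm _).2, smul_eq_mul]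

lemma hatPole_eq_integral {σ u : ℝ} (hσ : 1 < σ) (hu : 0 < u) :
    hatPole u = (1 / (2 * Real.pi) : ℝ) • ∫ t : ℝ, (u : ℂ) ^ (-((σ : ℂ) + t * I)) *
      (1 / ((σ : ℂ) + t * I - 1)) * (1 / (((σ : ℂ) + t * I) * ((σ : ℂ) + t * I + 1))) := by
  have hm : ∀ t : ℝ, HasMellin hatPole ((σ : ℂ) + t * I)
      (1 / ((σ : ℂ) + t * I - 1) * (1 / (((σ : ℂ) + t * I) * ((σ : ℂ) + t * I + 1)))) := fun t ↦ by
    rw [div_mul_div_comm, one_mul]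
    exact hasMellin_hatPole (by simpa using hσ)
  have h1 : ∀ t : ℝ, σ - 1 ≤ ‖(σ : ℂ) + t * I - 1‖ := fun t ↦ by
    simpa using (le_abs_self _).trans (abs_re_le_norm ((σ : ℂ) + t * I - 1))
  have h := mellinInv_mellin_eq σ hatPole hu (by simpa using (hm 0).1)
    (by
      simp only [VerticalIntegrable, (hm _).2]
      refine integrable_bounded_mul (by linarith) (F := fun t ↦ 1 / ((σ : ℂ) + t * I - 1))
        (continuous_const.div (by fun_prop) fun t h0 ↦ ?_) (B := 1 / (σ - 1)) fun t ↦ ?_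
      · have := h1 t
        rw [h0, norm_zero] at this
        linarith
      · rw [norm_div, norm_one]
        have := h1 t
        have : 0 < σ - 1 := by linarith
        gcongr)
    (continuousAt_hatPole hu)
  rw [← h, mellinInv]
  simp only [(hm _).2, smul_eq_mul, mul_assoc]

lemma norm_ofReal_cpow_line {y : ℝ} (hy : 0 < y) (σ t : ℝ) :
    ‖(y : ℂ) ^ ((σ : ℂ) + t * I)‖ = y ^ σ := by
  rw [norm_cpow_eq_rpow_re_of_pos hy]; simp

lemma continuous_cpow_line {z : ℂ} (hz : z ≠ 0) (σ : ℝ) :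
    Continuous fun t : ℝ ↦ z ^ ((σ : ℂ) + t * I) :=
  Continuous.const_cpow (by fun_prop) (Or.inl hz)

lemma continuous_term_line (c : ℕ → ℂ) (σ : ℝ) (n : ℕ) :
    Continuous fun t : ℝ ↦ LSeries.term c ((σ : ℂ) + t * I) n := by
  rcases eq_or_ne n 0 with rfl | hn
  · simpa using continuous_const
  · simp only [LSeries.term_of_ne_zero hn]
    have hn' : (n : ℂ) ≠ 0 := by exact_mod_cast hn
    exact continuous_const.div (continuous_cpow_line hn' σ) fun t ↦ by simp [cpow_eq_zero_iff, hn]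

lemma continuous_LSeries_line {c : ℕ → ℂ} {σ : ℝ} (hc : LSeriesSummable c σ) :
    Continuous fun t : ℝ ↦ LSeries c ((σ : ℂ) + t * I) := by
  unfold LSeries
  refine continuous_tsum (u := fun n ↦ ‖LSeries.term c σ n‖) (continuous_term_line c σ)
    hc.norm fun n t ↦ ?_
  rw [LSeries.norm_term_eq, LSeries.norm_term_eq]; simp

lemma norm_LSeries_line_le {c : ℕ → ℂ} {σ : ℝ} (hc : LSeriesSummable c σ) (t : ℝ) :
    ‖LSeries c ((σ : ℂ) + t * I)‖ ≤ ∑' n, ‖LSeries.term c σ n‖ := by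
  refine tsum_of_norm_bounded hc.norm.hasSum fun n ↦ ?_
  rw [LSeries.norm_term_eq, LSeries.norm_term_eq]; simp

lemma hasSum_hat {c : ℕ → ℂ} {σ : ℝ} (hσ : 1 / 2 ≤ σ) (hc : LSeriesSummable c σ) {y : ℝ}
    (hy : 0 < y) :
    HasSum (fun n : ℕ ↦ c n * hat (n / y)) ((1 / (2 * Real.pi) : ℝ) • ∫ t : ℝ,
      ((y : ℂ) ^ ((σ : ℂ) + t * I) * LSeries c ((σ : ℂ) + t * I)) *
        (1 / (((σ : ℂ) + t * I) * ((σ : ℂ) + t * I + 1)))) := by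
  have hy0 : (y : ℂ) ≠ 0 := by exact_mod_cast hy.ne'
  set F : ℕ → ℝ → ℂ := fun n t ↦ ((y : ℂ) ^ ((σ : ℂ) + t * I) *
    LSeries.term c ((σ : ℂ) + t * I) n) * (1 / (((σ : ℂ) + t * I) * ((σ : ℂ) + t * I + 1))) with hF
  have hnt : ∀ n (t : ℝ), ‖LSeries.term c ((σ : ℂ) + t * I) n‖ = ‖LSeries.term c σ n‖ :=
    fun n t ↦ by rw [LSeries.norm_term_eq, LSeries.norm_term_eq]; simp
  have hyc : Continuous fun t : ℝ ↦ (y : ℂ) ^ ((σ : ℂ) + t * I) :=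
    continuous_cpow_line hy0 σ
  have hInt : ∀ n, Integrable (F n) := fun n ↦
    integrable_bounded_mul hσ (hyc.mul (continuous_term_line c σ n)) (B := y ^ σ * ‖LSeries.term c σ n‖) fun t ↦ by
      rw [norm_mul, norm_ofReal_cpow_line hy, hnt]
  have hnorm : ∀ n, ∫ t, ‖F n t‖ = y ^ σ * ‖LSeries.term c σ n‖ *
      ∫ t : ℝ, ‖1 / (((σ : ℂ) + t * I) * ((σ : ℂ) + t * I + 1))‖ := fun n ↦ by
    rw [← integral_const_mul]
    congr 1
    ext t
    rw [hF]
    simp only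
    rw [norm_mul, norm_mul, norm_ofReal_cpow_line hy, hnt]
  have hsum : Summable fun n ↦ ∫ t, ‖F n t‖ := by
    simp only [hnorm]
    exact (hc.norm.mul_left _).mul_right _
  have h := (hasSum_integral_of_summable_integral_norm hInt hsum).const_smul
    (1 / (2 * Real.pi) : ℝ)
  have e1 : (fun n : ℕ ↦ c n * hat (n / y)) =
      fun n ↦ (1 / (2 * Real.pi) : ℝ) • ∫ t, F n t := by
    funext n
    rcases eq_or_ne n 0 with rfl | hn
    · simp [hF, hat]
    · have hn' : (0 : ℝ) < n := by exact_mod_cast Nat.pos_of_ne_zero hn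
      rw [hat_eq_integral hσ (div_pos hn' hy), mul_smul_comm, ← integral_const_mul]
      congr 2
      ext t
      rw [hF]
      simp only
      rw [LSeries.term_of_ne_zero hn, ← mul_assoc, ofReal_div, cpow_neg,
        div_cpow_ofReal_nonneg hn'.le hy.le, ofReal_natCast, inv_div]
      ring
  have e2 : (∫ t : ℝ, ((y : ℂ) ^ ((σ : ℂ) + t * I) * LSeries c ((σ : ℂ) + t * I)) *
      (1 / (((σ : ℂ) + t * I) * ((σ : ℂ) + t * I + 1)))) = ∫ t, ∑' n, F n t := by
    congr 1
    ext t
    simp only [hF]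
    rw [tsum_mul_right, tsum_mul_left, LSeries]
  rw [e1, e2]
  exact h

variable {q : ℕ} [NeZero q]

lemma tsum_residueClass_mul_hat {a : ZMod q} (ha : IsUnit a) {σ y : ℝ} (hσ : 1 < σ) (hy : 0 < y) :
    ∑' n : ℕ, (ArithmeticFunction.vonMangoldt.residueClass a n : ℂ) * hat (n / y) -
      (q.totient : ℂ)⁻¹ * hatPole (1 / y) = (1 / (2 * Real.pi) : ℝ) • ∫ t : ℝ,
        ((y : ℂ) ^ ((σ : ℂ) + t * I) * residueAux a ((σ : ℂ) + t * I)) *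
          (1 / (((σ : ℂ) + t * I) * ((σ : ℂ) + t * I + 1))) := by
  have hy0 : (y : ℂ) ≠ 0 := by exact_mod_cast hy.ne'
  have hc := LSeriesSummable_residueClass a (s := σ) (by simpa using hσ)
  have hσ' : 1 / 2 ≤ σ := by linarith
  have hyc : Continuous fun t : ℝ ↦ (y : ℂ) ^ ((σ : ℂ) + t * I) :=
    continuous_cpow_line hy0 σ
  have h1 : ∀ t : ℝ, σ - 1 ≤ ‖(σ : ℂ) + t * I - 1‖ := fun t ↦ by
    simpa using (le_abs_self _).trans (abs_re_le_norm ((σ : ℂ) + t * I - 1))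
  have i1 := integrable_bounded_mul hσ' (F := fun t ↦ (y : ℂ) ^ ((σ : ℂ) + t * I) * LSeries
      (fun n ↦ (ArithmeticFunction.vonMangoldt.residueClass a n : ℂ)) ((σ : ℂ) + t * I))
    (hyc.mul (continuous_LSeries_line hc))
    (B := y ^ σ * ∑' n, ‖LSeries.term
      (fun n ↦ (ArithmeticFunction.vonMangoldt.residueClass a n : ℂ)) σ n‖) fun t ↦ by
      rw [norm_mul, norm_ofReal_cpow_line hy]
      gcongr
      exact norm_LSeries_line_le hc t
  have i2 := integrable_bounded_mul hσ'
    (F := fun t ↦ (q.totient : ℂ)⁻¹ * ((y : ℂ) ^ ((σ : ℂ) + t * I) * (1 / ((σ : ℂ) + t * I - 1))))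
    (continuous_const.mul (hyc.mul (continuous_const.div (by fun_prop) fun t h0 ↦ by
        have := h1 t
        rw [h0, norm_zero] at this
        linarith)))
    (B := ‖(q.totient : ℂ)⁻¹‖ * (y ^ σ * (1 / (σ - 1)))) fun t ↦ by
      rw [norm_mul, norm_mul, norm_ofReal_cpow_line hy, norm_div, norm_one]
      have := h1 t
      have : 0 < σ - 1 := by linarith
      gcongr
  rw [(hasSum_hat hσ' hc hy).tsum_eq, hatPole_eq_integral hσ (by positivity), mul_smul_comm,
    ← integral_const_mul, ← smul_sub]
  congr 1
  have e : ∀ t : ℝ, (q.totient : ℂ)⁻¹ * ((((1 / y : ℝ) : ℂ)) ^ (-((σ : ℂ) + t * I)) *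
      (1 / ((σ : ℂ) + t * I - 1)) * (1 / (((σ : ℂ) + t * I) * ((σ : ℂ) + t * I + 1)))) =
      (q.totient : ℂ)⁻¹ * ((y : ℂ) ^ ((σ : ℂ) + t * I) * (1 / ((σ : ℂ) + t * I - 1))) *
        (1 / (((σ : ℂ) + t * I) * ((σ : ℂ) + t * I + 1))) := fun t ↦ by
    rw [one_div y, ofReal_inv, cpow_neg, inv_cpow, inv_inv]
    · ring
    · rw [arg_ofReal_of_nonneg hy.le]; exact Real.pi_ne_zero.symm
  simp only [e]
  rw [← integral_sub i1 i2]
  congr 1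
  ext t
  rw [residueAux_eq ha (by simpa using hσ)]
  ring

end PerronSum

section Contour

open Complex Filter Topology MeasureTheory Set

lemma arctan_le_self {x : ℝ} (hx : 0 ≤ x) : Real.arctan x ≤ x := by
  rcases hx.eq_or_lt with rfl | hx
  · simp
  · calc Real.arctan x ≤ Real.tan (Real.arctan x) :=
        Real.le_tan (Real.arctan_pos.mpr hx).le (Real.arctan_lt_pi_div_two x)
      _ = x := Real.tan_arctan x

lemma pi_sub_two_mul_arctan_le {T : ℝ} (hT : 0 < T) : Real.pi - 2 * Real.arctan T ≤ 2 / T := by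
  have h := Real.arctan_inv_of_pos hT
  have h2 := arctan_le_self (inv_pos.mpr hT).le
  rw [h] at h2
  rw [div_eq_mul_inv]
  linarith

lemma norm_integral_line_le {G : ℂ → ℂ} {σ₁ σ₀ T M y : ℝ} (h₁ : 1 / 2 ≤ σ₁) (h₁₀ : σ₁ ≤ σ₀)
    (h₀₁ : σ₀ ≤ σ₁ + 1) (hT : 1 ≤ T) (hy : 1 ≤ y)
    (hd : ∀ s : ℂ, σ₁ ≤ s.re → s.re ≤ σ₀ → |s.im| ≤ T → DifferentiableAt ℂ G s)
    (hM : ∀ s : ℂ, σ₁ ≤ s.re → s.re ≤ σ₀ → |s.im| ≤ T → ‖G s‖ ≤ M)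
    (hL : ∀ t : ℝ, ‖G ((σ₀ : ℂ) + t * I)‖ ≤ M)
    (hc : Continuous fun t : ℝ ↦ G ((σ₀ : ℂ) + t * I)) :
    ‖∫ t : ℝ, ((y : ℂ) ^ ((σ₀ : ℂ) + t * I) * G ((σ₀ : ℂ) + t * I)) *
      (1 / (((σ₀ : ℂ) + t * I) * ((σ₀ : ℂ) + t * I + 1)))‖ ≤
      M * (4 * Real.pi * y ^ σ₁ + 16 * y ^ σ₀ / T) := by
  have hy0 : 0 < y := by linarith
  have hyc : (y : ℂ) ≠ 0 := by exact_mod_cast hy0.ne'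
  have hT0 : 0 < T := by linarith
  have hM0 : 0 ≤ M := (norm_nonneg _).trans (hL 0)
  set F : ℂ → ℂ := fun s ↦ ((y : ℂ) ^ s * G s) * (1 / (s * (s + 1))) with hF
  have hFd : ∀ s : ℂ, σ₁ ≤ s.re → s.re ≤ σ₀ → |s.im| ≤ T → DifferentiableAt ℂ F s := by
    intro s hs1 hs2 hs3
    have hs0 : s ≠ 0 := fun h ↦ by simp [h] at hs1; linarith
    have hs0' : s + 1 ≠ 0 := fun h ↦ by
      have := congrArg re h; simp at this; linarith
    refine ((differentiableAt_id.const_cpow (Or.inl hyc)).mul (hd s hs1 hs2 hs3)).mul ?_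
    exact (differentiableAt_const _).div (by fun_prop) (mul_ne_zero hs0 hs0')
  have hFn : ∀ σ t : ℝ, 1 / 2 ≤ σ → ‖G ((σ : ℂ) + t * I)‖ ≤ M →
      ‖F ((σ : ℂ) + t * I)‖ ≤ y ^ σ * M * 4 * (1 + t ^ 2)⁻¹ := by
    intro σ t hσ hG
    simp only [hF]
    rw [norm_mul, norm_mul, norm_ofReal_cpow_line hy0, mul_assoc (y ^ σ * M)]
    gcongr
    exact norm_inv_mul_add_one_le hσ t
  have hInt : Integrable fun t : ℝ ↦ F ((σ₀ : ℂ) + t * I) :=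
    integrable_bounded_mul (by linarith)
      (F := fun t ↦ (y : ℂ) ^ ((σ₀ : ℂ) + t * I) * G ((σ₀ : ℂ) + t * I))
      ((continuous_cpow_line hyc σ₀).mul hc) (B := y ^ σ₀ * M) fun t ↦ by
        rw [norm_mul, norm_ofReal_cpow_line hy0]
        gcongr
        exact hL t
  have hTT : -T ≤ T := by linarith
  have hsplit := integral_add_compl (s := Ioc (-T) T) measurableSet_Ioc hInt
  rw [← intervalIntegral.integral_of_le hTT] at hsplit
  have htail : ‖∫ t in (Ioc (-T) T)ᶜ, F ((σ₀ : ℂ) + t * I)‖ ≤ M * (8 * y ^ σ₀ / T) := by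
    have h1 : ‖∫ t in (Ioc (-T) T)ᶜ, F ((σ₀ : ℂ) + t * I)‖ ≤
        ∫ t in (Ioc (-T) T)ᶜ, y ^ σ₀ * M * 4 * (1 + t ^ 2)⁻¹ :=
      norm_integral_le_of_norm_le (integrable_inv_one_add_sq.const_mul _).integrableOn
        (ae_of_all _ fun t ↦ hFn σ₀ t (by linarith) (hL t))
    have h2 := integral_add_compl (s := Ioc (-T) T) measurableSet_Ioc integrable_inv_one_add_sq
    rw [← intervalIntegral.integral_of_le hTT, integral_inv_one_add_sq, Real.arctan_neg,
      integral_univ_inv_one_add_sq] at h2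
    have h3 := pi_sub_two_mul_arctan_le hT0
    rw [integral_const_mul] at h1
    calc _ ≤ _ := h1
      _ ≤ y ^ σ₀ * M * 4 * (2 / T) := by gcongr; linarith
      _ = _ := by ring
  have hvert : ‖∫ t in (-T)..T, F ((σ₁ : ℂ) + t * I)‖ ≤ M * (4 * Real.pi * y ^ σ₁) := by
    have h1 : ‖∫ t in (-T)..T, F ((σ₁ : ℂ) + t * I)‖ ≤
        ∫ t in (-T)..T, y ^ σ₁ * M * 4 * (1 + t ^ 2)⁻¹ :=
      intervalIntegral.norm_integral_le_of_norm_le hTT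
        (ae_of_all _ fun t ht ↦ hFn σ₁ t h₁ (hM _ (by simp) (by simpa using h₁₀)
          (by simpa [abs_le] using ⟨ht.1.le, ht.2⟩)))
        (integrable_inv_one_add_sq.const_mul _).intervalIntegrable
    rw [intervalIntegral.integral_const_mul, integral_inv_one_add_sq, Real.arctan_neg] at h1
    have h3 := Real.arctan_lt_pi_div_two T
    calc _ ≤ _ := h1
      _ ≤ y ^ σ₁ * M * 4 * Real.pi := by gcongr; linarith
      _ = _ := by ring
  have hhor : ∀ t : ℝ, |t| = T → ‖∫ σ in σ₁..σ₀, F ((σ : ℂ) + t * I)‖ ≤ M * (4 * y ^ σ₀ / T) := by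
    intro t ht
    have h1 : ‖∫ σ in σ₁..σ₀, F ((σ : ℂ) + t * I)‖ ≤ M * (4 * y ^ σ₀ / T) * |σ₀ - σ₁| := by
      refine intervalIntegral.norm_integral_le_of_norm_le_const fun σ hσ ↦ ?_
      rw [uIoc_of_le h₁₀] at hσ
      have ht2 : t ^ 2 = T ^ 2 := by rw [← sq_abs, ht]
      calc _ ≤ _ := hFn σ t (by linarith [hσ.1]) (hM _ (by simpa using hσ.1.le)
            (by simpa using hσ.2) (by simpa using ht.le))
        _ ≤ y ^ σ₀ * M * 4 * T⁻¹ := by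
            gcongr
            · exact hσ.2
            · rw [ht2]; nlinarith
        _ = _ := by ring
    refine h1.trans (mul_le_of_le_one_right (by positivity) ?_)
    rw [abs_of_nonneg (by linarith)]
    linarith
  have hrect := integral_boundary_rect_eq_zero_of_differentiableOn F
    ((σ₁ : ℂ) + ((-T : ℝ) : ℂ) * I) ((σ₀ : ℂ) + (T : ℂ) * I) (fun s hs ↦ by
      simp only [add_re, ofReal_re, mul_re, I_re, mul_zero, ofReal_im, I_im, mul_one, sub_self,
        add_zero, add_im, mul_im, zero_add, mem_reProdIm, uIcc_of_le h₁₀, uIcc_of_le hTT] at hs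
      exact (hFd s hs.1.1 hs.1.2 (abs_le.mpr hs.2)).differentiableWithinAt)
  simp only [add_re, ofReal_re, mul_re, I_re, mul_zero, ofReal_im, I_im, mul_one, sub_self,
    add_zero, add_im, mul_im, zero_add, smul_eq_mul] at hrect
  have hb := hhor (-T) (by rw [abs_neg, abs_of_pos hT0])
  have ht := hhor T (abs_of_pos hT0)
  have hshift : ∫ t in (-T)..T, F ((σ₀ : ℂ) + t * I) = (∫ t in (-T)..T, F ((σ₁ : ℂ) + t * I)) +
      I * ((∫ σ in σ₁..σ₀, F ((σ : ℂ) + ((-T : ℝ) : ℂ) * I)) -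
        ∫ σ in σ₁..σ₀, F ((σ : ℂ) + T * I)) := by
    linear_combination (-I) * hrect + ((∫ t in (-T)..T, F ((σ₀ : ℂ) + t * I)) -
      ∫ t in (-T)..T, F ((σ₁ : ℂ) + t * I)) * I_sq
  change ‖∫ t : ℝ, F ((σ₀ : ℂ) + t * I)‖ ≤ _
  rw [← hsplit, hshift]
  calc _ ≤ ‖∫ t in (-T)..T, F ((σ₁ : ℂ) + t * I)‖ +
        (‖∫ σ in σ₁..σ₀, F ((σ : ℂ) + ((-T : ℝ) : ℂ) * I)‖ +
          ‖∫ σ in σ₁..σ₀, F ((σ : ℂ) + T * I)‖) +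
        ‖∫ t in (Ioc (-T) T)ᶜ, F ((σ₀ : ℂ) + t * I)‖ := by
        refine (norm_add_le _ _).trans (add_le_add (norm_add_le_of_le le_rfl ?_) le_rfl)
        rw [norm_mul, norm_I, one_mul]
        exact norm_sub_le _ _
    _ ≤ M * (4 * Real.pi * y ^ σ₁) + (M * (4 * y ^ σ₀ / T) + M * (4 * y ^ σ₀ / T)) +
        M * (8 * y ^ σ₀ / T) := by gcongr
    _ = _ := by ring

end Contour

section SmoothPsi

open Complex Filter Topology MeasureTheory Set

open ArithmeticFunction.vonMangoldt (residueClass)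

variable {q : ℕ}

/-- The Cesàro-type sum `∑ Λ(n) (y - n)` over `n ≤ y`, `n ≡ a`. -/
noncomputable def smoothPsi (a : ZMod q) (y : ℝ) : ℝ :=
  ∑ n ∈ Finset.range (⌊y⌋₊ + 1), residueClass a n * (y - n)

lemma tsum_residueClass_mul_hat_eq (a : ZMod q) {y : ℝ} (hy : 0 < y) :
    ∑' n : ℕ, (residueClass a n : ℂ) * hat (n / y) = ((smoothPsi a y / y : ℝ) : ℂ) := by
  rw [tsum_eq_sum (s := Finset.range (⌊y⌋₊ + 1))]
  · rw [smoothPsi, Finset.sum_div, ofReal_sum]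
    refine Finset.sum_congr rfl fun n hn ↦ ?_
    rcases Nat.eq_zero_or_pos n with rfl | hn0
    · simp [ArithmeticFunction.vonMangoldt.residueClass_apply_zero]
    · have hn0' : (0 : ℝ) < n := by exact_mod_cast hn0
      have hny : (n : ℝ) ≤ y :=
        (Nat.cast_le.mpr (Nat.lt_succ_iff.mp (Finset.mem_range.mp hn))).trans (Nat.floor_le hy.le)
      rw [hat_eq_max (div_pos hn0' hy), max_eq_left (by rw [sub_nonneg, div_le_one hy]; exact hny),
        ← ofReal_mul]
      congr 1
      field_simp
  · intro n hn
    have hn' : y < n := by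
      rw [Finset.mem_range, not_lt] at hn
      exact (Nat.lt_floor_add_one y).trans_le (by exact_mod_cast hn)
    rw [hat_eq_max (div_pos (hy.trans hn') hy),
      max_eq_right (by rw [sub_nonpos, one_le_div hy]; exact hn'.le)]
    simp

lemma smoothPsi_sub_eq [NeZero q] {a : ZMod q} (ha : IsUnit a) {σ y : ℝ} (hσ : 1 < σ) (hy : 1 ≤ y) :
    |smoothPsi a y - (q.totient : ℝ)⁻¹ * ((y - 1) ^ 2 / 2)| = y * ((1 / (2 * Real.pi)) *
      ‖∫ t : ℝ, ((y : ℂ) ^ ((σ : ℂ) + t * I) * residueAux a ((σ : ℂ) + t * I)) *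
          (1 / (((σ : ℂ) + t * I) * ((σ : ℂ) + t * I + 1)))‖) := by
  have hy0 : 0 < y := by linarith
  have h := congrArg norm (tsum_residueClass_mul_hat ha hσ hy0)
  rw [norm_smul, Real.norm_of_nonneg (by positivity)] at h
  rw [← h, tsum_residueClass_mul_hat_eq a hy0, hatPole_eq_max (by positivity), max_eq_left (by
    rw [sub_nonneg, div_le_one hy0]; exact hy), ← ofReal_natCast, ← ofReal_inv, ← ofReal_mul,
    ← ofReal_sub, norm_real, Real.norm_eq_abs, ← abs_of_pos hy0, ← abs_mul, abs_of_pos hy0]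
  congr 1
  field_simp

lemma continuous_residueAux_line [NeZero q] (a : ZMod q) {σ : ℝ} (hσ : 1 ≤ σ) :
    Continuous fun t : ℝ ↦ residueAux a ((σ : ℂ) + t * I) := by
  rw [continuous_iff_continuousAt]
  intro t
  have h := (differentiableAt_residueAux a (s := (σ : ℂ) + t * I) fun χ ↦
    entireL_ne_zero_of_one_le_re χ (by simpa using hσ)).continuousAt
  exact ContinuousAt.comp (f := fun t : ℝ ↦ (σ : ℂ) + t * I) h (by fun_prop)

lemma eventually_smoothPsi {A : ℝ} (hA : 0 < A) : ∀ᶠ l : ℝ in atTop,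
    ∀ q : ℕ, ∀ _ : NeZero q, (q : ℝ) ≤ l ^ A → ∀ (a : ZMod q), IsUnit a →
      ∀ y : ℝ, 1 ≤ y → y ≤ 2 * Real.exp (l ^ 2) →
      |smoothPsi a y - (q.totient : ℝ)⁻¹ * ((y - 1) ^ 2 / 2)| ≤
        Real.exp (2 * l ^ 2 - zeroFreeConst / 8 * l) := by
  have hκ := zeroFreeConst_pos
  have hκ1 := zeroFreeConst_le
  set κ := zeroFreeConst
  have hev := (isLittleO_pow_exp_pos_mul_atTop 2 (b := κ / 8) (by positivity)).bound
    (c := (64 * (1044 / κ))⁻¹) (by positivity)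
  filter_upwards [eventually_residueAux hA, eventually_norm_residueAux_line hA,
    eventually_ge_atTop (1 : ℝ), hev] with l h1 h2 hl hexp q hq0 hq a ha y hy hy'
  have hl0 : 0 < l := by linarith
  have hy0 : 0 < y := by linarith
  have hp2 : 0 < κ / 2 / l := by positivity
  have hp4 : 0 < κ / 4 / l := by positivity
  have hp2' : κ / 2 / l ≤ 1 / 2 := by
    rw [div_div, div_le_div_iff₀ (by positivity) (by norm_num)]; nlinarith
  have hp4' : κ / 4 / l ≤ 1 / 2 := by
    rw [div_div, div_le_div_iff₀ (by positivity) (by norm_num)]; nlinarith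
  rw [Real.norm_of_nonneg (by positivity), Real.norm_of_nonneg (by positivity),
    ← div_eq_inv_mul, le_div_iff₀ (by positivity)] at hexp
  have key := norm_integral_line_le (G := residueAux a) (σ₁ := 1 - κ / 4 / l)
    (σ₀ := 1 + κ / 2 / l) (T := Real.exp l) (M := 1044 / κ * l ^ 2) (y := y)
    (by linarith) (by linarith) (by linarith) (Real.one_le_exp hl0.le) hy
    (fun s hs1 hs2 hs3 ↦ (h1 q hq0 hq a s hs3 hs1 hs2).1)
    (fun s hs1 hs2 hs3 ↦ (h1 q hq0 hq a s hs3 hs1 hs2).2.trans (by gcongr; norm_num))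
    (fun t ↦ h2 q hq0 hq a _ ha (by simp; rfl))
    (continuous_residueAux_line a (by linarith))
  rw [smoothPsi_sub_eq ha (σ := 1 + κ / 2 / l) (by linarith) hy]
  have hpow : ∀ σ : ℝ, 0 ≤ σ → σ ≤ 2 → y ^ σ ≤ 4 * Real.exp (l ^ 2 * σ) := fun σ h0 h2 ↦ by
    calc y ^ σ ≤ (2 * Real.exp (l ^ 2)) ^ σ := by gcongr
      _ = 2 ^ σ * Real.exp (l ^ 2 * σ) := by
        rw [Real.mul_rpow (by norm_num) (Real.exp_pos _).le, ← Real.exp_mul]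
      _ ≤ 4 * Real.exp (l ^ 2 * σ) := by
        gcongr
        calc (2 : ℝ) ^ σ ≤ 2 ^ (2 : ℝ) := by gcongr; norm_num
          _ = 4 := by norm_num
  have hs1 := hpow (1 - κ / 4 / l) (by linarith) (by linarith)
  have hs0 := hpow (1 + κ / 2 / l) (by linarith) (by linarith)
  have e1 : l ^ 2 * (1 - κ / 4 / l) = l ^ 2 - κ / 4 * l := by field_simp
  have e0 : l ^ 2 * (1 + κ / 2 / l) = l ^ 2 + κ / 2 * l := by field_simp
  rw [e1] at hs1
  rw [e0] at hs0
  have hs0' : y ^ (1 + κ / 2 / l) / Real.exp l ≤ 4 * Real.exp (l ^ 2 - κ / 4 * l) := by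
    rw [div_le_iff₀ (Real.exp_pos _), mul_assoc, ← Real.exp_add]
    refine hs0.trans (mul_le_mul_of_nonneg_left (Real.exp_le_exp.mpr ?_) (by norm_num))
    nlinarith
  have hpi := Real.pi_gt_three
  set E := Real.exp (l ^ 2 - κ / 4 * l) with hE
  have hE0 : 0 < E := Real.exp_pos _
  set M := 1044 / κ * l ^ 2 with hM
  have hM0 : 0 < M := by positivity
  calc _ ≤ (2 * Real.exp (l ^ 2)) * ((1 / (2 * Real.pi)) *
        (M * (4 * Real.pi * (4 * E) + 16 * (4 * E)))) := by
        gcongr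
        refine key.trans ?_
        rw [mul_div_assoc]
        gcongr
    _ = Real.exp (l ^ 2) * M * E * (16 + 64 / Real.pi) := by field_simp; ring
    _ ≤ Real.exp (l ^ 2) * M * E * 64 := by
        gcongr
        have : 64 / Real.pi ≤ 64 / 3 := by gcongr
        linarith
    _ = Real.exp (l ^ 2) * E * (l ^ 2 * (64 * (1044 / κ))) := by rw [hM]; ring
    _ ≤ Real.exp (l ^ 2) * E * Real.exp (κ / 8 * l) := by gcongr
    _ = _ := by
        rw [hE, ← Real.exp_add, ← Real.exp_add]
        congr 1
        ring

end SmoothPsi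

section Desmooth

open Filter Topology MeasureTheory Set

open ArithmeticFunction.vonMangoldt (residueClass residueClass_nonneg residueClass_le)

variable {q : ℕ}

/-- The Chebyshev function `ψ` restricted to a residue class. -/
noncomputable def psiMod (a : ZMod q) (y : ℝ) : ℝ :=
  ∑ n ∈ Finset.range (⌊y⌋₊ + 1), residueClass a n

/-- The weights `log p` supported on primes in a residue class. -/
noncomputable def logPrimeMod (a : ZMod q) (n : ℕ) : ℝ :=
  if n.Prime ∧ (n : ZMod q) = a then Real.log n else 0

/-- The Chebyshev function `θ` restricted to a residue class. -/
noncomputable def thetaMod (a : ZMod q) (y : ℝ) : ℝ :=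
  ∑ n ∈ Finset.Icc 0 ⌊y⌋₊, logPrimeMod a n

lemma smoothPsi_eq_sum_max (a : ZMod q) {y : ℝ} (hy : 0 ≤ y) {N : ℕ} (hN : ⌊y⌋₊ + 1 ≤ N) :
    smoothPsi a y = ∑ n ∈ Finset.range N, residueClass a n * max (y - n) 0 := by
  rw [smoothPsi, ← Finset.sum_subset (Finset.range_subset_range.mpr hN)]
  · refine Finset.sum_congr rfl fun n hn ↦ ?_
    have hny : (n : ℝ) ≤ y :=
      (Nat.cast_le.mpr (Nat.lt_succ_iff.mp (Finset.mem_range.mp hn))).trans (Nat.floor_le hy)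
    rw [max_eq_left (by linarith)]
  · intro n _ hn
    have hn' : y < n := by
      rw [Finset.mem_range, not_lt] at hn
      exact (Nat.lt_floor_add_one y).trans_le (by exact_mod_cast hn)
    rw [max_eq_right (by linarith), mul_zero]

lemma smoothPsi_add_mul_psiMod_le (a : ZMod q) {y z : ℝ} (hz : 0 ≤ z) :
    smoothPsi a y + (z - y) * psiMod a y ≤ smoothPsi a z := by
  have hz' := smoothPsi_eq_sum_max a hz (N := max (⌊y⌋₊ + 1) (⌊z⌋₊ + 1)) (le_max_right _ _)
  rw [hz', smoothPsi, psiMod, Finset.mul_sum, ← Finset.sum_add_distrib]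
  calc _ ≤ ∑ n ∈ Finset.range (⌊y⌋₊ + 1), residueClass a n * max (z - n) 0 := by
        refine Finset.sum_le_sum fun n _ ↦ ?_
        calc _ = residueClass a n * (z - n) := by ring
          _ ≤ _ := mul_le_mul_of_nonneg_left (le_max_left _ _) (residueClass_nonneg a n)
    _ ≤ _ := Finset.sum_le_sum_of_subset_of_nonneg
        (Finset.range_subset_range.mpr (le_max_left _ _)) fun n _ _ ↦
        mul_nonneg (residueClass_nonneg a n) (le_max_right _ _)

lemma psiMod_nonneg (a : ZMod q) (y : ℝ) : 0 ≤ psiMod a y :=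
  Finset.sum_nonneg fun n _ ↦ residueClass_nonneg a n

lemma abs_psiMod_sub_le (a : ZMod q) {α h x E : ℝ} (hα : 0 ≤ α) (hα1 : α ≤ 1) (hh : 1 ≤ h)
    (hhx : h ≤ x) (hE : E ≤ h ^ 2)
    (hS : ∀ y, 1 ≤ y → y ≤ 2 * x → |smoothPsi a y - α * ((y - 1) ^ 2 / 2)| ≤ E)
    {y : ℝ} (hy : 1 ≤ y) (hyx : y ≤ x) : |psiMod a y - α * y| ≤ 4 * h := by
  have hh0 : 0 < h := by linarith
  have hψ := psiMod_nonneg a y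
  have hy1 := abs_le.mp (hS y hy (by linarith))
  rw [abs_le]
  constructor
  · rcases lt_or_ge y (h + 1) with hlt | hge
    · nlinarith
    · have h1 := smoothPsi_add_mul_psiMod_le a (y := y) (z := y - h) (by linarith)
      have h2 := abs_le.mp (hS (y - h) (by linarith) (by linarith))
      have h3 : h * (α * y - 4 * h) ≤ h * psiMod a y := by nlinarith
      linarith [le_of_mul_le_mul_left h3 hh0]
  · have h1 := smoothPsi_add_mul_psiMod_le a (y := y) (z := y + h) (by linarith)
    have h2 := abs_le.mp (hS (y + h) (by linarith) (by linarith))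
    have h3 : h * psiMod a y ≤ h * (α * y + 4 * h) := by nlinarith
    linarith [le_of_mul_le_mul_left h3 hh0]

lemma abs_psiMod_sub_thetaMod_le (a : ZMod q) {y : ℝ} (hy : 1 ≤ y) :
    |psiMod a y - thetaMod a y| ≤ 2 * √y * Real.log y := by
  have h0 : psiMod a y - thetaMod a y =
      ∑ n ∈ Finset.range (⌊y⌋₊ + 1), (residueClass a n - logPrimeMod a n) := by
    rw [psiMod, thetaMod, Finset.sum_sub_distrib, Nat.range_succ_eq_Icc_zero]
  have hnn : ∀ n, 0 ≤ residueClass a n - logPrimeMod a n ∧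
      residueClass a n - logPrimeMod a n ≤ if ¬ n.Prime then ArithmeticFunction.vonMangoldt n else 0 := by
    intro n
    have h1 := residueClass_nonneg a n
    have h2 := residueClass_le a n
    by_cases hp : n.Prime
    · have : residueClass a n = logPrimeMod a n := by
        rw [residueClass, logPrimeMod, indicator_apply]
        simp [hp, ArithmeticFunction.vonMangoldt_apply_prime hp]
      simp [hp, this]
    · simp [logPrimeMod, hp, h1, h2]
  rw [h0, abs_of_nonneg (Finset.sum_nonneg fun n _ ↦ (hnn n).1)]
  refine (Finset.sum_le_sum fun n _ ↦ (hnn n).2).trans ?_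
  refine le_trans (le_of_eq ?_) (Chebyshev.psi_sub_theta_le hy)
  rw [Chebyshev.psi_sub_theta_eq_sum_not_prime, Finset.sum_filter, Nat.range_succ_eq_Icc_zero,
    Finset.Icc_eq_cons_Ioc (Nat.zero_le _), Finset.sum_cons]
  simp

end Desmooth

section PartialSummation

open Filter Topology MeasureTheory Set Real

lemma abs_sum_div_log_sub_le {c : ℕ → ℝ} (h0 : c 0 = 0) (h1 : c 1 = 0) {α B y : ℝ} (hy : 2 ≤ y)
    (hα : 0 ≤ α) (hB : ∀ t, 2 ≤ t → t ≤ y → |∑ n ∈ Finset.Icc 0 ⌊t⌋₊, c n - α * t| ≤ B) :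
    |∑ n ∈ Finset.Icc 0 ⌊y⌋₊, (log n)⁻¹ * c n - α * ∫ t in (2 : ℝ)..y, 1 / log t| ≤
      (B + 2 * α) / log 2 := by
  have hlog : ∀ t ∈ uIcc 2 y, 0 < log t := fun t ht ↦ by
    rw [uIcc_of_le hy] at ht
    exact log_pos (by linarith [ht.1])
  have hpos : ∀ t ∈ uIcc 2 y, 0 < t := fun t ht ↦ by
    rw [uIcc_of_le hy] at ht
    linarith [ht.1]
  have hcont : ContinuousOn (fun t ↦ log t) (uIcc 2 y) := fun t ht ↦
    (continuousAt_log (hpos t ht).ne').continuousWithinAt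
  have hi1 : IntervalIntegrable (fun t ↦ 1 / log t) volume 2 y :=
    (continuousOn_const.div hcont fun t ht ↦ (hlog t ht).ne').intervalIntegrable
  have hi2 : IntervalIntegrable (fun t ↦ (log t ^ 2)⁻¹) volume 2 y :=
    ((hcont.pow 2).inv₀ fun t ht ↦ pow_ne_zero 2 (hlog t ht).ne').intervalIntegrable
  have hci3 : ContinuousOn (fun t ↦ (t * log t ^ 2)⁻¹) (uIcc 2 y) :=
    (continuousOn_id.mul (hcont.pow 2)).inv₀ fun t ht ↦
      mul_ne_zero (hpos t ht).ne' (pow_ne_zero 2 (hlog t ht).ne')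
  have hi3 : IntervalIntegrable (fun t ↦ (t * log t ^ 2)⁻¹) volume 2 y := hci3.intervalIntegrable
  have hi4 : IntervalIntegrable (fun t ↦ (∑ n ∈ Finset.Icc 0 ⌊t⌋₊, c n) * (t * log t ^ 2)⁻¹)
      volume 2 y := by
    rw [intervalIntegrable_iff_integrableOn_Icc_of_le hy]
    simp only [mul_comm (∑ n ∈ Finset.Icc 0 ⌊_⌋₊, c n)]
    refine integrableOn_mul_sum_Icc _ (by norm_num) ?_
    rw [uIcc_of_le hy] at hci3
    exact hci3.integrableOn_Icc
  have hsum : ∑ n ∈ Finset.Icc 0 ⌊y⌋₊, (log n)⁻¹ * c n =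
      (log y)⁻¹ * (∑ n ∈ Finset.Icc 0 ⌊y⌋₊, c n) +
        ∫ t in (2 : ℝ)..y, (∑ n ∈ Finset.Icc 0 ⌊t⌋₊, c n) * (t * log t ^ 2)⁻¹ := by
    rw [sum_mul_eq_sub_integral_mul₁ c (f := fun n ↦ (log n)⁻¹) h0 h1,
      ← intervalIntegral.integral_of_le hy, sub_eq_add_neg, ← intervalIntegral.integral_neg]
    · congr 1
      refine intervalIntegral.integral_congr fun u _ ↦ ?_
      simp [field]
    · intro z hz
      rw [← uIcc_of_le hy] at hz
      exact (differentiableAt_log (hpos z hz).ne').inv (hlog z hz).ne'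
    · refine ContinuousOn.integrableOn_Icc ?_
      rw [← uIcc_of_le hy]
      refine (hci3.neg).congr fun z _ ↦ ?_
      rw [deriv_inv_log_apply, Pi.neg_apply, mul_inv, neg_div, div_eq_mul_inv]
  have hli : ∫ t in (2 : ℝ)..y, 1 / log t = y / log y - 2 / log 2 +
      ∫ t in (2 : ℝ)..y, (log t ^ 2)⁻¹ := by
    rw [← sub_eq_iff_eq_add, ← intervalIntegral.integral_sub hi1 hi2]
    refine intervalIntegral.integral_eq_sub_of_hasDerivAt (f := fun t ↦ t / log t)
      (fun t ht ↦ ?_) (hi1.sub hi2)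
    have h := (hasDerivAt_id t).div (hasDerivAt_log (hpos t ht).ne') (hlog t ht).ne'
    have ht0 := (hpos t ht).ne'
    have hlt0 := (hlog t ht).ne'
    have e : (1 * log t - id t * t⁻¹) / log t ^ 2 = 1 / log t - (log t ^ 2)⁻¹ := by
      rw [id, mul_inv_cancel₀ ht0]
      field_simp
    rw [e] at h
    exact h
  have hint3 : ∫ t in (2 : ℝ)..y, (t * log t ^ 2)⁻¹ = (log 2)⁻¹ - (log y)⁻¹ := by
    have := intervalIntegral.integral_eq_sub_of_hasDerivAt (f := fun t ↦ -(log t)⁻¹)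
      (f' := fun t ↦ (t * log t ^ 2)⁻¹) (a := 2) (b := y) (fun t ht ↦ by
        have h := ((hasDerivAt_log (hpos t ht).ne').inv (hlog t ht).ne').neg
        have e : -(-t⁻¹ / log t ^ 2) = (t * log t ^ 2)⁻¹ := by
          rw [neg_div, neg_neg, mul_inv, div_eq_mul_inv]
        rw [e] at h
        exact h) hi3
    rw [this]; ring
  have herr : |∫ t in (2 : ℝ)..y, ((∑ n ∈ Finset.Icc 0 ⌊t⌋₊, c n) * (t * log t ^ 2)⁻¹ -
      α * (log t ^ 2)⁻¹)| ≤ B * ((log 2)⁻¹ - (log y)⁻¹) := by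
    rw [← hint3, ← intervalIntegral.integral_const_mul, ← Real.norm_eq_abs]
    refine intervalIntegral.norm_integral_le_of_norm_le hy (ae_of_all _ fun t ht ↦ ?_)
      (hi3.const_mul _)
    have ht' : t ∈ uIcc 2 y := by rw [uIcc_of_le hy]; exact ⟨ht.1.le, ht.2⟩
    have hp := hpos t ht'
    have hl := hlog t ht'
    have e : (∑ n ∈ Finset.Icc 0 ⌊t⌋₊, c n) * (t * log t ^ 2)⁻¹ - α * (log t ^ 2)⁻¹ =
        (∑ n ∈ Finset.Icc 0 ⌊t⌋₊, c n - α * t) * (t * log t ^ 2)⁻¹ := by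
      field_simp
    rw [e, Real.norm_eq_abs, abs_mul, abs_of_pos (a := (t * log t ^ 2)⁻¹) (by positivity)]
    gcongr
    exact hB t ht.1.le ht.2
  rw [intervalIntegral.integral_sub hi4 (hi2.const_mul α),
    intervalIntegral.integral_const_mul] at herr
  have hly := hlog y right_mem_uIcc
  have hl2 : 0 < log 2 := log_pos one_lt_two
  have hBy : |(log y)⁻¹ * (∑ n ∈ Finset.Icc 0 ⌊y⌋₊, c n - α * y)| ≤ (log y)⁻¹ * B := by
    rw [abs_mul, abs_of_pos (inv_pos.mpr hly)]
    gcongr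
    exact hB y hy le_rfl
  rw [hsum, hli]
  rw [abs_le] at *
  have e1 : (B + 2 * α) / log 2 = B * (log 2)⁻¹ + α * (2 / log 2) := by field_simp
  have e2 : y / log y = (log y)⁻¹ * y := by field_simp
  have h3 : 0 ≤ α * (2 / log 2) := by positivity
  rw [e1, e2]
  constructor <;> nlinarith

end PartialSummation

section Final

open Filter Topology MeasureTheory Set Real

lemma primePiMod_eq_sum (y : ℝ) (q : ℕ) (a : ℤ) :
    (primePiMod y q a : ℝ) =
      ∑ n ∈ Finset.Icc 0 ⌊y⌋₊, (log n)⁻¹ * logPrimeMod (a : ZMod q) n := by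
  rw [primePiMod, Finset.card_filter, Nat.cast_sum, Finset.Icc_eq_cons_Ioc (Nat.zero_le _),
    Finset.sum_cons]
  simp only [Nat.cast_zero, log_zero, inv_zero, zero_mul, zero_add]
  refine Finset.sum_congr rfl fun n _ ↦ ?_
  have hiff : (n : ℤ) ≡ a [ZMOD q] ↔ (n : ZMod q) = a := by
    rw [← ZMod.intCast_eq_intCast_iff, Int.cast_natCast]
  rw [logPrimeMod]
  by_cases h : n.Prime ∧ (n : ZMod q) = a
  · have hlog : log n ≠ 0 := (log_pos (by exact_mod_cast h.1.one_lt)).ne'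
    have h' : n.Prime ∧ (n : ℤ) ≡ a [ZMOD q] := ⟨h.1, hiff.mpr h.2⟩
    rw [if_pos h', if_pos h, inv_mul_cancel₀ hlog, Nat.cast_one]
  · have h' : ¬(n.Prime ∧ (n : ℤ) ≡ a [ZMOD q]) := fun H ↦ h ⟨H.1, hiff.mp H.2⟩
    rw [if_neg h', if_neg h, mul_zero, Nat.cast_zero]

lemma inv_totient_le_one {q : ℕ} (hq : 0 < q) : (q.totient : ℝ)⁻¹ ≤ 1 :=
  inv_le_one_of_one_le₀ (by exact_mod_cast Nat.totient_pos.mpr hq)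

lemma abs_primePiMod_sub_le_three_mul {y : ℝ} (hy : 2 ≤ y) {q : ℕ} (hq : 0 < q) (a : ℤ) :
    |(primePiMod y q a : ℝ) - (1 / (Nat.totient q)) * ∫ t in (2 : ℝ)..y, 1 / log t| ≤ 3 * y := by
  have h1 : (primePiMod y q a : ℝ) ≤ y := by
    have h : primePiMod y q a ≤ ⌊y⌋₊ := by
      rw [primePiMod]
      exact (Finset.card_filter_le _ _).trans (by simp)
    exact (Nat.cast_le.mpr h).trans (Nat.floor_le (by linarith))
  have hl2 : (1 : ℝ) / 2 < log 2 := by linarith [log_two_gt_d9]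
  have h2 : ‖∫ t in (2 : ℝ)..y, 1 / log t‖ ≤ 2 * |y - 2| := by
    refine intervalIntegral.norm_integral_le_of_norm_le_const fun t ht ↦ ?_
    rw [uIoc_of_le hy] at ht
    have h3 : log 2 ≤ log t := log_le_log (by norm_num) ht.1.le
    rw [Real.norm_of_nonneg (one_div_nonneg.mpr (by linarith)), div_le_iff₀ (by linarith)]
    linarith
  rw [abs_of_nonneg (by linarith)] at h2
  have h4 : ‖(1 / (Nat.totient q) : ℝ) * ∫ t in (2 : ℝ)..y, 1 / log t‖ ≤ 2 * (y - 2) := by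
    rw [norm_mul, one_div, Real.norm_of_nonneg (by positivity)]
    exact (mul_le_of_le_one_left (norm_nonneg _) (inv_totient_le_one hq)).trans h2
  have h5 : (0 : ℝ) ≤ primePiMod y q a := Nat.cast_nonneg _
  rw [Real.norm_eq_abs, abs_le] at h4
  rw [abs_le]
  constructor <;> linarith

lemma eventually_primePiMod {A : ℝ} (hA : 0 < A) : ∀ᶠ l : ℝ in atTop,
    ∀ q : ℕ, 0 < q → (q : ℝ) ≤ l ^ A → ∀ a : ℤ, IsCoprime a (q : ℤ) →
      ∀ y : ℝ, 2 ≤ y → y ≤ exp (l ^ 2) →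
      |(primePiMod y q a : ℝ) - (1 / (Nat.totient q)) * ∫ t in (2 : ℝ)..y, 1 / log t| ≤
        14 * exp (l ^ 2 - zeroFreeConst / 16 * l) := by
  have hκ := zeroFreeConst_pos
  have hκ1 := zeroFreeConst_le
  have hev := (isLittleO_pow_exp_pos_mul_atTop 2 (b := 1 / 4) (by positivity)).bound
    (c := 1 / 2) (by positivity)
  filter_upwards [eventually_smoothPsi hA, eventually_ge_atTop (1 : ℝ), hev]
    with l hl hl1 hexp q hq0 hq a ha y hy hyx
  have hq0' : NeZero q := ⟨hq0.ne'⟩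
  have hu : IsUnit (a : ZMod q) := (ZMod.coe_int_isUnit_iff_isCoprime a q).mpr ha.symm
  rw [Real.norm_of_nonneg (by positivity), Real.norm_of_nonneg (by positivity)] at hexp
  set κ := zeroFreeConst
  set h := exp (l ^ 2 - κ / 16 * l) with hh
  have hh1 : 1 ≤ h := one_le_exp (by nlinarith)
  have hhx : h ≤ exp (l ^ 2) := exp_le_exp.mpr (by nlinarith)
  have hE : exp (2 * l ^ 2 - κ / 8 * l) ≤ h ^ 2 := by
    rw [hh, ← exp_nat_mul]
    refine exp_le_exp.mpr (le_of_eq ?_)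
    push_cast
    ring
  have hα : (0 : ℝ) ≤ (q.totient : ℝ)⁻¹ := by positivity
  have hα1 := inv_totient_le_one hq0
  have hsq : 2 * √(exp (l ^ 2)) * log (exp (l ^ 2)) ≤ h := by
    rw [log_exp, ← exp_half]
    calc 2 * exp (l ^ 2 / 2) * l ^ 2 ≤ 2 * exp (l ^ 2 / 2) * (1 / 2 * exp (1 / 4 * l)) := by gcongr
      _ = exp (l ^ 2 / 2 + 1 / 4 * l) := by rw [exp_add]; ring
      _ ≤ h := exp_le_exp.mpr (by nlinarith)
  have hθ : ∀ t, 2 ≤ t → t ≤ y → |∑ n ∈ Finset.Icc 0 ⌊t⌋₊, logPrimeMod (a : ZMod q) n -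
      (q.totient : ℝ)⁻¹ * t| ≤ 5 * h := by
    intro t ht hty
    have h1 := abs_psiMod_sub_le (a : ZMod q) hα hα1 hh1 hhx hE
      (fun y h1 h2 ↦ hl q hq0' hq a hu y h1 h2) (y := t) (by linarith) (hty.trans hyx)
    have h2 := abs_psiMod_sub_thetaMod_le (a : ZMod q) (y := t) (by linarith)
    have h3 : 2 * √t * log t ≤ 2 * √(exp (l ^ 2)) * log (exp (l ^ 2)) := by
      have h5 : t ≤ exp (l ^ 2) := hty.trans hyx
      have : 0 ≤ log t := log_nonneg (by linarith)
      gcongr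
    have h4 := h2.trans (h3.trans hsq)
    rw [abs_le] at *
    change -(5 * h) ≤ thetaMod (a : ZMod q) t - _ ∧ thetaMod (a : ZMod q) t - _ ≤ _
    constructor <;> linarith
  have key := abs_sum_div_log_sub_le (c := logPrimeMod (a : ZMod q)) (by simp [logPrimeMod])
    (by simp [logPrimeMod]) hy hα hθ
  rw [← primePiMod_eq_sum, ← one_div (q.totient : ℝ)] at key
  refine key.trans ?_
  have hl2 : (1 : ℝ) / 2 < log 2 := by linarith [log_two_gt_d9]
  rw [div_le_iff₀ (by linarith), one_div]
  nlinarith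

end Final

/-- **Uniform Siegel–Walfisz theorem.** For every `C > 0` there are `D = D(C) > 0`
and an implied constant depending only on `C` such that for all `x ≥ 2`,
`2 ≤ y ≤ x`, `q ≤ (log x)^C` and `a` coprime to `q`,
`π(y; q, a) = (1/φ(q)) ∫_2^y dt/log t + O(x e^(-D √(log x)))`. -/
theorem siegel_walfisz_uniform (C : ℝ) (hC : 0 < C) :
    ∃ D : ℝ, 0 < D ∧ ∃ K : ℝ, 0 < K ∧
      ∀ x : ℝ, 2 ≤ x → ∀ y : ℝ, 2 ≤ y → y ≤ x →
        ∀ q : ℕ, 0 < q → (q : ℝ) ≤ Real.log x ^ C →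
          ∀ a : ℤ, IsCoprime a (q : ℤ) →
            |(primePiMod y q a : ℝ) - (1 / (Nat.totient q)) * ∫ t in (2 : ℝ)..y, 1 / Real.log t|
              ≤ K * x * Real.exp (-D * Real.sqrt (Real.log x)) := by
  obtain ⟨l₀, hl₀⟩ := Filter.eventually_atTop.mp (eventually_primePiMod (A := 2 * C) (by positivity))
  have hκ := zeroFreeConst_pos
  refine ⟨zeroFreeConst / 16, by positivity, 14 + 3 * Real.exp (zeroFreeConst / 16 * l₀),
    by positivity, fun x hx y hy hyx q hq hqx a ha ↦ ?_⟩
  have hx0 : 0 < x := by linarith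
  have hlog : 0 ≤ Real.log x := Real.log_nonneg (by linarith)
  set l := Real.sqrt (Real.log x) with hl
  have hl0 : 0 ≤ l := Real.sqrt_nonneg _
  have hl2 : l ^ 2 = Real.log x := Real.sq_sqrt hlog
  have hxl : Real.exp (l ^ 2) = x := by rw [hl2, Real.exp_log hx0]
  rcases le_or_gt l₀ l with h | h
  · have hq' : (q : ℝ) ≤ l ^ (2 * C) := by
      rw [Real.rpow_mul hl0, Real.rpow_two, hl2]
      exact hqx
    refine (hl₀ l h q hq hq' a ha y hy (by rwa [hxl])).trans ?_
    rw [sub_eq_add_neg, Real.exp_add, hxl, ← mul_assoc, neg_mul]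
    gcongr
    linarith [Real.exp_pos (zeroFreeConst / 16 * l₀)]
  · refine (abs_primePiMod_sub_le_three_mul hy hq a).trans ?_
    have h1 : 1 ≤ Real.exp (zeroFreeConst / 16 * l₀) * Real.exp (-(zeroFreeConst / 16) * l) := by
      rw [← Real.exp_add]
      refine Real.one_le_exp ?_
      nlinarith
    have h2 := Real.exp_pos (-(zeroFreeConst / 16) * l)
    calc 3 * y ≤ 3 * x * 1 := by linarith
      _ ≤ 3 * x * (Real.exp (zeroFreeConst / 16 * l₀) * Real.exp (-(zeroFreeConst / 16) * l)) := by
        gcongr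
      _ ≤ 14 * x * Real.exp (-(zeroFreeConst / 16) * l) + 3 * x *
          (Real.exp (zeroFreeConst / 16 * l₀) * Real.exp (-(zeroFreeConst / 16) * l)) :=
        le_add_of_nonneg_left (by positivity)
      _ = _ := by ring
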